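/- arXiv:math/0507256 — 2 statements merged into one kernel-verified Lean document; each statement's English description precedes it below -/
import Mathlib

section
/- There exists a map I which to every rational polyhedron p in V associates a meromorphic function I(p) on the complexified dual space V* with rational Taylor coefficients, such that: (a) if p contains a straight line then I(p)=0; (b) for every ξ ∈ V* such that |e^{⟨ξ,x⟩}| is integrable over p one has I(p)(ξ) = ∫_p e^{⟨ξ,x⟩} dm_{<p>}(x), where dm_{<p>} is the canonical Lebesgue measure on the affine span <p> of p; (c) for every rational point s ∈ V_ℚ, I(s+p)(ξ) = e^{⟨ξ,s⟩} I(p)(ξ); (d) I is a solid valuation: whenever polyhedra p_i satisfy a linear relation Σ_i r_i χ(p_i)=0 among their characteristic functions, the functions satisfy Σ_{i : <p_i>=V} r_i I(p_i) = 0. -/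
open MeasureTheory Filter Topology Set
open scoped RealInnerProductSpace Pointwise BigOperators

noncomputable section

/-- the ambient rational vector space: `ℝ^d` with the standard inner product, which is used
to identify `V` with its dual space `V^*`. -/
abbrev Vd (d : ℕ) := EuclideanSpace ℝ (Fin d)

variable {d : ℕ}

/-- the duality pairing `⟨ξ, x⟩` between `V^*` and `V`, realized by the standard inner
product of `ℝ^d`. -/
def pairE {d : ℕ} (ξ x : Vd d) : ℝ := @inner ℝ _ _ ξ x

/-- `Λ` is a lattice of its span: it is generated by finitely many `ℝ`-independent vectors. -/
def IsLatticeSub (Λ : AddSubgroup (Vd d)) : Prop :=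
  ∃ (k : ℕ) (v : Fin k → Vd d), LinearIndependent ℝ v ∧
    Λ = AddSubgroup.closure (Set.range v)

/-- `Λ` is a full-rank lattice in `ℝ^d`. -/
def IsFullLattice (Λ : AddSubgroup (Vd d)) : Prop :=
  IsLatticeSub Λ ∧ Submodule.span ℝ (Λ : Set (Vd d)) = ⊤

/-- `x` is a rational point with respect to the lattice `Λ`. -/
def IsRatPoint (Λ : AddSubgroup (Vd d)) (x : Vd d) : Prop :=
  ∃ q : ℤ, q ≠ 0 ∧ (q : ℝ) • x ∈ Λ

/-- viewing `φ ∈ V` as a linear functional via the standard pairing, it takes integer values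
on `Λ`, i.e. it belongs to the dual lattice. -/
def IsDualIntegral (Λ : AddSubgroup (Vd d)) (φ : Vd d) : Prop :=
  ∀ x ∈ Λ, ∃ n : ℤ, (pairE (φ) (x)) = (n : ℝ)

/-- a rational polyhedron (inside the span of `Λ`): a finite intersection of half-spaces
bounded by rational affine hyperplanes. -/
def IsRatPolyhedron (Λ : AddSubgroup (Vd d)) (P : Set (Vd d)) : Prop :=
  ∃ (n : ℕ) (φ : Fin n → Vd d) (c : Fin n → ℚ),
    (∀ i, IsDualIntegral Λ (φ i)) ∧
    P = {x | x ∈ Submodule.span ℝ (Λ : Set (Vd d)) ∧ ∀ i, (pairE (φ i) x) ≤ (c i : ℝ)}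

/-- the set `P` contains a straight (affine) line. -/
def ContainsLine (P : Set (Vd d)) : Prop :=
  ∃ x u : Vd d, u ≠ 0 ∧ ∀ t : ℝ, x + t • u ∈ P

/-- equality of meromorphic-type functions near `0`: they agree near `0` outside a closed
set with empty interior (the polar set). -/
def MeroEqAt0 (f g : Vd d → ℝ) : Prop :=
  ∃ Z : Set (Vd d), IsClosed Z ∧ interior Z = ∅ ∧
    ∀ᶠ ξ in 𝓝 (0 : Vd d), ξ ∉ Z → f ξ = g ξ

/-- `g` is analytic at `0` and its Taylor coefficients are rational with respect to an
integral basis (i.e. the coefficients take rational values on dual-lattice vectors). -/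
def HasRatSeriesAt0 (Λ : AddSubgroup (Vd d)) (g : Vd d → ℝ) : Prop :=
  ∃ p : FormalMultilinearSeries ℝ (Vd d) ℝ, HasFPowerSeriesAt g p 0 ∧
    ∀ (n : ℕ) (w : Fin n → Vd d), (∀ i, IsDualIntegral Λ (w i)) →
      ∃ q : ℚ, (p n) w = (q : ℝ)

/-- `f` is meromorphic near `0` with rational Taylor coefficients: near `0` it is a quotient
of two analytic functions with rational Taylor coefficients. -/
def RatMeromorphicAt0 (Λ : AddSubgroup (Vd d)) (f : Vd d → ℝ) : Prop :=
  ∃ g h : Vd d → ℝ, HasRatSeriesAt0 Λ g ∧ HasRatSeriesAt0 Λ h ∧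
    (¬ ∀ᶠ ξ in 𝓝 (0 : Vd d), h ξ = 0) ∧
    (∀ᶠ ξ in 𝓝 (0 : Vd d), h ξ ≠ 0 → f ξ * h ξ = g ξ)

/-- `m` is the canonical Lebesgue measure carried by the rational affine subspace `A`,
normalized so that a fundamental parallelepiped of the lattice `Λ ∩ lin(A)` has volume `1`:
it is the image of the standard Lebesgue measure under a `ℤ`-basis parametrization. -/
def IsCanonicalMeasure (Λ : AddSubgroup (Vd d)) (A : Set (Vd d)) (m : Measure (Vd d)) : Prop :=
  ∃ (k : ℕ) (x₀ : Vd d) (v : Fin k → Vd d),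
    x₀ ∈ A ∧ (∀ i, v i ∈ Λ) ∧ LinearIndependent ℝ v ∧
    A = {x | ∃ t : Fin k → ℝ, x = x₀ + ∑ i, t i • v i} ∧
    (∀ y ∈ Λ, y ∈ Submodule.span ℝ (Set.range v) →
      ∃ c : Fin k → ℤ, y = ∑ i, (c i : ℝ) • v i) ∧
    m = Measure.map (fun t : Fin k → ℝ => x₀ + ∑ i, t i • v i) volume

/-- the characterizing properties of the map `I`: it sends rational polyhedra to meromorphic
functions with rational coefficients, vanishes on polyhedra containing lines, and is given by
`∫_P e^{⟨ξ,x⟩} dm_{<P>}(x)` wherever this integral converges. -/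
def IsIMap (Λ : AddSubgroup (Vd d)) (I : Set (Vd d) → Vd d → ℝ) : Prop :=
  (∀ P, IsRatPolyhedron Λ P → RatMeromorphicAt0 Λ (I P)) ∧
  (∀ P, IsRatPolyhedron Λ P → ContainsLine P → ∀ ξ, I P ξ = 0) ∧
  (∀ P, IsRatPolyhedron Λ P → ∀ m : Measure (Vd d),
    IsCanonicalMeasure Λ ((affineSpan ℝ P : AffineSubspace ℝ (Vd d)) : Set (Vd d)) m →
    ∀ ξ : Vd d, IntegrableOn (fun x => Real.exp (pairE (ξ) (x))) P m →
      I P ξ = ∫ x in P, Real.exp (pairE (ξ) (x)) ∂m)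

/-- the characterizing properties of the map `S`: it sends rational polyhedra to meromorphic
functions with rational coefficients, vanishes on polyhedra containing lines, and is given by
`∑_{x ∈ P ∩ Λ} e^{⟨ξ,x⟩}` wherever this sum converges absolutely. -/
def IsSMap (Λ : AddSubgroup (Vd d)) (S : Set (Vd d) → Vd d → ℝ) : Prop :=
  (∀ P, IsRatPolyhedron Λ P → RatMeromorphicAt0 Λ (S P)) ∧
  (∀ P, IsRatPolyhedron Λ P → ContainsLine P → ∀ ξ, S P ξ = 0) ∧
  (∀ P, IsRatPolyhedron Λ P → ∀ ξ : Vd d,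
    Summable (fun x : ↥(P ∩ (Λ : Set (Vd d))) => Real.exp (pairE ξ (x : Vd d))) →
      S P ξ = ∑' x : ↥(P ∩ (Λ : Set (Vd d))), Real.exp (pairE ξ (x : Vd d)))

/-- `F` is a (nonempty, exposed) face of the convex set `P`. -/
def IsFaceOf (P F : Set (Vd d)) : Prop :=
  F.Nonempty ∧ ∃ φ : Vd d, F = {x ∈ P | ∀ y ∈ P, (pairE (φ) (y)) ≤ (pairE (φ) (x))}

/-- `v` is a vertex of `P`. -/
def IsVertexOf (P : Set (Vd d)) (v : Vd d) : Prop := IsFaceOf P {v}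

/-- the cone of feasible directions of `P` along the face `F` (computed at a point of the
relative interior of `F`). -/
def feasibleCone (P F : Set (Vd d)) : Set (Vd d) :=
  {u | ∃ x ∈ intrinsicInterior ℝ F, ∃ ε : ℝ, 0 < ε ∧ ∀ t : ℝ, 0 < t → t ≤ ε → x + t • u ∈ P}

/-- the supporting cone `<F> + c(P,F)` of `P` along its face `F`. -/
def suppCone (P F : Set (Vd d)) : Set (Vd d) :=
  {z | ∃ a ∈ (affineSpan ℝ F : Set (Vd d)), ∃ u ∈ feasibleCone P F, z = a + u}

/-- the recession cone (cone of directions) of a convex set. -/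
def recCone (P : Set (Vd d)) : Set (Vd d) :=
  {u | ∀ x ∈ P, ∀ t : ℝ, 0 ≤ t → x + t • u ∈ P}

/-- a rational affine cone with respect to the lattice `Λ`: a rational translate of a cone
generated by finitely many lattice vectors. -/
def IsRatAffineCone (Λ : AddSubgroup (Vd d)) (a : Set (Vd d)) : Prop :=
  ∃ (s : Vd d) (n : ℕ) (v : Fin n → Vd d), IsRatPoint Λ s ∧ (∀ i, v i ∈ Λ) ∧
    a = {x | ∃ t : Fin n → ℝ, (∀ i, 0 ≤ t i) ∧ x = s + ∑ i, t i • v i}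

/-- a rational (convex polyhedral) cone with vertex at the origin. -/
def IsRatCone (Λ : AddSubgroup (Vd d)) (c : Set (Vd d)) : Prop :=
  ∃ (n : ℕ) (v : Fin n → Vd d), (∀ i, v i ∈ Λ) ∧
    c = {x | ∃ t : Fin n → ℝ, (∀ i, 0 ≤ t i) ∧ x = ∑ i, t i • v i}

/-- `Q` is a rational scalar product: a symmetric positive definite bilinear form taking
rational values on lattice vectors. -/
def IsRatInner (Λ : AddSubgroup (Vd d)) (Q : Vd d →ₗ[ℝ] Vd d →ₗ[ℝ] ℝ) : Prop :=
  (∀ x y, Q x y = Q y x) ∧ (∀ x : Vd d, x ≠ 0 → 0 < Q x x) ∧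
  (∀ x ∈ Λ, ∀ y ∈ Λ, ∃ q : ℚ, Q x y = (q : ℝ))

/-- `π` realizes the quotient map `V → V/L` as the `Q`-orthogonal projection onto the
`Q`-orthogonal complement of `L`. -/
def IsQCoproj (Q : Vd d →ₗ[ℝ] Vd d →ₗ[ℝ] ℝ) (L : Submodule ℝ (Vd d))
    (π : Vd d →ₗ[ℝ] Vd d) : Prop :=
  (∀ x, x - π x ∈ L) ∧ (∀ x : Vd d, ∀ y ∈ L, Q (π x) y = 0)

/-- `Λ'` is the lattice of a rational quotient space of `(V, Λ)`, realized inside `V` via the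
`Q`-orthogonal projection along a rational subspace. -/
def IsQuotLattice (Q : Vd d →ₗ[ℝ] Vd d →ₗ[ℝ] ℝ) (Λ Λ' : AddSubgroup (Vd d)) : Prop :=
  ∃ (L : Submodule ℝ (Vd d)) (π : Vd d →ₗ[ℝ] Vd d),
    Submodule.span ℝ ((L : Set (Vd d)) ∩ (Λ : Set (Vd d))) = L ∧
    IsQCoproj Q L π ∧ Λ' = AddSubgroup.map π.toAddMonoidHom Λ

/-- a family of maps `I` indexed by the rational quotient spaces of `(V,Λ)`, each member
satisfying the characterizing properties of the integral generating function. -/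
def IsIFamily (Q : Vd d →ₗ[ℝ] Vd d →ₗ[ℝ] ℝ) (Λ : AddSubgroup (Vd d))
    (I : AddSubgroup (Vd d) → Set (Vd d) → Vd d → ℝ) : Prop :=
  ∀ Λ', IsQuotLattice Q Λ Λ' → IsIMap Λ' (I Λ')

/-- a family of maps `S` indexed by the rational quotient spaces of `(V,Λ)`, each member
satisfying the characterizing properties of the lattice-point generating function. -/
def IsSFamily (Q : Vd d →ₗ[ℝ] Vd d →ₗ[ℝ] ℝ) (Λ : AddSubgroup (Vd d))
    (S : AddSubgroup (Vd d) → Set (Vd d) → Vd d → ℝ) : Prop :=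
  ∀ Λ', IsQuotLattice Q Λ Λ' → IsSMap Λ' (S Λ')

/-- the defining properties (a),(b),(c) of the family `μ` of Berline--Vergne:
each `μ(a)` is meromorphic with rational coefficients near `0`, `μ_{0}({0}) = 1`, and for
every pointed rational affine cone `a` in a rational quotient `W` of `V` one has
`S(a) = ∑_{f ∈ F(a)} μ(t(a,f)) I(f)`, where the transverse cone `t(a,f)` is realized inside
`V` by the `Q`-orthogonal projection `π F` along `lin(f)`, and functions on quotient duals
are extended by `Q`-orthogonal projection. -/
def IsMuCore (Λ : AddSubgroup (Vd d)) (Q : Vd d →ₗ[ℝ] Vd d →ₗ[ℝ] ℝ)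
    (I S μ : AddSubgroup (Vd d) → Set (Vd d) → Vd d → ℝ) : Prop :=
  (∀ Λ', IsQuotLattice Q Λ Λ' → ∀ a, IsRatAffineCone Λ' a → ¬ ContainsLine a →
      RatMeromorphicAt0 Λ' (μ Λ' a)) ∧
  (∀ ξ, μ ⊥ ({0} : Set (Vd d)) ξ = 1) ∧
  (∀ Λ', IsQuotLattice Q Λ Λ' → ∀ a, IsRatAffineCone Λ' a → ¬ ContainsLine a →
    ∀ π : Set (Vd d) → (Vd d →ₗ[ℝ] Vd d),
      (∀ F, IsFaceOf a F → IsQCoproj Q (affineSpan ℝ F).direction (π F)) →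
      MeroEqAt0 (S Λ' a)
        (fun ξ => ∑ᶠ F ∈ {F | IsFaceOf a F},
          μ (AddSubgroup.map (π F).toAddMonoidHom Λ') ((π F) '' suppCone a F) ξ
            * I Λ' F ξ))

/-- the family `μ`, extended by `μ(a) = 0` on cones containing a straight line. -/
def IsMuFamily (Λ : AddSubgroup (Vd d)) (Q : Vd d →ₗ[ℝ] Vd d →ₗ[ℝ] ℝ)
    (I S μ : AddSubgroup (Vd d) → Set (Vd d) → Vd d → ℝ) : Prop :=
  IsMuCore Λ Q I S μ ∧
  (∀ Λ', IsQuotLattice Q Λ Λ' → ∀ a, IsRatAffineCone Λ' a → ContainsLine a →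
    ∀ ξ, μ Λ' a ξ = 0)

/-- the trace pairing of two `n`-multilinear forms on `ℝ^d`, computed in the standard basis. -/
def multiPair {n : ℕ} (p q : ContinuousMultilinearMap ℝ (fun _ : Fin n => Vd d) ℝ) : ℝ :=
  ∑ ι : Fin n → Fin d,
    p (fun j => (EuclideanSpace.basisFun (Fin d) ℝ) (ι j)) *
    q (fun j => (EuclideanSpace.basisFun (Fin d) ℝ) (ι j))

/-- the action on `h` of the infinite-order constant-coefficient differential operator whose
symbol has Taylor series `p` at `0`; on polynomials `h` the sum is finite.  Its defining
property is `D(Φ)e^{⟨ξ,·⟩} = Φ(ξ)e^{⟨ξ,·⟩}`. -/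
def DOp (p : FormalMultilinearSeries ℝ (Vd d) ℝ) (h : Vd d → ℝ) (x : Vd d) : ℝ :=
  ∑ᶠ n : ℕ, multiPair (p n) (iteratedFDeriv ℝ n h x)

/-- `h` is a polynomial function on `ℝ^d`. -/
def IsPolyFun (h : Vd d → ℝ) : Prop :=
  ∃ p : MvPolynomial (Fin d) ℝ, ∀ x : Vd d, h x = MvPolynomial.eval (fun i => x i) p

/-- `h` is a polynomial function of degree at most `r` on `ℝ^d`. -/
def IsPolyFunOfDeg (h : Vd d → ℝ) (r : ℕ) : Prop :=
  ∃ p : MvPolynomial (Fin d) ℝ, p.totalDegree ≤ r ∧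
    ∀ x : Vd d, h x = MvPolynomial.eval (fun i => x i) p

end

open MeasureTheory Filter Topology Set
open scoped RealInnerProductSpace Pointwise BigOperators

namespace BVI
set_option linter.unusedSectionVars false

/-- rational real numbers -/
def IsQ (x : ℝ) : Prop := ∃ q : ℚ, x = (q : ℝ)

theorem IsQ.add {x y : ℝ} (hx : IsQ x) (hy : IsQ y) : IsQ (x + y) := by
  obtain ⟨a, rfl⟩ := hx; obtain ⟨b, rfl⟩ := hy; exact ⟨a + b, by push_cast; rfl⟩
theorem IsQ.sub {x y : ℝ} (hx : IsQ x) (hy : IsQ y) : IsQ (x - y) := by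
  obtain ⟨a, rfl⟩ := hx; obtain ⟨b, rfl⟩ := hy; exact ⟨a - b, by push_cast; rfl⟩
theorem IsQ.mul {x y : ℝ} (hx : IsQ x) (hy : IsQ y) : IsQ (x * y) := by
  obtain ⟨a, rfl⟩ := hx; obtain ⟨b, rfl⟩ := hy; exact ⟨a * b, by push_cast; rfl⟩
theorem IsQ.div {x y : ℝ} (hx : IsQ x) (hy : IsQ y) : IsQ (x / y) := by
  obtain ⟨a, rfl⟩ := hx; obtain ⟨b, rfl⟩ := hy; exact ⟨a / b, by push_cast; rfl⟩
theorem IsQ.neg {x : ℝ} (hx : IsQ x) : IsQ (-x) := by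
  obtain ⟨a, rfl⟩ := hx; exact ⟨-a, by push_cast; rfl⟩
theorem IsQ.zero : IsQ 0 := ⟨0, by simp⟩
theorem IsQ.one : IsQ 1 := ⟨1, by simp⟩
theorem IsQ.rat (q : ℚ) : IsQ (q : ℝ) := ⟨q, rfl⟩
theorem IsQ.int (q : ℤ) : IsQ (q : ℝ) := ⟨q, by simp⟩
theorem IsQ.natCast (q : ℕ) : IsQ (q : ℝ) := ⟨q, by simp⟩
theorem IsQ.sum {ι : Type*} (s : Finset ι) {f : ι → ℝ} (h : ∀ i ∈ s, IsQ (f i)) :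
    IsQ (∑ i ∈ s, f i) := by
  classical
  induction s using Finset.induction_on with
  | empty => simpa using IsQ.zero
  | insert a s ha ih =>
    rw [Finset.sum_insert ha]
    exact (h a (by simp)).add (ih fun i hi => h i (by simp [hi]))
theorem IsQ.prod {ι : Type*} (s : Finset ι) {f : ι → ℝ} (h : ∀ i ∈ s, IsQ (f i)) :
    IsQ (∏ i ∈ s, f i) := by
  classical
  induction s using Finset.induction_on with
  | empty => simpa using IsQ.one
  | insert a s ha ih =>
    rw [Finset.prod_insert ha]
    exact (h a (by simp)).mul (ih fun i hi => h i (by simp [hi]))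

variable {W W' : Type*} [NormedAddCommGroup W] [NormedSpace ℝ W]
  [NormedAddCommGroup W'] [NormedSpace ℝ W']

/-- entire real-analytic functions with rational Taylor coefficients with respect to a set
of rational vectors -/
def RatAn (R : Set W) (g : W → ℝ) : Prop :=
  AnalyticOnNhd ℝ g univ ∧ ∃ p : FormalMultilinearSeries ℝ W ℝ, HasFPowerSeriesAt g p 0 ∧
    ∀ (n : ℕ) (w : Fin n → W), (∀ i, w i ∈ R) → IsQ ((p n) w)

theorem RatAn.at_zero {R : Set W} {g : W → ℝ} (hg : RatAn R g) : IsQ (g 0) := by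
  obtain ⟨_, p, hp, h⟩ := hg
  have := h 0 (fun i => 0) (fun i => i.elim0)
  rwa [hp.coeff_zero] at this

theorem RatAn.const (R : Set W) {c : ℝ} (hc : IsQ c) : RatAn R (fun _ => c) := by
  refine ⟨analyticOnNhd_const, constFormalMultilinearSeries ℝ W c, hasFPowerSeriesAt_const, ?_⟩
  intro n w hw
  rcases n with _ | n
  · simpa [constFormalMultilinearSeries] using hc
  · simpa [constFormalMultilinearSeries] using IsQ.zero

theorem RatAn.add {R : Set W} {f g : W → ℝ} (hf : RatAn R f) (hg : RatAn R g) :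
    RatAn R (fun x => f x + g x) := by
  obtain ⟨af, p, hp, h⟩ := hf
  obtain ⟨ag, q, hq, k⟩ := hg
  exact ⟨af.add ag, p + q, hp.add hq, fun n w hw => (h n w hw).add (k n w hw)⟩

theorem RatAn.mul {R : Set W} {f g : W → ℝ} (hf : RatAn R f) (hg : RatAn R g) :
    RatAn R (fun x => f x * g x) := by
  have hf0 := hf.at_zero
  have hg0 := hg.at_zero
  obtain ⟨af, p, hp, h⟩ := hf
  obtain ⟨ag, q, hq, k⟩ := hg
  refine ⟨af.mul ag, ?_⟩
  have hb := (ContinuousLinearMap.mul ℝ ℝ).hasFPowerSeriesAt_bilinear (f 0, g 0)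
  have hc := HasFPowerSeriesAt.comp (f := fun x => (f x, g x)) hb (hp.prod hq)
  refine ⟨_, hc, ?_⟩
  intro n w hw
  simp only [FormalMultilinearSeries.comp, _root_.sum_apply]
  refine IsQ.sum _ fun c _ => ?_
  simp only [FormalMultilinearSeries.compAlongComposition_apply]
  have key : ∀ i, IsQ (((p.prod q).applyComposition c w i).1) ∧
      IsQ (((p.prod q).applyComposition c w i).2) := by
    intro i
    constructor
    · exact h _ _ (fun j => hw _)
    · exact k _ _ (fun j => hw _)
  generalize (p.prod q).applyComposition c w = v at key
  generalize c.length = m at v key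
  rcases m with _ | _ | _ | m
  · simpa using hf0.mul hg0
  · simpa using (hf0.mul (key 0).2).add ((key 0).1.mul hg0)
  · simpa using (key 0).1.mul (key 1).2
  · simpa using IsQ.zero

theorem RatAn.neg {R : Set W} {f : W → ℝ} (hf : RatAn R f) :
    RatAn R (fun x => - f x) := by
  simpa using (RatAn.const R IsQ.one.neg).mul hf

theorem RatAn.sub {R : Set W} {f g : W → ℝ} (hf : RatAn R f) (hg : RatAn R g) :
    RatAn R (fun x => f x - g x) := by
  simpa [sub_eq_add_neg] using hf.add hg.neg

theorem RatAn.compL {R : Set W} {R' : Set W'} {g : W' → ℝ} (hg : RatAn R' g) (L : W →L[ℝ] W')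
    (hL : ∀ w ∈ R, L w ∈ R') : RatAn R (fun x => g (L x)) := by
  obtain ⟨ag, q, hq, k⟩ := hg
  refine ⟨fun x _ => (ag (L x) trivial).comp (L.analyticAt x), q.compContinuousLinearMap L, ?_, ?_⟩
  · have : HasFPowerSeriesAt g q (L 0) := by simpa using hq
    exact this.compContinuousLinearMap
  · intro n w hw
    exact k n _ fun i => hL _ (hw i)

theorem RatAn.clm {R : Set W} (L : W →L[ℝ] ℝ) (hL : ∀ w ∈ R, IsQ (L w)) :
    RatAn R (fun x => L x) := by
  refine ⟨L.analyticOnNhd _, _, L.hasFPowerSeriesAt 0, ?_⟩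
  intro n w hw
  rcases n with _ | _ | n
  · simpa using IsQ.zero
  · simpa using hL _ (hw 0)
  · simpa using IsQ.zero

theorem RatAn.expL {R : Set W} (L : W →L[ℝ] ℝ) (hL : ∀ w ∈ R, IsQ (L w)) :
    RatAn R (fun x => Real.exp (L x)) := by
  have h : RatAn {x : ℝ | IsQ x} Real.exp := by
    refine ⟨fun x _ => analyticAt_rexp, NormedSpace.expSeries ℝ ℝ, ?_, ?_⟩
    · rw [Real.exp_eq_exp_ℝ]; exact NormedSpace.exp_hasFPowerSeriesAt_zero
    · intro n w hw
      simp only [NormedSpace.expSeries, smul_apply, smul_eq_mul,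
        ContinuousMultilinearMap.mkPiAlgebraFin_apply]
      rw [List.prod_ofFn]
      refine IsQ.mul ?_ (IsQ.prod _ fun i _ => hw i)
      exact ⟨((n.factorial : ℚ))⁻¹, by simp⟩
  exact h.compL L hL

/-- identity theorem: if a product of two entire analytic functions vanishes on a nonempty open
set and the first one is nonzero somewhere, the second one vanishes -/
theorem an_eq_of_open {f g : W → ℝ} (hf : AnalyticOnNhd ℝ f univ) (hg : AnalyticOnNhd ℝ g univ)
    {U : Set W} (hU : IsOpen U) (hne : U.Nonempty) (h : ∀ x ∈ U, f x = g x) : ∀ x, f x = g x := by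
  obtain ⟨x, hx⟩ := hne
  have : f =ᶠ[𝓝 x] g := by
    filter_upwards [hU.mem_nhds hx] with y hy using h y hy
  exact fun y => congrFun (hf.eq_of_eventuallyEq hg this) y

theorem an_dense {f : W → ℝ} (hf : AnalyticOnNhd ℝ f univ) (hne : ∃ x, f x ≠ 0) :
    Dense {x | f x ≠ 0} := by
  have hc : {x | f x ≠ 0} = {x | f x = 0}ᶜ := rfl
  rw [hc, ← interior_eq_empty_iff_dense_compl]
  by_contra hcon
  obtain ⟨x, hx⟩ := hne
  exact hx (an_eq_of_open hf analyticOnNhd_const isOpen_interior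
    (Set.nonempty_iff_ne_empty.2 hcon) (fun y hy => (interior_subset hy : y ∈ {x | f x = 0})) x)

theorem an_cont {f : W → ℝ} (hf : AnalyticOnNhd ℝ f univ) : Continuous f :=
  continuous_iff_continuousAt.2 fun x => (hf x trivial).continuousAt

theorem an_open {f : W → ℝ} (hf : AnalyticOnNhd ℝ f univ) : IsOpen {x | f x ≠ 0} :=
  isOpen_ne_fun (an_cont hf) continuous_const

theorem an_mul_ne {f g : W → ℝ} (hf : AnalyticOnNhd ℝ f univ) (hg : AnalyticOnNhd ℝ g univ)
    (h : ∃ x, f x ≠ 0) (k : ∃ x, g x ≠ 0) : ∃ x, f x * g x ≠ 0 := by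
  obtain ⟨y, hy⟩ := k
  obtain ⟨x, hx, hx'⟩ := (an_dense hf h).inter_open_nonempty _ (an_open hg) ⟨y, hy⟩
  exact ⟨x, mul_ne_zero hx' hx⟩

theorem an_mul_cancel {f g : W → ℝ} (hf : AnalyticOnNhd ℝ f univ) (hg : AnalyticOnNhd ℝ g univ)
    (h : ∃ x, f x ≠ 0) (k : ∀ x, f x * g x = 0) : ∀ x, g x = 0 := by
  by_contra! hcon
  obtain ⟨x, hx⟩ := an_mul_ne hf hg h hcon
  exact hx (k x)

/-- exponential decay condition -/
def GoodL (P : Set W) (f : W → ℝ) : Prop :=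
  ∃ C ε : ℝ, 0 < ε ∧ ∀ x ∈ P, f x ≤ C - ε * ‖x‖

theorem GoodL.mono {P Q : Set W} {f : W → ℝ} (h : GoodL P f) (hQ : Q ⊆ P) : GoodL Q f := by
  obtain ⟨C, ε, hε, h⟩ := h
  exact ⟨C, ε, hε, fun x hx => h x (hQ hx)⟩

theorem GoodL.union {P Q : Set W} {f : W → ℝ} (h : GoodL P f) (h' : GoodL Q f) :
    GoodL (P ∪ Q) f := by
  obtain ⟨C, ε, hε, h⟩ := h
  obtain ⟨C', ε', hε', h'⟩ := h'
  refine ⟨max C C', min ε ε', lt_min hε hε', ?_⟩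
  rintro x (hx | hx)
  · refine (h x hx).trans (sub_le_sub (le_max_left _ _) ?_)
    exact mul_le_mul_of_nonneg_right (min_le_left _ _) (norm_nonneg _)
  · refine (h' x hx).trans (sub_le_sub (le_max_right _ _) ?_)
    exact mul_le_mul_of_nonneg_right (min_le_right _ _) (norm_nonneg _)

theorem goodL_empty (f : W → ℝ) : GoodL ∅ f := ⟨0, 1, one_pos, by simp⟩

theorem integrable_exp_neg_norm [FiniteDimensional ℝ W] [MeasurableSpace W] [BorelSpace W]
    (μ : Measure W) [μ.IsAddHaarMeasure] {ε : ℝ} (hε : 0 < ε) :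
    Integrable (fun x : W => Real.exp (-(ε * ‖x‖))) μ := by
  set n := Module.finrank ℝ W + 1 with hn
  have h1 : Integrable (fun x : W => (1 + ‖x‖) ^ (-(n : ℝ))) μ :=
    integrable_one_add_norm (by rw [hn]; push_cast; linarith)
  -- e^{-εr} (1+r)^n bounded
  have h2 : ∃ K : ℝ, ∀ r : ℝ, 0 ≤ r → Real.exp (-(ε * r)) ≤ K * (1 + r) ^ (-(n : ℝ)) := by
    refine ⟨Real.exp ε * (n.factorial / ε ^ n), fun r hr => ?_⟩
    have h3 := Real.pow_div_factorial_le_exp (x := ε * (1 + r)) (by positivity) n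
    rw [Real.rpow_neg (by positivity), Real.rpow_natCast, Real.exp_neg]
    have h4 : Real.exp (ε * (1 + r)) = Real.exp ε * Real.exp (ε * r) := by
      rw [← Real.exp_add]; ring_nf
    rw [h4, mul_pow, div_le_iff₀ (by positivity)] at h3
    have : Real.exp ε * (n.factorial / ε ^ n) * ((1 + r) ^ n)⁻¹ =
      (Real.exp ε * n.factorial) / (ε ^ n * (1 + r) ^ n) := by field_simp
    rw [this, inv_eq_one_div, div_le_div_iff₀ (by positivity) (by positivity)]
    linarith
  obtain ⟨K, hK⟩ := h2
  refine (h1.const_mul K).mono' ?_ ?_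
  · exact (Continuous.aestronglyMeasurable (by fun_prop))
  · refine Eventually.of_forall fun x => ?_
    rw [Real.norm_eq_abs, Real.abs_exp]
    exact hK _ (norm_nonneg _)

theorem GoodL.integrableOn [FiniteDimensional ℝ W] [MeasurableSpace W] [BorelSpace W]
    (μ : Measure W) [μ.IsAddHaarMeasure] {P : Set W} (hP : MeasurableSet P) {f : W → ℝ}
    (hf : Continuous f) (h : GoodL P f) : IntegrableOn (fun x => Real.exp (f x)) P μ := by
  obtain ⟨C, ε, hε, h⟩ := h
  have h1 := ((integrable_exp_neg_norm μ hε).const_mul (Real.exp C)).integrableOn (s := P)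
  refine Integrable.mono' h1 (Continuous.aestronglyMeasurable (by fun_prop)) ?_
  refine (ae_restrict_iff' hP).2 (Eventually.of_forall fun x hx => ?_)
  rw [Real.norm_eq_abs, Real.abs_exp, ← Real.exp_add]
  exact Real.exp_le_exp.2 (by linarith [h x hx])

end BVI

open MeasureTheory Filter Topology Set
open scoped RealInnerProductSpace Pointwise BigOperators

namespace BVI
set_option linter.unusedSectionVars false

section NiceF
variable {W W' : Type*} [NormedAddCommGroup W] [NormedSpace ℝ W]
  [NormedAddCommGroup W'] [NormedSpace ℝ W']

/-- `F` coincides on `D` with a quotient of two entire functions with rational coefficients -/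
def NiceF (R : Set W) (D : Set W) (F : W → ℝ) : Prop :=
  ∃ g h : W → ℝ, RatAn R g ∧ RatAn R h ∧ (∃ ξ, h ξ ≠ 0) ∧ ∀ ξ ∈ D, h ξ * F ξ = g ξ

theorem NiceF.mono {R D D' : Set W} {F : W → ℝ} (h : NiceF R D F) (hD : D' ⊆ D) :
    NiceF R D' F := by
  obtain ⟨g, k, hg, hk, hne, h⟩ := h
  exact ⟨g, k, hg, hk, hne, fun ξ hξ => h ξ (hD hξ)⟩

theorem NiceF.congr {R D : Set W} {F G : W → ℝ} (h : NiceF R D F) (hD : ∀ ξ ∈ D, G ξ = F ξ) :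
    NiceF R D G := by
  obtain ⟨g, k, hg, hk, hne, h⟩ := h
  exact ⟨g, k, hg, hk, hne, fun ξ hξ => by rw [hD ξ hξ, h ξ hξ]⟩

theorem NiceF.ofRatAn {R D : Set W} {F : W → ℝ} (h : RatAn R F) : NiceF R D F :=
  ⟨F, fun _ => 1, h, RatAn.const R IsQ.one, ⟨0, one_ne_zero⟩, fun ξ _ => one_mul _⟩

theorem NiceF.add {R D : Set W} {F G : W → ℝ} (hF : NiceF R D F) (hG : NiceF R D G) :
    NiceF R D (fun ξ => F ξ + G ξ) := by
  obtain ⟨g, k, hg, hk, hne, h⟩ := hF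
  obtain ⟨g', k', hg', hk', hne', h'⟩ := hG
  refine ⟨_, _, (hg.mul hk').add (hg'.mul hk), hk.mul hk', an_mul_ne hk.1 hk'.1 hne hne', ?_⟩
  intro ξ hξ
  dsimp only
  rw [← h ξ hξ, ← h' ξ hξ]; ring

theorem NiceF.mul_left {R D : Set W} {F r : W → ℝ} (hF : NiceF R D F) (hr : RatAn R r) :
    NiceF R D (fun ξ => r ξ * F ξ) := by
  obtain ⟨g, k, hg, hk, hne, h⟩ := hF
  refine ⟨_, _, hr.mul hg, hk, hne, ?_⟩
  intro ξ hξ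
  dsimp only
  rw [← h ξ hξ]; ring

theorem NiceF.neg {R D : Set W} {F : W → ℝ} (hF : NiceF R D F) :
    NiceF R D (fun ξ => - F ξ) := by
  simpa using hF.mul_left (RatAn.const R IsQ.one.neg)

theorem NiceF.sub {R D : Set W} {F G : W → ℝ} (hF : NiceF R D F) (hG : NiceF R D G) :
    NiceF R D (fun ξ => F ξ - G ξ) := by
  simpa [sub_eq_add_neg] using hF.add hG.neg

theorem NiceF.of_mul {R D : Set W} {F r : W → ℝ} (hF : NiceF R D (fun ξ => r ξ * F ξ))
    (hr : RatAn R r) (hne : ∃ ξ, r ξ ≠ 0) : NiceF R D F := by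
  obtain ⟨g, k, hg, hk, hne', h⟩ := hF
  refine ⟨_, _, hg, hk.mul hr, an_mul_ne hk.1 hr.1 hne' hne, ?_⟩
  intro ξ hξ
  rw [← h ξ hξ]; simp only; ring

theorem NiceF.compL {R D : Set W} {R' D' : Set W'} {F : W' → ℝ} (hF : NiceF R' D' F)
    (L : W →L[ℝ] W') (hL : ∀ w ∈ R, L w ∈ R') (hs : Function.Surjective L)
    (hD : ∀ ξ ∈ D, L ξ ∈ D') : NiceF R D (fun ξ => F (L ξ)) := by
  obtain ⟨g, k, hg, hk, ⟨y, hy⟩, h⟩ := hF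
  obtain ⟨x, rfl⟩ := hs y
  exact ⟨_, _, hg.compL L hL, hk.compL L hL, ⟨x, hy⟩, fun ξ hξ => h _ (hD ξ hξ)⟩

end NiceF

/-- rational vectors of `ℝ^k` -/
def RQ (k : ℕ) : Set (Fin k → ℝ) := {w | ∀ j, IsQ (w j)}

/-- rational linear form -/
noncomputable def lin {k : ℕ} (a : Fin k → ℚ) (x : Fin k → ℝ) : ℝ := ∑ i, (a i : ℝ) * x i

/-- rational affine function -/
noncomputable def aff {k : ℕ} (u : (Fin k → ℚ) × ℚ) (x : Fin k → ℝ) : ℝ := lin u.1 x + (u.2 : ℝ)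

/-- rational polyhedron in coordinates -/
def poly {k : ℕ} (L : List ((Fin k → ℚ) × ℚ)) : Set (Fin k → ℝ) :=
  {x | ∀ p ∈ L, lin p.1 x ≤ (p.2 : ℝ)}

/-- dot product -/
def dp {k : ℕ} (ξ x : Fin k → ℝ) : ℝ := ∑ i, ξ i * x i

theorem continuous_dp {k : ℕ} (ξ : Fin k → ℝ) : Continuous (dp ξ) := by
  unfold dp; fun_prop

theorem continuous_lin {k : ℕ} (a : Fin k → ℚ) : Continuous (lin a) := by
  unfold lin; fun_prop

theorem continuous_aff {k : ℕ} (a : (Fin k → ℚ) × ℚ) : Continuous (aff a) := by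
  unfold aff; have := continuous_lin a.1; fun_prop

theorem measurableSet_poly {k : ℕ} (L : List ((Fin k → ℚ) × ℚ)) : MeasurableSet (poly L) := by
  have : poly L = ⋂ p ∈ L, {x | lin p.1 x ≤ (p.2 : ℝ)} := by ext; simp [poly]
  rw [this]
  have : IsClosed (⋂ p ∈ L, {x : Fin k → ℝ | lin p.1 x ≤ (p.2 : ℝ)}) :=
    isClosed_biInter fun p _ => isClosed_le (continuous_lin _) continuous_const
  exact this.measurableSet

/-- existence of the meromorphic continuation for a set `P` -/
def Nice {k : ℕ} (P : Set (Fin k → ℝ)) : Prop :=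
  NiceF (RQ k) {ξ | GoodL P (dp ξ)} (fun ξ => ∫ x in P, Real.exp (dp ξ x))

theorem Nice.union {k : ℕ} {P Q : Set (Fin k → ℝ)} (hPm : MeasurableSet P)
    (hQm : MeasurableSet Q) (hP : Nice P) (hQ : Nice Q) (hPQ : Nice (P ∩ Q)) : Nice (P ∪ Q) := by
  have h1 : NiceF (RQ k) {ξ | GoodL (P ∪ Q) (dp ξ)} (fun ξ => ∫ x in P, Real.exp (dp ξ x)) :=
    NiceF.mono hP fun ξ hξ => GoodL.mono hξ subset_union_left
  have h2 : NiceF (RQ k) {ξ | GoodL (P ∪ Q) (dp ξ)} (fun ξ => ∫ x in Q, Real.exp (dp ξ x)) :=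
    NiceF.mono hQ fun ξ hξ => GoodL.mono hξ subset_union_right
  have h3 : NiceF (RQ k) {ξ | GoodL (P ∪ Q) (dp ξ)} (fun ξ => ∫ x in P ∩ Q, Real.exp (dp ξ x)) :=
    NiceF.mono hPQ fun ξ hξ => GoodL.mono hξ (inter_subset_left.trans subset_union_left)
  refine ((h1.add h2).sub h3).congr fun ξ hξ => ?_
  have hi : IntegrableOn (fun x => Real.exp (dp ξ x)) (P ∪ Q) volume :=
    GoodL.integrableOn volume (hPm.union hQm) (continuous_dp ξ) hξ
  have e1 : P ∪ Q = P ∪ (Q \ P) := by simp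
  have e2 : ∫ x in Q, Real.exp (dp ξ x) =
      (∫ x in P ∩ Q, Real.exp (dp ξ x)) + ∫ x in Q \ P, Real.exp (dp ξ x) := by
    rw [inter_comm, integral_inter_add_sdiff hPm (hi.mono_set subset_union_right)]
  rw [e1, setIntegral_union disjoint_sdiff_right (hQm.diff hPm)
    (hi.mono_set subset_union_left)
    (hi.mono_set (sdiff_subset.trans subset_union_right)), e2]
  ring

theorem Nice.zero_dim (L : List ((Fin 0 → ℚ) × ℚ)) : Nice (poly L) := by
  by_cases h : poly L = ∅
  · rw [h]
    refine (NiceF.ofRatAn (RatAn.const _ IsQ.zero)).congr fun ξ _ => ?_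
    simp
  · have : poly L = univ := by
      ext x
      obtain ⟨y, hy⟩ := Set.nonempty_iff_ne_empty.2 h
      simpa [Subsingleton.elim x y] using hy
    rw [this]
    refine (NiceF.ofRatAn (RatAn.const _ IsQ.one)).congr fun ξ _ => ?_
    simp [dp, measureReal_def, volume_pi]

variable {k : ℕ}

/-- the linear substitution `ζ + η α` -/
noncomputable def subL (u : (Fin k → ℚ) × ℚ) : (Fin (k + 1) → ℝ) →L[ℝ] (Fin k → ℝ) :=
  ContinuousLinearMap.pi fun i =>
    ContinuousLinearMap.proj (R := ℝ) (φ := fun _ : Fin (k + 1) => ℝ) i.succ +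
    (u.1 i : ℝ) • ContinuousLinearMap.proj (R := ℝ) (φ := fun _ : Fin (k + 1) => ℝ) 0

theorem subL_apply (u : (Fin k → ℚ) × ℚ) (ξ : Fin (k + 1) → ℝ) (i : Fin k) :
    subL u ξ i = ξ i.succ + (u.1 i : ℝ) * ξ 0 := by
  simp [subL]

theorem dp_cons (ξ : Fin (k + 1) → ℝ) (y : ℝ) (x : Fin k → ℝ) :
    dp ξ (Fin.cons y x) = ξ 0 * y + dp (fun i => ξ i.succ) x := by
  simp [dp, Fin.sum_univ_succ]

theorem dp_cons_aff (u : (Fin k → ℚ) × ℚ) (ξ : Fin (k + 1) → ℝ) (x : Fin k → ℝ) :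
    dp ξ (Fin.cons (aff u x) x) = ξ 0 * u.2 + dp (subL u ξ) x := by
  rw [dp_cons]
  simp only [dp, subL_apply, aff, lin, add_mul, Finset.sum_add_distrib, mul_add, Finset.mul_sum]
  have : ∀ i, ξ 0 * ((u.1 i : ℝ) * x i) = (u.1 i : ℝ) * ξ 0 * x i := fun i => by ring
  simp only [this]
  ring

theorem niceF_term (IH : ∀ L : List ((Fin k → ℚ) × ℚ), Nice (poly L))
    (L : List ((Fin k → ℚ) × ℚ)) (u : (Fin k → ℚ) × ℚ) :
    NiceF (RQ (k + 1)) {ξ | GoodL (poly L) (dp (subL u ξ))}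
      (fun ξ => ∫ x in poly L, Real.exp (dp ξ (Fin.cons (aff u x) x))) := by
  have h1 : NiceF (RQ (k + 1)) {ξ | GoodL (poly L) (dp (subL u ξ))}
      (fun ξ => ∫ x in poly L, Real.exp (dp (subL u ξ) x)) := by
    refine NiceF.compL (IH L) (subL u) ?_ ?_ ?_
    · intro w hw i
      rw [subL_apply]
      exact (hw _).add ((IsQ.rat _).mul (hw _))
    · intro y
      refine ⟨Fin.cons 0 y, ?_⟩
      ext i
      simp [subL_apply]
    · intro ξ hξ; exact hξ
  have h2 : RatAn (RQ (k + 1)) (fun ξ => Real.exp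
      (((u.2 : ℝ) • ContinuousLinearMap.proj (R := ℝ) (φ := fun _ : Fin (k + 1) => ℝ) 0) ξ)) :=
    RatAn.expL _ fun w hw => by simpa using (IsQ.rat _).mul (hw 0)
  refine (h1.mul_left h2).congr fun ξ _ => ?_
  rw [← integral_const_mul]
  refine integral_congr_ae (Eventually.of_forall fun x => ?_)
  simp only [dp_cons_aff, Real.exp_add]
  congr 2
  simp [mul_comm]

/-- polyhedron with separated constraints on the first coordinate -/
def spoly (R U Lo : List ((Fin k → ℚ) × ℚ)) : Set (Fin (k + 1) → ℝ) :=
  {x | Fin.tail x ∈ poly R ∧ (∀ u ∈ U, x 0 ≤ aff u (Fin.tail x)) ∧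
    ∀ l ∈ Lo, aff l (Fin.tail x) ≤ x 0}

theorem continuous_tail : Continuous (fun x : Fin (k + 1) → ℝ => (Fin.tail x : Fin k → ℝ)) := by
  unfold Fin.tail; fun_prop

theorem measurableSet_spoly (R U Lo : List ((Fin k → ℚ) × ℚ)) :
    MeasurableSet (spoly R U Lo) := by
  have : spoly R U Lo = Fin.tail ⁻¹' poly R ∩
    ((⋂ u ∈ U, {x | x 0 ≤ aff u (Fin.tail x)}) ∩ ⋂ l ∈ Lo, {x | aff l (Fin.tail x) ≤ x 0}) := by
    ext; simp [spoly]
  rw [this]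
  have c : ∀ u : (Fin k → ℚ) × ℚ, Continuous (fun x : Fin (k + 1) → ℝ => aff u (Fin.tail x)) :=
    fun u => (continuous_aff u).comp continuous_tail
  refine (continuous_tail.measurable (measurableSet_poly R)).inter (MeasurableSet.inter ?_ ?_)
  · refine IsClosed.measurableSet (isClosed_biInter fun p _ => isClosed_le ?_ (c p))
    fun_prop
  · refine IsClosed.measurableSet (isClosed_biInter fun p _ => isClosed_le (c p) ?_)
    fun_prop

theorem mem_spoly_cons (R U Lo : List ((Fin k → ℚ) × ℚ)) (y : ℝ) (x : Fin k → ℝ) :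
    Fin.cons y x ∈ spoly R U Lo ↔ x ∈ poly R ∧ (∀ u ∈ U, y ≤ aff u x) ∧ ∀ l ∈ Lo, aff l x ≤ y := by
  simp [spoly]

theorem norm_le_cons (y : ℝ) (x : Fin k → ℝ) : ‖x‖ ≤ ‖(Fin.cons y x : Fin (k + 1) → ℝ)‖ := by
  refine (pi_norm_le_iff_of_nonneg (norm_nonneg _)).2 fun i => ?_
  simpa using norm_le_pi_norm (Fin.cons y x : Fin (k + 1) → ℝ) i.succ

theorem abs_le_cons (y : ℝ) (x : Fin k → ℝ) : |y| ≤ ‖(Fin.cons y x : Fin (k + 1) → ℝ)‖ := by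
  simpa using norm_le_pi_norm (Fin.cons y x : Fin (k + 1) → ℝ) 0

theorem good_trace {S : Set (Fin (k + 1) → ℝ)} {Q : Set (Fin k → ℝ)} (u : (Fin k → ℚ) × ℚ)
    (hQ : ∀ x ∈ Q, (Fin.cons (aff u x) x : Fin (k + 1) → ℝ) ∈ S) {ξ : Fin (k + 1) → ℝ}
    (hξ : GoodL S (dp ξ)) : GoodL Q (dp (subL u ξ)) := by
  obtain ⟨C, ε, hε, h⟩ := hξ
  refine ⟨C - ξ 0 * u.2, ε, hε, fun x hx => ?_⟩
  have h1 := h _ (hQ x hx)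
  rw [dp_cons_aff] at h1
  have := mul_le_mul_of_nonneg_left (norm_le_cons (aff u x) x) hε.le
  linarith

theorem fubini_cons {S : Set (Fin (k + 1) → ℝ)} (hS : MeasurableSet S) {f : (Fin (k + 1) → ℝ) → ℝ}
    (hf : IntegrableOn f S volume) :
    ∫ x in S, f x = ∫ x : Fin k → ℝ, ∫ y : ℝ, S.indicator f (Fin.cons y x) := by
  rw [← integral_indicator hS]
  have hi : Integrable (S.indicator f) volume := hf.integrable_indicator hS
  have hv := (volume_preserving_piFinSuccAbove (fun _ : Fin (k + 1) => ℝ) 0).symm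
  have h1 := hv.integral_comp' (g := S.indicator f)
  have h2 := (hv.integrable_comp_emb (MeasurableEquiv.measurableEmbedding _)).2 hi
  rw [← h1]
  have := integral_prod_symm _ h2
  refine this.trans ?_
  refine integral_congr_ae (Eventually.of_forall fun x => ?_)
  refine integral_congr_ae (Eventually.of_forall fun y => ?_)
  simp [MeasurableEquiv.piFinSuccAbove, Fin.insertNthEquiv]

/-- integrals over fibers, multiplied by `η` -/
theorem fubini_mul {S : Set (Fin (k + 1) → ℝ)} (hS : MeasurableSet S) {Q : Set (Fin k → ℝ)}
    (hQ : MeasurableSet Q) {ξ : Fin (k + 1) → ℝ} (hξ : GoodL S (dp ξ)) (G : (Fin k → ℝ) → ℝ)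
    (h1 : ∀ x ∈ Q, ξ 0 * ∫ y in {y : ℝ | (Fin.cons y x : Fin (k + 1) → ℝ) ∈ S},
      Real.exp (dp ξ (Fin.cons y x)) = G x)
    (h2 : ∀ x, x ∉ Q → ∀ y : ℝ, (Fin.cons y x : Fin (k + 1) → ℝ) ∉ S) :
    ξ 0 * ∫ x in S, Real.exp (dp ξ x) = ∫ x in Q, G x := by
  rw [fubini_cons hS (GoodL.integrableOn volume hS (continuous_dp ξ) hξ), ← integral_const_mul,
    ← integral_indicator hQ]
  refine integral_congr_ae (Eventually.of_forall fun x => ?_)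
  dsimp only
  by_cases hx : x ∈ Q
  · rw [indicator_of_mem hx, ← h1 x hx, ← integral_indicator]
    · rfl
    · have : Measurable (fun y : ℝ => (Fin.cons y x : Fin (k + 1) → ℝ)) := by
        refine measurable_pi_lambda _ fun i => ?_
        refine Fin.cases ?_ (fun j => ?_) i
        · simpa using measurable_id'
        · simp
      exact this hS
  · rw [indicator_of_notMem hx]
    have : ∀ y : ℝ, S.indicator (fun x => Real.exp (dp ξ x)) (Fin.cons y x) = 0 :=
      fun y => indicator_of_notMem (h2 x hx y) _
    simp [this]

end BVI

open MeasureTheory Filter Topology Set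
open scoped RealInnerProductSpace Pointwise BigOperators

namespace BVI
set_option linter.unusedSectionVars false
variable {k : ℕ}

theorem ratAn_coord0 : RatAn (RQ (k + 1)) (fun ξ => ξ 0) :=
  RatAn.clm (ContinuousLinearMap.proj (R := ℝ) (φ := fun _ : Fin (k + 1) => ℝ) 0)
    fun w hw => by simpa using hw 0

theorem nice_of_mul {S : Set (Fin (k + 1) → ℝ)}
    (h : NiceF (RQ (k + 1)) {ξ | GoodL S (dp ξ)} (fun ξ => ξ 0 * ∫ x in S, Real.exp (dp ξ x))) :
    Nice S :=
  NiceF.of_mul h ratAn_coord0 ⟨fun _ => 1, one_ne_zero⟩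

theorem nice_base00 (R : List ((Fin k → ℚ) × ℚ)) : Nice (spoly R [] []) := by
  refine (NiceF.ofRatAn (RatAn.const _ IsQ.zero)).congr fun ξ hξ => ?_
  have : spoly R [] [] = ∅ := by
    by_contra hne
    obtain ⟨x, hx⟩ := Set.nonempty_iff_ne_empty.2 hne
    obtain ⟨C, ε, hε, h⟩ := hξ
    have hm : ∀ y : ℝ, ξ 0 * y + dp (fun i => ξ i.succ) (Fin.tail x) ≤ C - ε * |y| := by
      intro y
      have h1 := h (Fin.cons y (Fin.tail x)) (by rw [mem_spoly_cons]; exact ⟨hx.1, by simp, by simp⟩)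
      rw [dp_cons] at h1
      have := mul_le_mul_of_nonneg_left (abs_le_cons y (Fin.tail x)) hε.le
      linarith
    set c := dp (fun i => ξ i.succ) (Fin.tail x)
    have h1 := hm ((|C - c| + 1) / ε)
    have h2 := hm (-((|C - c| + 1) / ε))
    rw [abs_neg] at h2
    have h3 : ε * |(|C - c| + 1) / ε| = |C - c| + 1 := by
      rw [abs_of_nonneg (by positivity)]; field_simp
    have := le_abs_self (C - c)
    linarith
  rw [this]; simp

theorem nice_base10 (IH : ∀ L : List ((Fin k → ℚ) × ℚ), Nice (poly L))
    (R : List ((Fin k → ℚ) × ℚ)) (u : (Fin k → ℚ) × ℚ) : Nice (spoly R [u] []) := by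
  refine nice_of_mul ?_
  have hcons : ∀ x ∈ poly R, (Fin.cons (aff u x) x : Fin (k + 1) → ℝ) ∈ spoly R [u] [] := by
    intro x hx; rw [mem_spoly_cons]; simp [hx]
  have h1 := (niceF_term IH R u).mono
    (D' := {ξ | GoodL (spoly R [u] []) (dp ξ)}) fun ξ hξ => good_trace u hcons hξ
  refine h1.congr fun ξ hξ => ?_
  refine fubini_mul (measurableSet_spoly _ _ _) (measurableSet_poly R) hξ _ ?_ ?_
  · intro x hx
    have hset : {y : ℝ | (Fin.cons y x : Fin (k + 1) → ℝ) ∈ spoly R [u] []} = Iic (aff u x) := by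
      ext y; simp [mem_spoly_cons, hx]
    have hpos : 0 < ξ 0 := by
      obtain ⟨C, ε, hε, h⟩ := hξ
      by_contra hcon
      push Not at hcon
      have hm : ∀ y ≤ aff u x, ξ 0 * y + dp (fun i => ξ i.succ) x ≤ C - ε * |y| := by
        intro y hy
        have h1 := h (Fin.cons y x) (by rw [mem_spoly_cons]; simp [hx, hy])
        rw [dp_cons] at h1
        have := mul_le_mul_of_nonneg_left (abs_le_cons y x) hε.le
        linarith
      set c := dp (fun i => ξ i.succ) x
      have h1 := hm (-(|aff u x| + (|C - c| + 1) / ε)) (by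
        have := neg_abs_le (aff u x)
        have : 0 ≤ (|C - c| + 1) / ε := by positivity
        linarith)
      have h2 : 0 ≤ ξ 0 * -(|aff u x| + (|C - c| + 1) / ε) :=
        mul_nonneg_of_nonpos_of_nonpos hcon (by
          have : 0 ≤ (|C - c| + 1) / ε := by positivity
          have := abs_nonneg (aff u x)
          linarith)
      have hnn : 0 ≤ |aff u x| + (|C - c| + 1) / ε := by positivity
      rw [abs_neg, abs_of_nonneg hnn, mul_add ε] at h1
      have h3 : ε * ((|C - c| + 1) / ε) = |C - c| + 1 := by field_simp
      have := le_abs_self (C - c)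
      have : 0 ≤ ε * |aff u x| := by positivity
      linarith
    rw [hset]
    simp only [dp_cons, Real.exp_add]
    rw [integral_mul_const, integral_exp_mul_Iic hpos]
    field_simp
  · intro x hx y hy
    rw [mem_spoly_cons] at hy
    exact hx hy.1

theorem nice_base01 (IH : ∀ L : List ((Fin k → ℚ) × ℚ), Nice (poly L))
    (R : List ((Fin k → ℚ) × ℚ)) (u : (Fin k → ℚ) × ℚ) : Nice (spoly R [] [u]) := by
  refine nice_of_mul ?_
  have hcons : ∀ x ∈ poly R, (Fin.cons (aff u x) x : Fin (k + 1) → ℝ) ∈ spoly R [] [u] := by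
    intro x hx; rw [mem_spoly_cons]; simp [hx]
  have h1 := (niceF_term IH R u).mono
    (D' := {ξ | GoodL (spoly R [] [u]) (dp ξ)}) fun ξ hξ => good_trace u hcons hξ
  refine h1.neg.congr fun ξ hξ => ?_
  rw [← integral_neg]
  refine fubini_mul (measurableSet_spoly _ _ _) (measurableSet_poly R) hξ _ ?_ ?_
  · intro x hx
    have hset : {y : ℝ | (Fin.cons y x : Fin (k + 1) → ℝ) ∈ spoly R [] [u]} = Ici (aff u x) := by
      ext y; simp [mem_spoly_cons, hx]
    have hpos : ξ 0 < 0 := by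
      obtain ⟨C, ε, hε, h⟩ := hξ
      by_contra hcon
      push Not at hcon
      have hm : ∀ y, aff u x ≤ y → ξ 0 * y + dp (fun i => ξ i.succ) x ≤ C - ε * |y| := by
        intro y hy
        have h1 := h (Fin.cons y x) (by rw [mem_spoly_cons]; simp [hx, hy])
        rw [dp_cons] at h1
        have := mul_le_mul_of_nonneg_left (abs_le_cons y x) hε.le
        linarith
      set c := dp (fun i => ξ i.succ) x
      have h1 := hm (|aff u x| + (|C - c| + 1) / ε) (by
        have := le_abs_self (aff u x)
        have : 0 ≤ (|C - c| + 1) / ε := by positivity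
        linarith)
      have h2 : 0 ≤ ξ 0 * (|aff u x| + (|C - c| + 1) / ε) := by positivity
      have hnn : 0 ≤ |aff u x| + (|C - c| + 1) / ε := by positivity
      rw [abs_of_nonneg hnn, mul_add ε] at h1
      have h3 : ε * ((|C - c| + 1) / ε) = |C - c| + 1 := by field_simp
      have := le_abs_self (C - c)
      have : 0 ≤ ε * |aff u x| := by positivity
      linarith
    rw [hset, integral_Ici_eq_integral_Ioi]
    simp only [dp_cons, Real.exp_add]
    rw [integral_mul_const, integral_exp_mul_Ioi hpos]
    have := hpos.ne
    field_simp
  · intro x hx y hy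
    rw [mem_spoly_cons] at hy
    exact hx hy.1

/-- the constraint `aff u ≤ aff w` -/
def cmp (u w : (Fin k → ℚ) × ℚ) : (Fin k → ℚ) × ℚ := (u.1 - w.1, w.2 - u.2)

theorem lin_sub (a b : Fin k → ℚ) (x : Fin k → ℝ) : lin (a - b) x = lin a x - lin b x := by
  simp [lin, sub_mul]

theorem mem_poly_cmp (u w : (Fin k → ℚ) × ℚ) (R : List ((Fin k → ℚ) × ℚ)) (x : Fin k → ℝ) :
    x ∈ poly (cmp u w :: R) ↔ aff u x ≤ aff w x ∧ x ∈ poly R := by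
  simp only [poly, List.mem_cons, forall_eq_or_imp, mem_setOf_eq, cmp, lin_sub, aff]
  refine and_congr_left fun _ => ?_
  push_cast
  constructor <;> intro h <;> linarith

theorem nice_base11 (IH : ∀ L : List ((Fin k → ℚ) × ℚ), Nice (poly L))
    (R : List ((Fin k → ℚ) × ℚ)) (u l : (Fin k → ℚ) × ℚ) : Nice (spoly R [u] [l]) := by
  refine nice_of_mul ?_
  set R' := cmp l u :: R with hR'
  have hcons : ∀ x ∈ poly R', (Fin.cons (aff u x) x : Fin (k + 1) → ℝ) ∈ spoly R [u] [l] := by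
    intro x hx
    rw [mem_poly_cmp] at hx
    rw [mem_spoly_cons]; simp [hx]
  have hcons' : ∀ x ∈ poly R', (Fin.cons (aff l x) x : Fin (k + 1) → ℝ) ∈ spoly R [u] [l] := by
    intro x hx
    rw [mem_poly_cmp] at hx
    rw [mem_spoly_cons]; simp [hx]
  have h1 := (niceF_term IH R' u).mono
    (D' := {ξ | GoodL (spoly R [u] [l]) (dp ξ)}) fun ξ hξ => good_trace u hcons hξ
  have h2 := (niceF_term IH R' l).mono
    (D' := {ξ | GoodL (spoly R [u] [l]) (dp ξ)}) fun ξ hξ => good_trace l hcons' hξ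
  have hintg : ∀ w : (Fin k → ℚ) × ℚ, ∀ ξ : Fin (k + 1) → ℝ, GoodL (poly R') (dp (subL w ξ)) →
      IntegrableOn (fun x => Real.exp (dp ξ (Fin.cons (aff w x) x))) (poly R') volume := by
    intro w ξ h
    have := (GoodL.integrableOn volume (measurableSet_poly R') (continuous_dp _) h).const_mul
      (Real.exp (ξ 0 * w.2))
    simp only [dp_cons_aff, Real.exp_add]
    exact this
  refine (h1.sub h2).congr fun ξ hξ => ?_
  rw [← integral_sub (hintg u ξ (good_trace u hcons hξ)) (hintg l ξ (good_trace l hcons' hξ))]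
  refine fubini_mul (measurableSet_spoly _ _ _) (measurableSet_poly R') hξ _ ?_ ?_
  · intro x hx
    rw [mem_poly_cmp] at hx
    have hset : {y : ℝ | (Fin.cons y x : Fin (k + 1) → ℝ) ∈ spoly R [u] [l]} =
        Icc (aff l x) (aff u x) := by
      ext y; simp [mem_spoly_cons, hx, and_comm]
    rw [hset, integral_Icc_eq_integral_Ioc, ← intervalIntegral.integral_of_le hx.1]
    simp only [dp_cons, ← intervalIntegral.integral_const_mul]
    have := intervalIntegral.integral_eq_sub_of_hasDerivAt (a := aff l x) (b := aff u x)
      (f := fun y => Real.exp (ξ 0 * y + dp (fun i => ξ i.succ) x))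
      (f' := fun y => ξ 0 * Real.exp (ξ 0 * y + dp (fun i => ξ i.succ) x)) ?_ ?_
    · exact this
    · intro y _
      have h := (((hasDerivAt_id y).const_mul (ξ 0)).add_const (dp (fun i => ξ i.succ) x)).exp
      simpa [mul_comm] using h
    · exact Continuous.intervalIntegrable (by fun_prop) _ _
  · intro x hx y hy
    rw [mem_spoly_cons] at hy
    refine hx ?_
    rw [mem_poly_cmp]
    have h3 := hy.2.1 u (by simp)
    have h4 := hy.2.2 l (by simp)
    exact ⟨h4.trans h3, hy.1⟩

theorem nice_base (IH : ∀ L : List ((Fin k → ℚ) × ℚ), Nice (poly L))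
    (R U Lo : List ((Fin k → ℚ) × ℚ)) (hU : U.length ≤ 1) (hLo : Lo.length ≤ 1) :
    Nice (spoly R U Lo) := by
  rcases U with _ | ⟨u, _ | ⟨u', U⟩⟩
  · rcases Lo with _ | ⟨l, _ | ⟨l', Lo⟩⟩
    · exact nice_base00 R
    · exact nice_base01 IH R l
    · simp at hLo
  · rcases Lo with _ | ⟨l, _ | ⟨l', Lo⟩⟩
    · exact nice_base10 IH R u
    · exact nice_base11 IH R u l
    · simp at hLo
  · simp at hU

theorem mem_spoly (R U Lo : List ((Fin k → ℚ) × ℚ)) (x : Fin (k + 1) → ℝ) :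
    x ∈ spoly R U Lo ↔ Fin.tail x ∈ poly R ∧ (∀ u ∈ U, x 0 ≤ aff u (Fin.tail x)) ∧
    ∀ l ∈ Lo, aff l (Fin.tail x) ≤ x 0 := Iff.rfl

theorem nice_stepU (IH : ∀ L : List ((Fin k → ℚ) × ℚ), Nice (poly L)) (n : ℕ) :
    ∀ (R U Lo : List ((Fin k → ℚ) × ℚ)), U.length ≤ n + 1 → Lo.length ≤ 1 →
      Nice (spoly R U Lo) := by
  induction n with
  | zero => exact fun R U Lo h1 h2 => nice_base IH R U Lo (by simpa using h1) h2
  | succ n ih =>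
    intro R U Lo hU hLo
    rcases U with _ | ⟨u, _ | ⟨u', U⟩⟩
    · exact ih _ _ _ (by simp) hLo
    · exact ih _ _ _ (by simp) hLo
    · simp only [List.length_cons] at hU
      have e1 : spoly R (u :: u' :: U) Lo =
          spoly (cmp u u' :: R) (u :: U) Lo ∪ spoly (cmp u' u :: R) (u' :: U) Lo := by
        ext x
        simp only [mem_union, mem_spoly, mem_poly_cmp, List.mem_cons, forall_eq_or_imp]
        rcases le_total (aff u (Fin.tail x)) (aff u' (Fin.tail x)) with h | h <;> grind
      have e2 : spoly (cmp u u' :: R) (u :: U) Lo ∩ spoly (cmp u' u :: R) (u' :: U) Lo =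
          spoly (cmp u u' :: cmp u' u :: R) (u :: U) Lo := by
        ext x
        simp only [mem_inter_iff, mem_spoly, mem_poly_cmp, List.mem_cons, forall_eq_or_imp]
        grind
      rw [e1]
      refine Nice.union (measurableSet_spoly _ _ _) (measurableSet_spoly _ _ _)
        (ih _ _ _ (by simp; omega) hLo) (ih _ _ _ (by simp; omega) hLo) ?_
      rw [e2]
      exact ih _ _ _ (by simp; omega) hLo

theorem nice_stepL (IH : ∀ L : List ((Fin k → ℚ) × ℚ), Nice (poly L)) (n : ℕ) :
    ∀ (R U Lo : List ((Fin k → ℚ) × ℚ)), Lo.length ≤ n + 1 → Nice (spoly R U Lo) := by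
  induction n with
  | zero => exact fun R U Lo h2 => nice_stepU IH U.length R U Lo (by simp) h2
  | succ n ih =>
    intro R U Lo hLo
    rcases Lo with _ | ⟨u, _ | ⟨u', Lo⟩⟩
    · exact ih _ _ _ (by simp)
    · exact ih _ _ _ (by simp)
    · simp only [List.length_cons] at hLo
      have e1 : spoly R U (u :: u' :: Lo) =
          spoly (cmp u' u :: R) U (u :: Lo) ∪ spoly (cmp u u' :: R) U (u' :: Lo) := by
        ext x
        simp only [mem_union, mem_spoly, mem_poly_cmp, List.mem_cons, forall_eq_or_imp]
        rcases le_total (aff u (Fin.tail x)) (aff u' (Fin.tail x)) with h | h <;> grind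
      have e2 : spoly (cmp u' u :: R) U (u :: Lo) ∩ spoly (cmp u u' :: R) U (u' :: Lo) =
          spoly (cmp u u' :: cmp u' u :: R) U (u :: Lo) := by
        ext x
        simp only [mem_inter_iff, mem_spoly, mem_poly_cmp, List.mem_cons, forall_eq_or_imp]
        grind
      rw [e1]
      refine Nice.union (measurableSet_spoly _ _ _) (measurableSet_spoly _ _ _)
        (ih _ _ _ (by simp; omega)) (ih _ _ _ (by simp; omega)) ?_
      rw [e2]
      exact ih _ _ _ (by simp; omega)

theorem lin_smul (c : ℚ) (a : Fin k → ℚ) (x : Fin k → ℝ) : lin (c • a) x = c * lin a x := by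
  simp [lin, Finset.mul_sum, mul_assoc]

theorem poly_eq_spoly (L : List ((Fin (k + 1) → ℚ) × ℚ)) :
    ∃ R U Lo : List ((Fin k → ℚ) × ℚ), poly L = spoly R U Lo := by
  induction L with
  | nil => exact ⟨[], [], [], by ext; simp [poly, spoly]⟩
  | cons p L ih =>
    obtain ⟨R, U, Lo, h⟩ := ih
    have hL : ∀ x, x ∈ poly (p :: L) ↔
        (p.1 0 : ℝ) * x 0 + lin (Fin.tail p.1) (Fin.tail x) ≤ p.2 ∧ x ∈ poly L := by
      intro x
      simp [poly, lin, Fin.sum_univ_succ, Fin.tail]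
    rcases lt_trichotomy (p.1 0) 0 with h0 | h0 | h0
    · refine ⟨R, U, ((-(p.1 0)⁻¹) • Fin.tail p.1, p.2 / p.1 0) :: Lo, ?_⟩
      ext x
      have h0' : (p.1 0 : ℝ) < 0 := by exact_mod_cast h0
      have : aff ((-(p.1 0)⁻¹) • Fin.tail p.1, p.2 / p.1 0) (Fin.tail x) ≤ x 0 ↔
          (p.1 0 : ℝ) * x 0 + lin (Fin.tail p.1) (Fin.tail x) ≤ p.2 := by
        simp only [aff, lin_smul]
        push_cast
        have e : -(p.1 0 : ℝ)⁻¹ * lin (Fin.tail p.1) (Fin.tail x) + p.2 / p.1 0 =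
          (p.2 - lin (Fin.tail p.1) (Fin.tail x)) / p.1 0 := by field_simp; ring
        rw [e, div_le_iff_of_neg h0']
        constructor <;> intro h <;> linarith
      rw [hL, h, mem_spoly, mem_spoly, ← this]
      simp only [List.mem_cons, forall_eq_or_imp]
      tauto
    · refine ⟨(Fin.tail p.1, p.2) :: R, U, Lo, ?_⟩
      ext x
      rw [hL, h, mem_spoly, mem_spoly]
      simp only [h0, poly, List.mem_cons, forall_eq_or_imp, mem_setOf_eq]
      simp [and_assoc]
    · refine ⟨R, ((-(p.1 0)⁻¹) • Fin.tail p.1, p.2 / p.1 0) :: U, Lo, ?_⟩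
      ext x
      have h0' : 0 < (p.1 0 : ℝ) := by exact_mod_cast h0
      have : x 0 ≤ aff ((-(p.1 0)⁻¹) • Fin.tail p.1, p.2 / p.1 0) (Fin.tail x) ↔
          (p.1 0 : ℝ) * x 0 + lin (Fin.tail p.1) (Fin.tail x) ≤ p.2 := by
        simp only [aff, lin_smul]
        push_cast
        have e : -(p.1 0 : ℝ)⁻¹ * lin (Fin.tail p.1) (Fin.tail x) + p.2 / p.1 0 =
          (p.2 - lin (Fin.tail p.1) (Fin.tail x)) / p.1 0 := by field_simp; ring
        rw [e, le_div_iff₀ h0']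
        constructor <;> intro h <;> linarith
      rw [hL, h, mem_spoly, mem_spoly, ← this]
      simp only [List.mem_cons, forall_eq_or_imp]
      tauto

theorem nice_poly : ∀ (k : ℕ) (L : List ((Fin k → ℚ) × ℚ)), Nice (poly L)
  | 0, L => Nice.zero_dim L
  | k + 1, L => by
    obtain ⟨R, U, Lo, h⟩ := poly_eq_spoly L
    rw [h]
    exact nice_stepL (nice_poly k) Lo.length R U Lo (by simp)

end BVI

open MeasureTheory Filter Topology Set
open scoped RealInnerProductSpace Pointwise BigOperators

namespace BVI
set_option linter.unusedSectionVars false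
set_option linter.deprecated false

section fm
variable {k : ℕ}

theorem exists_mid (A B : List ℚ) (h : ∀ a ∈ A, ∀ b ∈ B, a ≤ b) :
    ∃ y : ℚ, (∀ a ∈ A, a ≤ y) ∧ ∀ b ∈ B, y ≤ b := by
  by_cases hA : A = []
  · subst hA
    by_cases hB : B = []
    · subst hB; exact ⟨0, by simp⟩
    · obtain ⟨m, hm, h2⟩ := Finset.exists_min_image B.toFinset id
        (by simpa [List.toFinset_nonempty_iff] using hB)
      exact ⟨m, by simp, fun b hb => h2 b (by simpa using hb)⟩
  · obtain ⟨m, hm, h2⟩ := Finset.exists_max_image A.toFinset id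
        (by simpa [List.toFinset_nonempty_iff] using hA)
    exact ⟨m, fun a ha => h2 a (by simpa using ha), fun b hb => h m (by simpa using hm) b hb⟩

/-- rational value of an affine form -/
def affQ {k : ℕ} (u : (Fin k → ℚ) × ℚ) (x : Fin k → ℚ) : ℚ := ∑ i, u.1 i * x i + u.2

theorem aff_cast (u : (Fin k → ℚ) × ℚ) (x : Fin k → ℚ) :
    aff u (fun i => (x i : ℝ)) = (affQ u x : ℝ) := by
  simp [aff, lin, affQ]

theorem poly_rat : ∀ (k : ℕ) (L : List ((Fin k → ℚ) × ℚ)), (poly L).Nonempty →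
    ∃ x : Fin k → ℚ, (fun i => (x i : ℝ)) ∈ poly L
  | 0, L => by
    rintro ⟨x, hx⟩
    refine ⟨fun i => 0, ?_⟩
    convert hx
  | k + 1, L => by
    obtain ⟨R, U, Lo, h⟩ := poly_eq_spoly L
    rw [h]
    rintro ⟨x, hx⟩
    rw [mem_spoly] at hx
    have h1 : Fin.tail x ∈ poly (R ++
        Lo.flatMap fun l => U.map fun u => ((l.1 - u.1, u.2 - l.2) : (Fin k → ℚ) × ℚ)) := by
      intro p hp
      rw [List.mem_append] at hp
      rcases hp with hp | hp
      · exact hx.1 p hp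
      · simp only [List.mem_flatMap, List.mem_map] at hp
        obtain ⟨l, hl, u, hu, rfl⟩ := hp
        have := (hx.2.2 l hl).trans (hx.2.1 u hu)
        simp only [aff, lin, Pi.sub_apply, Rat.cast_sub, sub_mul, Finset.sum_sub_distrib] at this ⊢
        linarith
    obtain ⟨y, hy⟩ := poly_rat k _ ⟨_, h1⟩
    obtain ⟨z, hz1, hz2⟩ := exists_mid (Lo.map fun l => affQ l y) (U.map fun u => affQ u y) (by
      simp only [List.mem_map]
      rintro _ ⟨l, hl, rfl⟩ _ ⟨u, hu, rfl⟩
      have := hy (l.1 - u.1, u.2 - l.2) (by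
        rw [List.mem_append]; right
        simp only [List.mem_flatMap, List.mem_map]
        exact ⟨l, hl, u, hu, rfl⟩)
      have h2 : aff l (fun i => (y i : ℝ)) ≤ aff u (fun i => (y i : ℝ)) := by
        simp only [aff, lin, Pi.sub_apply, Rat.cast_sub, sub_mul, Finset.sum_sub_distrib] at this ⊢
        linarith
      rw [aff_cast, aff_cast] at h2
      exact_mod_cast h2)
    refine ⟨Fin.cons z y, ?_⟩
    have e : (fun i => ((Fin.cons z y : Fin (k + 1) → ℚ) i : ℝ)) =
        (Fin.cons (z : ℝ) (fun i => (y i : ℝ)) : Fin (k + 1) → ℝ) := by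
      ext i
      refine Fin.cases ?_ (fun j => ?_) i <;> simp
    rw [e, mem_spoly_cons]
    refine ⟨fun p hp => hy p (by simp [hp]), fun u hu => ?_, fun l hl => ?_⟩
    · rw [aff_cast]; exact_mod_cast hz2 _ (List.mem_map_of_mem hu)
    · rw [aff_cast]; exact_mod_cast hz1 _ (List.mem_map_of_mem hl)
end fm

variable {d : ℕ}

theorem pairE_add_left (a b x : Vd d) : pairE (a + b) x = pairE a x + pairE b x :=
  inner_add_left _ _ _
theorem pairE_add_right (a x y : Vd d) : pairE a (x + y) = pairE a x + pairE a y :=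
  inner_add_right _ _ _
theorem pairE_sub_left (a b x : Vd d) : pairE (a - b) x = pairE a x - pairE b x :=
  inner_sub_left _ _ _
theorem pairE_sub_right (a x y : Vd d) : pairE a (x - y) = pairE a x - pairE a y :=
  inner_sub_right _ _ _
theorem pairE_smul_left (c : ℝ) (a x : Vd d) : pairE (c • a) x = c * pairE a x :=
  real_inner_smul_left _ _ _
theorem pairE_smul_right (c : ℝ) (a x : Vd d) : pairE a (c • x) = c * pairE a x :=
  real_inner_smul_right _ _ _
theorem pairE_neg_left (a x : Vd d) : pairE (-a) x = - pairE a x := inner_neg_left _ _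
theorem pairE_neg_right (a x : Vd d) : pairE a (-x) = - pairE a x := inner_neg_right _ _
theorem pairE_zero_left (x : Vd d) : pairE 0 x = 0 := inner_zero_left _
theorem pairE_zero_right (x : Vd d) : pairE x 0 = 0 := inner_zero_right _
theorem pairE_sum_right {ι : Type*} (s : Finset ι) (a : Vd d) (f : ι → Vd d) :
    pairE a (∑ i ∈ s, f i) = ∑ i ∈ s, pairE a (f i) := inner_sum _ _ _
theorem pairE_sum_left {ι : Type*} (s : Finset ι) (a : Vd d) (f : ι → Vd d) :
    pairE (∑ i ∈ s, f i) a = ∑ i ∈ s, pairE (f i) a := sum_inner _ _ _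
theorem continuous_pairE (a : Vd d) : Continuous (pairE a) := by
  unfold pairE; fun_prop
theorem pairE_abs_le (a x : Vd d) : |pairE a x| ≤ ‖a‖ * ‖x‖ := abs_real_inner_le_norm a x

/-- evaluation at `x` as a continuous linear functional of `ξ` -/
noncomputable def evL (x : Vd d) : Vd d →L[ℝ] ℝ := innerSL ℝ x
theorem evL_apply (x ξ : Vd d) : evL x ξ = pairE ξ x := by
  simp [evL, pairE, real_inner_comm]

/-- polyhedron from a list of inequalities -/
def rpoly (L : List (Vd d × ℚ)) : Set (Vd d) := {x | ∀ p ∈ L, pairE p.1 x ≤ p.2}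

/-- internal notion of rational polyhedron -/
def IsRP (Λ : AddSubgroup (Vd d)) (P : Set (Vd d)) : Prop :=
  ∃ L : List (Vd d × ℚ), (∀ p ∈ L, IsDualIntegral Λ p.1) ∧ P = rpoly L

variable {Λ : AddSubgroup (Vd d)}

theorem IsRP.of (hΛ : IsFullLattice Λ) {P : Set (Vd d)} (h : IsRatPolyhedron Λ P) : IsRP Λ P := by
  obtain ⟨n, φ, c, hφ, rfl⟩ := h
  refine ⟨List.ofFn fun i => (φ i, c i), ?_, ?_⟩
  · intro p hp
    rw [List.mem_ofFn] at hp
    obtain ⟨i, rfl⟩ := hp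
    exact hφ i
  · rw [hΛ.2]
    ext x
    simp [rpoly, List.mem_ofFn]

theorem IsRP.inter {P Q : Set (Vd d)} (h : IsRP Λ P) (h' : IsRP Λ Q) : IsRP Λ (P ∩ Q) := by
  obtain ⟨L, hL, rfl⟩ := h
  obtain ⟨L', hL', rfl⟩ := h'
  refine ⟨L ++ L', ?_, ?_⟩
  · intro p hp
    rcases List.mem_append.1 hp with hp | hp
    · exact hL p hp
    · exact hL' p hp
  · ext x
    simp only [rpoly, mem_inter_iff, mem_setOf_eq, List.mem_append]
    constructor
    · rintro ⟨a, b⟩ p (hp | hp)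
      · exact a p hp
      · exact b p hp
    · exact fun a => ⟨fun p hp => a p (Or.inl hp), fun p hp => a p (Or.inr hp)⟩

theorem IsDualIntegral.neg {φ : Vd d} (h : IsDualIntegral Λ φ) : IsDualIntegral Λ (-φ) := by
  intro x hx
  obtain ⟨n, hn⟩ := h x hx
  exact ⟨-n, by rw [pairE_neg_left, hn]; push_cast; rfl⟩

theorem IsRP.univ : IsRP Λ (univ : Set (Vd d)) := ⟨[], by simp, by ext; simp [rpoly]⟩

theorem IsRP.le {φ : Vd d} (h : IsDualIntegral Λ φ) (c : ℚ) : IsRP Λ {x | pairE φ x ≤ c} :=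
  ⟨[(φ, c)], by simpa using h, by ext; simp [rpoly]⟩

theorem IsRP.ge {φ : Vd d} (h : IsDualIntegral Λ φ) (c : ℚ) : IsRP Λ {x | (c : ℝ) ≤ pairE φ x} :=
  ⟨[(-φ, -c)], by simpa using IsDualIntegral.neg h, by ext; simp [rpoly, pairE_neg_left]⟩

theorem IsRP.isClosed {P : Set (Vd d)} (h : IsRP Λ P) : IsClosed P := by
  obtain ⟨L, hL, rfl⟩ := h
  have : rpoly L = ⋂ p ∈ L, {x | pairE p.1 x ≤ p.2} := by ext; simp [rpoly]
  rw [this]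
  exact isClosed_biInter fun p _ => isClosed_le (continuous_pairE _) continuous_const

theorem IsRP.meas {P : Set (Vd d)} (h : IsRP Λ P) : MeasurableSet P := h.isClosed.measurableSet

theorem pairE_rat {φ s : Vd d} (h : IsDualIntegral Λ φ) (hs : IsRatPoint Λ s) :
    IsQ (pairE φ s) := by
  obtain ⟨q, hq, hs⟩ := hs
  obtain ⟨n, hn⟩ := h _ hs
  rw [pairE_smul_right] at hn
  have : (q : ℝ) ≠ 0 := by exact_mod_cast hq
  have e : pairE φ s = n / q := by field_simp; linarith
  rw [e]
  exact (IsQ.int n).div (IsQ.int q)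

theorem IsRatPoint.neg {s : Vd d} (hs : IsRatPoint Λ s) : IsRatPoint Λ (-s) := by
  obtain ⟨q, hq, hs⟩ := hs
  exact ⟨q, hq, by rw [smul_neg]; exact Λ.neg_mem hs⟩

theorem IsRatPoint.ofMem {s : Vd d} (hs : s ∈ Λ) : IsRatPoint Λ s :=
  ⟨1, one_ne_zero, by simpa using hs⟩

theorem IsRP.translate {P : Set (Vd d)} (h : IsRP Λ P) {s : Vd d} (hs : IsRatPoint Λ s) :
    IsRP Λ ((fun x => s + x) '' P) := by
  obtain ⟨L, hL, rfl⟩ := h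
  choose! q hq using fun (p : Vd d × ℚ) (hp : p ∈ L) => pairE_rat (hL p hp) hs
  refine ⟨L.map fun p => (p.1, p.2 + q p), ?_, ?_⟩
  · intro p hp
    obtain ⟨p', hp', rfl⟩ := List.mem_map.1 hp
    exact hL p' hp'
  · ext x
    rw [image_add_left, mem_preimage]
    simp only [rpoly, mem_setOf_eq, List.mem_map, forall_exists_index, and_imp,
      forall_apply_eq_imp_iff₂]
    refine forall₂_congr fun p hp => ?_
    push_cast
    rw [← hq p hp, pairE_add_right, pairE_neg_right]
    constructor <;> intro h <;> linarith

/-- parametrization -/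
noncomputable def par {k : ℕ} (x₀ : Vd d) (v : Fin k → Vd d) (t : Fin k → ℝ) : Vd d :=
  x₀ + ∑ i, t i • v i

theorem pairE_par {k : ℕ} (x₀ : Vd d) (v : Fin k → Vd d) (t : Fin k → ℝ) (ξ : Vd d) :
    pairE ξ (par x₀ v t) = pairE ξ x₀ + dp (fun i => pairE ξ (v i)) t := by
  simp only [par, pairE_add_right, pairE_sum_right, pairE_smul_right, dp, mul_comm]

theorem pullback {k : ℕ} {x₀ : Vd d} (hx : IsRatPoint Λ x₀) {v : Fin k → Vd d}
    (hv : ∀ i, v i ∈ Λ) {P : Set (Vd d)} (h : IsRP Λ P) :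
    ∃ L' : List ((Fin k → ℚ) × ℚ), par x₀ v ⁻¹' P = poly L' := by
  obtain ⟨L, hL, rfl⟩ := h
  choose! q hq using fun (p : Vd d × ℚ) (hp : p ∈ L) => pairE_rat (hL p hp) hx
  choose! a ha using fun (p : Vd d × ℚ) (hp : p ∈ L) (i : Fin k) => (hL p hp) _ (hv i)
  refine ⟨L.map fun p => (fun i => (a p i : ℚ), p.2 - q p), ?_⟩
  ext t
  simp only [rpoly, poly, mem_preimage, mem_setOf_eq, List.mem_map, forall_exists_index, and_imp,
      forall_apply_eq_imp_iff₂]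
  refine forall₂_congr fun p hp => ?_
  rw [pairE_par, hq p hp]
  simp only [ha p hp, dp, lin]
  push_cast
  constructor <;> intro h <;> linarith

theorem lattice_basis (hΛ : IsFullLattice Λ) :
    ∃ b : Module.Basis (Fin d) ℝ (Vd d), Λ = AddSubgroup.closure (Set.range b) := by
  obtain ⟨⟨k, v, hv, hc⟩, hs⟩ := hΛ
  have hs' : ⊤ ≤ Submodule.span ℝ (Set.range v) := by
    rw [← hs, Submodule.span_le, hc]
    intro x hx
    refine AddSubgroup.closure_induction (p := fun x _ => x ∈ Submodule.span ℝ (Set.range v))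
      ?_ ?_ ?_ ?_ hx
    · exact fun x hx => Submodule.subset_span hx
    · exact Submodule.zero_mem _
    · exact fun x y _ _ hx hy => Submodule.add_mem _ hx hy
    · exact fun x _ hx => Submodule.neg_mem _ hx
  let b := Module.Basis.mk hv hs'
  have hk : k = d := by
    have := Module.finrank_eq_card_basis b
    simpa using this.symm
  subst hk
  exact ⟨b, by rw [hc]; simp [b]⟩

theorem mem_closure_basis {k : ℕ} {v : Fin k → Vd d} {y : Vd d}
    (hy : y ∈ AddSubgroup.closure (Set.range v)) : ∃ c : Fin k → ℤ, y = ∑ i, (c i : ℝ) • v i := by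
  classical
  refine AddSubgroup.closure_induction
    (p := fun y _ => ∃ c : Fin k → ℤ, y = ∑ i, (c i : ℝ) • v i) ?_ ?_ ?_ ?_ hy
  · rintro _ ⟨i, rfl⟩
    exact ⟨Pi.single i 1, by simp [Pi.single_apply, ite_smul]⟩
  · exact ⟨0, by simp⟩
  · rintro x y _ _ ⟨c, rfl⟩ ⟨c', rfl⟩
    exact ⟨c + c', by simp [add_smul, Finset.sum_add_distrib]⟩
  · rintro x _ ⟨c, rfl⟩
    exact ⟨-c, by simp⟩

theorem ratPoint_sum {k : ℕ} {v : Fin k → Vd d} (hv : ∀ i, v i ∈ Λ) (c : Fin k → ℚ) :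
    IsRatPoint Λ (∑ i, (c i : ℝ) • v i) := by
  refine ⟨∏ i, ((c i).den : ℤ), ?_, ?_⟩
  · rw [Finset.prod_ne_zero_iff]; intro i _; exact_mod_cast (c i).den_nz
  · rw [Finset.smul_sum]
    refine Λ.sum_mem fun i _ => ?_
    have : ∃ n : ℤ, ((∏ i, ((c i).den : ℤ) : ℤ) : ℝ) * (c i : ℝ) = n := by
      classical
      refine ⟨(∏ j ∈ Finset.univ.erase i, ((c j).den : ℤ)) * (c i).num, ?_⟩
      rw [← Finset.mul_prod_erase _ _ (Finset.mem_univ i)]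
      have h1 : ((c i).den : ℝ) * (c i : ℝ) = (c i).num := by
        exact_mod_cast Rat.den_mul_eq_num (c i)
      push_cast
      rw [← h1]; ring
    obtain ⟨n, hn⟩ := this
    rw [smul_smul, hn]
    have := Λ.zsmul_mem (hv i) n
    rwa [← Int.cast_smul_eq_zsmul ℝ] at this

theorem IsRP.ratPoint (hΛ : IsFullLattice Λ) {P : Set (Vd d)} (h : IsRP Λ P) (hne : P.Nonempty) :
    ∃ s ∈ P, IsRatPoint Λ s := by
  obtain ⟨b, hb⟩ := lattice_basis hΛ
  have hbm : ∀ i, b i ∈ Λ := fun i => by rw [hb]; exact AddSubgroup.subset_closure ⟨i, rfl⟩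
  obtain ⟨L', hL'⟩ := pullback (IsRatPoint.ofMem Λ.zero_mem) hbm h
  obtain ⟨x, hx⟩ := hne
  have hx' : (fun i => b.repr x i) ∈ poly L' := by
    rw [← hL', mem_preimage, par, b.sum_repr, zero_add]; exact hx
  obtain ⟨y, hy⟩ := poly_rat d L' ⟨_, hx'⟩
  rw [← hL', mem_preimage] at hy
  refine ⟨_, hy, ?_⟩
  rw [par, zero_add]
  exact ratPoint_sum hbm y

end BVI

open MeasureTheory Filter Topology Set
open scoped RealInnerProductSpace Pointwise BigOperators

namespace BVI
open scoped Matrix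
set_option linter.unusedSectionVars false
set_option linter.deprecated false
variable {d : ℕ} {Λ : AddSubgroup (Vd d)}

/-- linear part of the parametrization -/
noncomputable def parL {k : ℕ} (v : Fin k → Vd d) : (Fin k → ℝ) →ₗ[ℝ] Vd d :=
  Fintype.linearCombination ℝ v

theorem parL_apply {k : ℕ} (v : Fin k → Vd d) (t : Fin k → ℝ) : parL v t = ∑ i, t i • v i := by
  simp [parL, Fintype.linearCombination_apply]

theorem par_eq {k : ℕ} (x₀ : Vd d) (v : Fin k → Vd d) (t : Fin k → ℝ) :
    par x₀ v t = x₀ + parL v t := by rw [parL_apply]; rfl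

theorem parL_inj {k : ℕ} {v : Fin k → Vd d} (hv : LinearIndependent ℝ v) :
    Function.Injective (parL v) := by
  rwa [linearIndependent_iff_injective_fintypeLinearCombination] at hv

theorem par_cont {k : ℕ} (x₀ : Vd d) (v : Fin k → Vd d) : Continuous (par x₀ v) := by
  unfold par; fun_prop

theorem par_emb {k : ℕ} (x₀ : Vd d) {v : Fin k → Vd d} (hv : LinearIndependent ℝ v) :
    MeasurableEmbedding (par x₀ v) := by
  refine (par_cont x₀ v).measurableEmbedding ?_
  intro a b h
  rw [par_eq, par_eq] at h
  exact parL_inj hv (add_left_cancel h)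

theorem par_shift {k : ℕ} (x₀ : Vd d) (v : Fin k → Vd d) (t : Fin k → ℝ) :
    Measure.map (par (par x₀ v t) v) volume = Measure.map (par x₀ v) volume := by
  have h1 : par (par x₀ v t) v = par x₀ v ∘ (fun s => t + s) := by
    ext1 s
    simp only [Function.comp, par_eq, map_add, add_assoc]
  rw [h1, ← Measure.map_map (par_cont _ _).measurable (measurable_const_add t)]
  rw [(measurePreserving_add_left volume t).map_eq]

theorem parL_range {k : ℕ} (v : Fin k → Vd d) (y : Vd d) :
    y ∈ Submodule.span ℝ (Set.range v) ↔ ∃ t, parL v t = y := by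
  rw [Submodule.mem_span_range_iff_exists_fun]
  simp only [parL_apply]

theorem can_rebase {k : ℕ} {x₀ : Vd d} {v : Fin k → Vd d} {A : Set (Vd d)}
    (hA : A = {x | ∃ t : Fin k → ℝ, x = x₀ + ∑ i, t i • v i}) {y : Vd d} (hy : y ∈ A) :
    A = {x | ∃ t : Fin k → ℝ, x = par y v t} ∧
      Measure.map (par x₀ v) volume = Measure.map (par y v) volume := by
  rw [hA] at hy
  obtain ⟨t, ht⟩ := hy
  change y = par x₀ v t at ht
  refine ⟨?_, ?_⟩
  · rw [hA, ht]
    ext z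
    constructor
    · rintro ⟨s, rfl⟩
      refine ⟨s - t, ?_⟩
      change par x₀ v s = _
      simp only [par_eq, map_sub]
      abel
    · rintro ⟨s, rfl⟩
      refine ⟨t + s, ?_⟩
      change _ = par x₀ v (t + s)
      simp only [par_eq, map_add]
      abel
  · rw [ht, par_shift]

theorem span_le_of {k k' : ℕ} {x : Vd d} {v : Fin k → Vd d} {v' : Fin k' → Vd d}
    (h : {z | ∃ t, z = par x v t} = {z | ∃ t, z = par x v' t}) :
    Submodule.span ℝ (Set.range v) ≤ Submodule.span ℝ (Set.range v') := by
  intro y hy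
  obtain ⟨t, rfl⟩ := (parL_range v y).1 hy
  have : par x v t ∈ {z | ∃ t, z = par x v' t} := by rw [← h]; exact ⟨t, rfl⟩
  obtain ⟨t', ht'⟩ := this
  rw [par_eq, par_eq] at ht'
  exact (parL_range v' _).2 ⟨t', (add_left_cancel ht').symm⟩

theorem can_unique {A : Set (Vd d)} {m m' : Measure (Vd d)} (h : IsCanonicalMeasure Λ A m)
    (h' : IsCanonicalMeasure Λ A m') : m = m' := by
  obtain ⟨k, x, v, hxA, hvΛ, hv, hA, hintg, hm⟩ := h
  obtain ⟨k', x', v', hxA', hvΛ', hv', hA', hintg', hm'⟩ := h'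
  obtain ⟨hB, he⟩ := can_rebase hA' hxA
  change m = Measure.map (par x v) volume at hm
  change m' = Measure.map (par x' v') volume at hm'
  rw [hm, hm', he]
  have hA2 : {z | ∃ t, z = par x v t} = {z | ∃ t, z = par x v' t} := by rw [← hB, hA]; rfl
  have hs1 := span_le_of hA2
  have hs2 := span_le_of hA2.symm
  have hspan := le_antisymm hs1 hs2
  have hk : k = k' := by
    have e1 := finrank_span_eq_card hv
    have e2 := finrank_span_eq_card hv'
    rw [hspan] at e1
    simpa using e1.symm.trans e2
  subst hk
  choose C hC using fun i => hintg _ (hvΛ' i) (hs2 (Submodule.subset_span ⟨i, rfl⟩))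
  choose D hD using fun i => hintg' _ (hvΛ i) (hs1 (Submodule.subset_span ⟨i, rfl⟩))
  let MC : Matrix (Fin k) (Fin k) ℤ := Matrix.of C
  let MD : Matrix (Fin k) (Fin k) ℤ := Matrix.of D
  have hmul : MC * MD = 1 := by
    ext i j
    have e : parL v' (fun j => ((MC * MD) i j : ℝ)) =
        parL v' (fun j => ((1 : Matrix (Fin k) (Fin k) ℤ) i j : ℝ)) := by
      rw [parL_apply, parL_apply]
      simp only [Matrix.one_apply, Matrix.mul_apply]
      simp only [Int.cast_ite, Int.cast_one, Int.cast_zero, ite_smul, one_smul, zero_smul,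
        Finset.sum_ite_eq, Finset.mem_univ, if_true]
      rw [hC i]
      conv_rhs => enter [2, l]; rw [hD l, Finset.smul_sum]
      rw [Finset.sum_comm]
      refine Finset.sum_congr rfl fun j _ => ?_
      push_cast
      rw [Finset.sum_smul]
      refine Finset.sum_congr rfl fun l _ => ?_
      rw [smul_smul]; rfl
    have := congrFun (parL_inj hv' e) j
    exact_mod_cast this
  have hdet : |((MC.map (Int.cast : ℤ → ℝ))ᵀ).det| = 1 := by
    have h1 : IsUnit MC.det := IsUnit.of_mul_eq_one MD.det (by rw [← Matrix.det_mul, hmul, Matrix.det_one])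
    rw [Matrix.det_transpose]
    have h2 : (MC.map (Int.cast : ℤ → ℝ)).det = (MC.det : ℝ) := by
      have := (Int.castRingHom ℝ).map_det MC
      simpa using this.symm
    rw [h2]
    rcases Int.isUnit_iff.1 h1 with h | h <;> rw [h] <;> simp
  have hcomp : par x v' = par x v ∘ (Matrix.toLin' ((MC.map (Int.cast : ℤ → ℝ))ᵀ)) := by
    ext1 s
    simp only [Function.comp, par_eq, parL_apply]
    congr 1
    conv_lhs => enter [2, j]; rw [hC j, Finset.smul_sum]
    rw [Finset.sum_comm]
    refine Finset.sum_congr rfl fun i _ => ?_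
    simp only [Matrix.toLin'_apply, Matrix.mulVec, dotProduct, Matrix.transpose_apply,
      Matrix.map_apply, Finset.sum_smul, smul_smul]
    refine Finset.sum_congr rfl fun j _ => ?_
    rw [mul_comm]; rfl
  rw [hcomp, ← Measure.map_map (par_cont _ _).measurable
    (LinearMap.continuous_of_finiteDimensional _).measurable,
    Real.map_matrix_volume_pi_eq_smul_volume_pi (by
      intro h0; rw [h0] at hdet; simp at hdet)]
  rw [abs_inv, hdet]
  simp

theorem can_translate {A : Set (Vd d)} {m : Measure (Vd d)} (h : IsCanonicalMeasure Λ A m)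
    (s : Vd d) : IsCanonicalMeasure Λ ((fun x => s + x) '' A) (m.map (fun x => s + x)) := by
  obtain ⟨k, x, v, hxA, hvΛ, hv, hA, hintg, hm⟩ := h
  refine ⟨k, s + x, v, ⟨x, hxA, rfl⟩, hvΛ, hv, ?_, hintg, ?_⟩
  · rw [hA]
    ext z
    constructor
    · rintro ⟨_, ⟨t, rfl⟩, rfl⟩
      exact ⟨t, by simp only [add_assoc]⟩
    · rintro ⟨t, rfl⟩
      exact ⟨_, ⟨t, rfl⟩, by simp only [add_assoc]⟩
  · change m = Measure.map (par x v) volume at hm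
    rw [hm, Measure.map_map (measurable_const_add s) (par_cont x v).measurable]
    congr 1
    ext1 t
    simp only [Function.comp, par, add_assoc]

theorem can_invariant {A : Set (Vd d)} {m : Measure (Vd d)} (h : IsCanonicalMeasure Λ A m)
    {x u : Vd d} (hx : x ∈ A) (hu : u + x ∈ A) : m.map (fun y => u + y) = m := by
  obtain ⟨k, x₀, v, hxA, hvΛ, hv, hA, hintg, hm⟩ := h
  change m = Measure.map (par x₀ v) volume at hm
  have h1 := (can_rebase hA hx).2
  have h2 := (can_rebase hA hu).2
  rw [hm]
  nth_rw 1 [h1]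
  rw [h2, Measure.map_map (measurable_const_add u) (par_cont x v).measurable]
  congr 1
  ext1 t
  simp only [Function.comp, par_eq, add_assoc]

theorem can_top (hΛ : IsFullLattice Λ) :
    ∃ μ : Measure (Vd d), IsCanonicalMeasure Λ univ μ ∧ μ.IsAddHaarMeasure := by
  obtain ⟨b, hb⟩ := lattice_basis hΛ
  have hbm : ∀ i, b i ∈ Λ := fun i => by rw [hb]; exact AddSubgroup.subset_closure ⟨i, rfl⟩
  refine ⟨Measure.map (par 0 b) volume, ⟨d, 0, b, trivial, hbm, b.linearIndependent, ?_, ?_, rfl⟩, ?_⟩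
  · ext x
    simp only [mem_univ, zero_add, true_iff, mem_setOf_eq]
    exact ⟨fun i => b.repr x i, (b.sum_repr x).symm⟩
  · intro y hy _
    rw [hb] at hy
    exact mem_closure_basis hy
  · have : par 0 b = (b.equivFun.symm.toContinuousLinearEquiv : (Fin d → ℝ) ≃L[ℝ] Vd d) := by
      ext1 t
      simp [par, Module.Basis.equivFun_symm_apply]
    rw [this]
    exact ContinuousLinearEquiv.isAddHaarMeasure_map _ _

/-- evaluation on a tuple of vectors -/
noncomputable def evT {k : ℕ} (v : Fin k → Vd d) : Vd d →L[ℝ] (Fin k → ℝ) :=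
  ContinuousLinearMap.pi fun i => evL (v i)

theorem evT_apply {k : ℕ} (v : Fin k → Vd d) (ξ : Vd d) : evT v ξ = fun i => pairE ξ (v i) := by
  ext i; simp [evT, evL_apply]

theorem evT_surj {k : ℕ} {v : Fin k → Vd d} (hv : LinearIndependent ℝ v) :
    Function.Surjective (evT v) := by
  -- adjoint of an injective map
  intro η
  obtain ⟨f, hf⟩ := (LinearMap.exists_leftInverse_of_injective (parL v)
    (LinearMap.ker_eq_bot.2 (parL_inj hv)))
  let ℓ : Vd d →L[ℝ] ℝ := LinearMap.toContinuousLinearMap ((Fintype.linearCombination ℝ η) ∘ₗ f)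
  refine ⟨(InnerProductSpace.toDual ℝ (Vd d)).symm ℓ, ?_⟩
  rw [evT_apply]
  ext i
  simp only [pairE, InnerProductSpace.toDual_symm_apply]
  have : v i = parL v (Pi.single i 1) := by
    rw [parL_apply]; simp [Pi.single_apply]
  have h2 : f (v i) = Pi.single i 1 := by
    rw [this]; exact LinearMap.congr_fun hf _
  simp [ℓ, h2, Fintype.linearCombination_apply, Pi.single_apply]

theorem good_pull {k : ℕ} {v : Fin k → Vd d} (hv : LinearIndependent ℝ v) (x₀ : Vd d)
    {P : Set (Vd d)} {ξ : Vd d} (h : GoodL P (pairE ξ)) :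
    GoodL (par x₀ v ⁻¹' P) (dp (evT v ξ)) := by
  obtain ⟨C, ε, hε, h⟩ := h
  obtain ⟨K, hK, hanti⟩ := LinearMap.exists_antilipschitzWith (parL v)
    (LinearMap.ker_eq_bot.2 (parL_inj hv))
  refine ⟨C + ε * ‖x₀‖ - pairE ξ x₀, ε / K, by positivity, fun t ht => ?_⟩
  have h1 := h _ ht
  rw [pairE_par] at h1
  rw [evT_apply]
  have h2 : ‖t‖ ≤ K * ‖parL v t‖ := by
    have := hanti.le_mul_dist t 0
    simpa using this
  have h3 : ‖parL v t‖ ≤ ‖par x₀ v t‖ + ‖x₀‖ := by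
    rw [par_eq]
    calc ‖parL v t‖ = ‖(x₀ + parL v t) - x₀‖ := by congr 1; abel
      _ ≤ _ := norm_sub_le _ _
  have h4 : ε / K * ‖t‖ ≤ ε * ‖parL v t‖ := by
    have hK' : (0 : ℝ) < K := by exact_mod_cast hK
    rw [div_mul_eq_mul_div, div_le_iff₀ hK']
    nlinarith
  have h5 := mul_le_mul_of_nonneg_left h3 hε.le
  linarith

/-- rational vectors of the dual space -/
def RD (Λ : AddSubgroup (Vd d)) : Set (Vd d) := {w | IsDualIntegral Λ w}

theorem can_rep {A : Set (Vd d)} {m : Measure (Vd d)} (h : IsCanonicalMeasure Λ A m)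
    {s : Vd d} (hs : s ∈ A) (hsr : IsRatPoint Λ s) {P : Set (Vd d)} (hP : IsRP Λ P) :
    NiceF (RD Λ) {ξ | GoodL P (pairE ξ)} (fun ξ => ∫ x in P, Real.exp (pairE ξ x) ∂m) := by
  obtain ⟨k, x₀, v, hxA, hvΛ, hv, hA, hintg, hm⟩ := h
  change m = Measure.map (par x₀ v) volume at hm
  rw [hm, (can_rebase hA hs).2]
  obtain ⟨L', hL'⟩ := pullback hsr hvΛ hP
  have h1 := nice_poly k L'
  have h2 := NiceF.compL (R := RD Λ) (D := {ξ | GoodL P (pairE ξ)}) h1 (evT v)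
    (fun w hw j => by
      rw [evT_apply]; obtain ⟨n, hn⟩ := hw _ (hvΛ j); exact ⟨n, by simpa using hn⟩)
    (evT_surj hv) (fun ξ hξ => by
      have := good_pull hv s hξ
      rw [hL'] at this; exact this)
  have h3 : RatAn (RD Λ) (fun ξ => Real.exp (evL s ξ)) :=
    RatAn.expL _ fun w hw => by rw [evL_apply]; exact pairE_rat hw hsr
  refine (h2.mul_left h3).congr fun ξ hξ => ?_
  rw [(par_emb s hv).setIntegral_map, hL', ← integral_const_mul]
  refine integral_congr_ae (Eventually.of_forall fun t => ?_)
  simp only [pairE_par, Real.exp_add, evL_apply, evT_apply]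

theorem can_integrable {A : Set (Vd d)} {m : Measure (Vd d)} (h : IsCanonicalMeasure Λ A m)
    {P : Set (Vd d)} (hP : MeasurableSet P) {ξ : Vd d} (hξ : GoodL P (pairE ξ)) :
    IntegrableOn (fun x => Real.exp (pairE ξ x)) P m := by
  obtain ⟨k, x₀, v, hxA, hvΛ, hv, hA, hintg, hm⟩ := h
  change m = Measure.map (par x₀ v) volume at hm
  rw [hm, (par_emb x₀ hv).integrableOn_map_iff]
  have h1 := (good_pull hv x₀ hξ).integrableOn volume ((par_cont x₀ v).measurable hP)
    (continuous_dp _)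
  refine (h1.const_mul (Real.exp (pairE ξ x₀))).congr (Eventually.of_forall fun t => ?_)
  simp only [Function.comp, pairE_par, Real.exp_add, evT_apply]

end BVI

open MeasureTheory Filter Topology Set
open scoped RealInnerProductSpace Pointwise BigOperators

namespace BVI
set_option linter.unusedSectionVars false
set_option linter.deprecated false
variable {d : ℕ} {Λ : AddSubgroup (Vd d)}

theorem good_open (P : Set (Vd d)) : IsOpen {ξ | GoodL P (pairE ξ)} := by
  rw [Metric.isOpen_iff]
  rintro ξ ⟨C, ε, hε, h⟩
  refine ⟨ε / 2, by positivity, fun η hη => ⟨C, ε / 2, by positivity, fun x hx => ?_⟩⟩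
  rw [Metric.mem_ball, dist_eq_norm] at hη
  have h1 := h x hx
  have h2 := (le_abs_self _).trans (pairE_abs_le (η - ξ) x)
  rw [pairE_sub_left] at h2
  have h3 := mul_le_mul_of_nonneg_right hη.le (norm_nonneg x)
  linarith

theorem line_dir {P : Set (Vd d)} (hP : IsRP Λ P) (h : ContainsLine P) :
    ∃ u : Vd d, u ≠ 0 ∧ ∀ x ∈ P, ∀ t : ℝ, x + t • u ∈ P := by
  obtain ⟨L, hL, rfl⟩ := hP
  obtain ⟨x, u, hu, h⟩ := h
  have h0 : ∀ p ∈ L, pairE p.1 u = 0 := by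
    intro p hp
    by_contra hne
    have h1 := h (((p.2 : ℝ) - pairE p.1 x + 1) / pairE p.1 u) p hp
    rw [pairE_add_right, pairE_smul_right, div_mul_cancel₀ _ hne] at h1
    linarith
  refine ⟨u, hu, fun y hy t p hp => ?_⟩
  rw [pairE_add_right, pairE_smul_right, h0 p hp, mul_zero, add_zero]
  exact hy p hp

theorem good_nonempty {P : Set (Vd d)} (hP : IsRP Λ P) (h : ¬ ContainsLine P) :
    ∃ ξ, GoodL P (pairE ξ) := by
  rcases P.eq_empty_or_nonempty with rfl | ⟨x, hx⟩
  · exact ⟨0, goodL_empty _⟩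
  obtain ⟨L, hL, rfl⟩ := hP
  let Φ : Vd d →ₗ[ℝ] (Fin L.length → ℝ) :=
    LinearMap.pi fun i => (innerₛₗ ℝ (L.get i).1)
  have hΦ : ∀ y i, Φ y i = pairE (L.get i).1 y := fun y i => rfl
  have hker : LinearMap.ker Φ = ⊥ := by
    rw [LinearMap.ker_eq_bot']
    intro u hu
    by_contra hne
    refine h ⟨x, u, hne, fun t p hp => ?_⟩
    obtain ⟨i, hi⟩ := List.get_of_mem hp
    have : pairE p.1 u = 0 := by rw [← hi, ← hΦ, hu]; rfl
    rw [pairE_add_right, pairE_smul_right, this, mul_zero, add_zero]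
    exact hx p hp
  obtain ⟨K, hK, hanti⟩ := LinearMap.exists_antilipschitzWith Φ hker
  have hK' : (0 : ℝ) < K := by exact_mod_cast hK
  refine ⟨∑ i, (L.get i).1, ∑ i, 2 * |((L.get i).2 : ℝ)|, (K : ℝ)⁻¹, by positivity, fun y hy => ?_⟩
  have h1 : ‖y‖ ≤ K * ‖Φ y‖ := by
    have := hanti.le_mul_dist y 0
    simpa using this
  have h2 : ‖Φ y‖ ≤ ∑ i, |Φ y i| := by
    refine (pi_norm_le_iff_of_nonneg (Finset.sum_nonneg fun i _ => abs_nonneg _)).2 fun i => ?_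
    exact Finset.single_le_sum (f := fun i => |Φ y i|) (fun i _ => abs_nonneg _) (Finset.mem_univ i)
  have h3 : ∑ i, |Φ y i| ≤ ∑ i, (2 * |((L.get i).2 : ℝ)| - pairE (L.get i).1 y) := by
    refine Finset.sum_le_sum fun i _ => ?_
    rw [hΦ]
    have := hy _ (L.get_mem i)
    have h5 := le_abs_self ((L.get i).2 : ℝ)
    have h6 := abs_nonneg ((L.get i).2 : ℝ)
    rw [abs_le]
    constructor <;> linarith
  rw [Finset.sum_sub_distrib] at h3
  rw [pairE_sum_left]
  have h4 : (K : ℝ)⁻¹ * ‖y‖ ≤ ‖Φ y‖ := by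
    rw [inv_mul_le_iff₀ hK']; exact h1
  linarith

theorem not_line_of_good {P : Set (Vd d)} {ξ : Vd d} (h : GoodL P (pairE ξ)) :
    ¬ ContainsLine P := by
  rintro ⟨x, u, hu, hl⟩
  obtain ⟨C, ε, hε, h⟩ := h
  have hun : 0 < ‖u‖ := norm_pos_iff.2 hu
  set t : ℝ := (|C - pairE ξ x| + 1) / (ε * ‖u‖) with ht
  have ht0 : 0 ≤ t := by positivity
  have h1 := h _ (hl t)
  have h2 := h _ (hl (-t))
  have h3 : 2 * (t * ‖u‖) ≤ ‖x + t • u‖ + ‖x + (-t) • u‖ := by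
    have := norm_sub_le (x + t • u) (x + (-t) • u)
    have e : (x + t • u) - (x + (-t) • u) = (2 * t) • u := by
      rw [neg_smul, two_mul, add_smul]; abel
    rw [e, norm_smul, Real.norm_eq_abs, abs_of_nonneg (by positivity)] at this
    linarith
  rw [pairE_add_right, pairE_smul_right] at h1 h2
  have h4 := mul_le_mul_of_nonneg_left h3 hε.le
  have h5 : ε * (t * ‖u‖) = |C - pairE ξ x| + 1 := by
    rw [ht]; field_simp
  have := le_abs_self (C - pairE ξ x)
  linarith

theorem line_zero {P : Set (Vd d)} (hP : MeasurableSet P) {m : Measure (Vd d)} {u : Vd d}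
    (hu : u ≠ 0) (hPu : ∀ x, u + x ∈ P ↔ x ∈ P) (hm : m.map (fun y => u + y) = m) {ξ : Vd d}
    (hξ : 0 ≤ pairE ξ u) (hintg : IntegrableOn (fun x => Real.exp (pairE ξ x)) P m) :
    m P = 0 := by
  let f : Vd d → ℝ := fun y => Real.exp (pairE ξ y) * Real.exp (Real.arctan (pairE u y))
  have hfc : Continuous f := by
    have := continuous_pairE ξ
    have := continuous_pairE u
    have := Real.continuous_arctan
    fun_prop
  have hf : IntegrableOn f P m := by
    refine Integrable.mono' (hintg.mul_const (Real.exp (Real.pi / 2))) hfc.aestronglyMeasurable ?_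
    refine Eventually.of_forall fun x => ?_
    rw [Real.norm_eq_abs, abs_of_pos (by positivity)]
    exact mul_le_mul_of_nonneg_left (Real.exp_le_exp.2 (Real.arctan_lt_pi_div_two _).le)
      (Real.exp_pos _).le
  have hF : Integrable (P.indicator f) m := (integrable_indicator_iff hP).2 hf
  have hmeas : Measurable (fun y : Vd d => u + y) := measurable_const_add u
  have hF2 : Integrable (fun y => P.indicator f (u + y)) m := by
    have : Integrable (P.indicator f) (m.map fun y => u + y) := by rwa [hm]
    exact this.comp_measurable hmeas
  have heq : ∫ y, P.indicator f (u + y) ∂m = ∫ y, P.indicator f y ∂m := by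
    conv_rhs => rw [← hm]
    rw [integral_map hmeas.aemeasurable]
    exact (hfc.measurable.indicator hP).aestronglyMeasurable
  have huu : 0 < pairE u u := by
    have := real_inner_self_pos.2 hu
    exact this
  have hlt : ∀ y ∈ P, 0 < P.indicator f (u + y) - P.indicator f y := by
    intro y hy
    rw [indicator_of_mem ((hPu y).2 hy), indicator_of_mem hy, sub_pos]
    simp only [f, pairE_add_right, ← Real.exp_add]
    refine Real.exp_lt_exp.2 ?_
    have := Real.arctan_strictMono (show pairE u y < pairE u u + pairE u y by linarith)
    linarith
  have hnn : ∀ y, 0 ≤ P.indicator f (u + y) - P.indicator f y := by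
    intro y
    by_cases hy : y ∈ P
    · exact (hlt y hy).le
    · rw [indicator_of_notMem hy, indicator_of_notMem (fun h => hy ((hPu y).1 h)), sub_zero]
  have hz : ∫ y, (P.indicator f (u + y) - P.indicator f y) ∂m = 0 := by
    rw [integral_sub hF2 hF, heq, sub_self]
  rw [integral_eq_zero_iff_of_nonneg hnn (hF2.sub hF)] at hz
  have : ∀ᵐ y ∂m, y ∉ P := by
    filter_upwards [hz] with y hy hyP
    exact (hlt y hyP).ne' hy
  simpa [ae_iff] using this

theorem line_integral_zero {P : Set (Vd d)} (hP : IsRP Λ P) (hl : ContainsLine P)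
    {A : Set (Vd d)} (hPA : P ⊆ A) {m : Measure (Vd d)} (hm : IsCanonicalMeasure Λ A m) {ξ : Vd d}
    (hintg : IntegrableOn (fun x => Real.exp (pairE ξ x)) P m) :
    ∫ x in P, Real.exp (pairE ξ x) ∂m = 0 := by
  obtain ⟨x, u0, hu0, hx⟩ := id hl
  have hxP := hx 0
  obtain ⟨u, hu, hul⟩ := line_dir hP hl
  have key : ∀ u : Vd d, u ≠ 0 → (∀ x ∈ P, ∀ t : ℝ, x + t • u ∈ P) → 0 ≤ pairE ξ u → m P = 0 := by
    intro u hu hul h0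
    have h1 : ∀ x, u + x ∈ P ↔ x ∈ P := by
      intro x
      constructor
      · intro h
        have := hul _ h (-1)
        rwa [show u + x + (-1 : ℝ) • u = x by rw [neg_smul, one_smul]; abel] at this
      · intro h
        have := hul _ h 1
        rwa [one_smul, add_comm] at this
    exact line_zero hP.meas hu h1 (can_invariant hm (hPA hxP) (hPA ((h1 _).2 hxP))) h0 hintg
  have : m P = 0 := by
    rcases le_total 0 (pairE ξ u) with h | h
    · exact key u hu hul h
    · refine key (-u) (neg_ne_zero.2 hu) (fun x hx t => ?_) (by rw [pairE_neg_right]; linarith)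
      have := hul x hx (-t)
      rwa [neg_smul, ← smul_neg] at this
  rw [Measure.restrict_eq_zero.2 this, integral_zero_measure]

theorem rep_integrable {P : Set (Vd d)} (hP : MeasurableSet P) {m : Measure (Vd d)}
    (hgi : ∀ ξ, GoodL P (pairE ξ) → IntegrableOn (fun x => Real.exp (pairE ξ x)) P m)
    {g h : Vd d → ℝ} (hg : AnalyticOnNhd ℝ g univ) (hh : AnalyticOnNhd ℝ h univ)
    (hrep : ∀ ξ, GoodL P (pairE ξ) → h ξ * ∫ x in P, Real.exp (pairE ξ x) ∂m = g ξ)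
    {ξ₀ : Vd d} (hξ₀ : GoodL P (pairE ξ₀)) {ξ : Vd d}
    (hintg : IntegrableOn (fun x => Real.exp (pairE ξ x)) P m) :
    h ξ * ∫ x in P, Real.exp (pairE ξ x) ∂m = g ξ := by
  set η := ξ₀ - ξ with hη
  let c : ℝ → Vd d := fun t => ξ + t • η
  have hcc : Continuous c := by fun_prop
  have hc1 : c 1 = ξ₀ := by simp [c, hη]
  have hc0 : c 0 = ξ := by simp [c]
  have hpc : ∀ t x, pairE (c t) x = pairE ξ x + t * pairE η x := by
    intro t x; simp only [c, pairE_add_left, pairE_smul_left]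
  let ρ : Vd d → ℝ := fun x => Real.exp (pairE ξ x)
  have hρm : Measurable ρ := by
    have := continuous_pairE ξ
    exact (by fun_prop : Continuous ρ).measurable
  let ν : Measure (Vd d) := (m.restrict P).withDensity (fun x => ENNReal.ofReal (ρ x))
  have hρ2 : Measurable (fun x => ENNReal.ofReal (ρ x)) := hρm.ennreal_ofReal
  have hfin : ∀ᵐ x ∂(m.restrict P), ENNReal.ofReal (ρ x) < ⊤ :=
    Eventually.of_forall fun x => ENNReal.ofReal_lt_top
  have hsm : ∀ t x, (ENNReal.ofReal (ρ x)).toReal • Real.exp (t * pairE η x) =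
      Real.exp (pairE (c t) x) := by
    intro t x
    rw [ENNReal.toReal_ofReal (Real.exp_pos _).le, smul_eq_mul, ← Real.exp_add, hpc]
  have hI : ∀ t, Integrable (fun x => Real.exp (t * pairE η x)) ν ↔
      IntegrableOn (fun x => Real.exp (pairE (c t) x)) P m := by
    intro t
    rw [integrable_withDensity_iff_integrable_smul' hρ2 hfin]
    simp only [hsm]; rfl
  have hF : ∀ t, ProbabilityTheory.mgf (pairE η) ν t = ∫ x in P, Real.exp (pairE (c t) x) ∂m := by
    intro t
    rw [ProbabilityTheory.mgf, integral_withDensity_eq_integral_toReal_smul hρ2 hfin]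
    simp only [hsm]
  -- good parameters near 1
  have hopen : IsOpen (c ⁻¹' {ξ | GoodL P (pairE ξ)}) := (good_open P).preimage hcc
  have h1mem : (1 : ℝ) ∈ c ⁻¹' {ξ | GoodL P (pairE ξ)} := by
    change GoodL P (pairE (c 1)); rwa [hc1]
  obtain ⟨δ, hδ, hball⟩ := Metric.isOpen_iff.1 hopen 1 h1mem
  set S := ProbabilityTheory.integrableExpSet (pairE η) ν with hS
  have hSmem : ∀ t, IntegrableOn (fun x => Real.exp (pairE (c t) x)) P m → t ∈ S := by
    intro t ht; exact (hI t).2 ht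
  have h0S : (0 : ℝ) ∈ S := hSmem 0 (by rwa [hc0])
  have h1S : (1 + δ / 2 : ℝ) ∈ S := hSmem _ (hgi _ (hball (by
    rw [Metric.mem_ball, Real.dist_eq]; simp; rw [abs_of_pos (by positivity)]; linarith)))
  have hconv : Convex ℝ S := ProbabilityTheory.convex_integrableExpSet
  have hIcc : Icc 0 (1 + δ / 2) ⊆ S := hconv.ordConnected.out h0S h1S
  have hIoo : Ioo 0 (1 + δ / 2) ⊆ interior S :=
    interior_maximal (Ioo_subset_Icc_self.trans hIcc) isOpen_Ioo
  have hanF : AnalyticOnNhd ℝ (ProbabilityTheory.mgf (pairE η) ν) (Ioo 0 (1 + δ / 2)) :=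
    ProbabilityTheory.analyticOnNhd_mgf.mono hIoo
  have hcan : AnalyticOnNhd ℝ c (Ioo 0 (1 + δ / 2)) := fun t _ => by
    simp only [c]; fun_prop
  have hG1 : AnalyticOnNhd ℝ (fun t => h (c t) * ProbabilityTheory.mgf (pairE η) ν t)
      (Ioo 0 (1 + δ / 2)) := (hh.comp hcan (fun _ _ => trivial)).mul hanF
  have hG2 : AnalyticOnNhd ℝ (fun t => g (c t)) (Ioo 0 (1 + δ / 2)) :=
    hg.comp hcan (fun _ _ => trivial)
  have heqn : (fun t => h (c t) * ProbabilityTheory.mgf (pairE η) ν t) =ᶠ[𝓝 1] fun t => g (c t) := by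
    filter_upwards [hopen.mem_nhds h1mem] with t ht
    rw [hF]; exact hrep _ ht
  have hall := hG1.eqOn_of_preconnected_of_eventuallyEq hG2 isPreconnected_Ioo
    (show (1 : ℝ) ∈ Ioo 0 (1 + δ / 2) by constructor <;> linarith) heqn
  -- limit at 0
  have hlim : Tendsto (fun t => ∫ x in P, Real.exp (pairE (c t) x) ∂m) (𝓝[>] 0)
      (𝓝 (∫ x in P, Real.exp (pairE ξ x) ∂m)) := by
    refine tendsto_integral_filter_of_dominated_convergence
      (fun x => Real.exp (pairE ξ x) + Real.exp (pairE ξ₀ x)) ?_ ?_ ?_ ?_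
    · refine Eventually.of_forall fun t => ?_
      have := continuous_pairE (c t)
      exact (by fun_prop : Continuous fun x => Real.exp (pairE (c t) x)).aestronglyMeasurable
    · have : Ioo (0 : ℝ) 1 ∈ 𝓝[>] (0 : ℝ) := Ioo_mem_nhdsGT one_pos
      filter_upwards [this] with t ht
      refine Eventually.of_forall fun x => ?_
      rw [Real.norm_eq_abs, Real.abs_exp, hpc]
      have e : pairE η x = pairE ξ₀ x - pairE ξ x := by rw [hη, pairE_sub_left]
      rcases le_total (pairE ξ x) (pairE ξ₀ x) with hle | hle
      · have : Real.exp (pairE ξ x + t * pairE η x) ≤ Real.exp (pairE ξ₀ x) := by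
          refine Real.exp_le_exp.2 ?_
          rw [e]; nlinarith [ht.1, ht.2]
        linarith [Real.exp_pos (pairE ξ x)]
      · have : Real.exp (pairE ξ x + t * pairE η x) ≤ Real.exp (pairE ξ x) := by
          refine Real.exp_le_exp.2 ?_
          rw [e]; nlinarith [ht.1, ht.2]
        linarith [Real.exp_pos (pairE ξ₀ x)]
    · exact hintg.add (hgi _ hξ₀)
    · refine Eventually.of_forall fun x => ?_
      have : Continuous fun t => Real.exp (pairE (c t) x) := by
        simp only [hpc]; fun_prop
      have := (this.tendsto 0).mono_left (nhdsWithin_le_nhds (s := Ioi 0))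
      rwa [hc0] at this
  have hlh : Tendsto (fun t => h (c t)) (𝓝[>] 0) (𝓝 (h ξ)) := by
    have := (((an_cont hh).comp hcc).tendsto 0).mono_left (nhdsWithin_le_nhds (s := Ioi 0))
    simpa [Function.comp_def, hc0] using this
  have hlg : Tendsto (fun t => g (c t)) (𝓝[>] 0) (𝓝 (g ξ)) := by
    have := (((an_cont hg).comp hcc).tendsto 0).mono_left (nhdsWithin_le_nhds (s := Ioi 0))
    simpa [Function.comp_def, hc0] using this
  refine tendsto_nhds_unique_of_eventuallyEq (hlh.mul hlim) hlg ?_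
  have : Ioo (0 : ℝ) 1 ∈ 𝓝[>] (0 : ℝ) := Ioo_mem_nhdsGT one_pos
  filter_upwards [this] with t ht
  have := hall (show t ∈ Ioo 0 (1 + δ / 2) from ⟨ht.1, by linarith [ht.2]⟩)
  simpa only [hF] using this

end BVI

open MeasureTheory Filter Topology Set
open scoped RealInnerProductSpace Pointwise BigOperators

namespace BVI
set_option linter.unusedSectionVars false
set_option linter.unusedVariables false
set_option linter.deprecated false
variable {d : ℕ} {Λ : AddSubgroup (Vd d)}

/-- filter of sets with dense interior -/
def gen (d : ℕ) : Filter (Vd d) where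
  sets := {s | Dense (interior s)}
  univ_sets := by simp
  sets_of_superset := fun h hs => h.mono (interior_mono hs)
  inter_sets := fun {s t} hs ht => by
    change Dense (interior (s ∩ t))
    rw [interior_inter]
    exact hs.inter_of_isOpen_left ht isOpen_interior

theorem mem_gen {s : Set (Vd d)} : s ∈ gen d ↔ Dense (interior s) := Iff.rfl

theorem gen_an {h : Vd d → ℝ} (hh : AnalyticOnNhd ℝ h univ) (hne : ∃ ξ, h ξ ≠ 0) :
    ∀ᶠ ξ in gen d, h ξ ≠ 0 := by
  change {ξ | h ξ ≠ 0} ∈ gen d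
  rw [mem_gen, (an_open hh).interior_eq]
  exact an_dense hh hne

theorem meroEq_of_gen {f g : Vd d → ℝ} (h : ∀ᶠ ξ in gen d, f ξ = g ξ) : MeroEqAt0 f g := by
  change {ξ | f ξ = g ξ} ∈ gen d at h
  rw [mem_gen] at h
  refine ⟨(interior {ξ | f ξ = g ξ})ᶜ, isOpen_interior.isClosed_compl, ?_, ?_⟩
  · rw [interior_eq_empty_iff_dense_compl, compl_compl]; exact h
  · refine Eventually.of_forall fun ξ hξ => ?_
    exact (interior_subset (s := {ξ | f ξ = g ξ}) (notMem_compl_iff.1 hξ))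

theorem gen_exists {p : Vd d → Prop} (h : ∀ᶠ ξ in gen d, p ξ) {U : Set (Vd d)} (hU : IsOpen U)
    (hne : U.Nonempty) : ∃ W ⊆ U, IsOpen W ∧ W.Nonempty ∧ ∀ ξ ∈ W, p ξ := by
  change {ξ | p ξ} ∈ gen d at h
  rw [mem_gen] at h
  exact ⟨U ∩ interior {ξ | p ξ}, inter_subset_left, hU.inter isOpen_interior,
    h.inter_open_nonempty U hU hne, fun ξ hξ => interior_subset hξ.2⟩

/-- generically a quotient of entire analytic functions -/
def Mero (F : Vd d → ℝ) : Prop :=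
  ∃ g h : Vd d → ℝ, AnalyticOnNhd ℝ g univ ∧ AnalyticOnNhd ℝ h univ ∧ (∃ ξ, h ξ ≠ 0) ∧
    ∀ᶠ ξ in gen d, h ξ * F ξ = g ξ

theorem Mero.an {g : Vd d → ℝ} (hg : AnalyticOnNhd ℝ g univ) : Mero g :=
  ⟨g, fun _ => 1, hg, analyticOnNhd_const, ⟨0, one_ne_zero⟩, Eventually.of_forall fun ξ => one_mul _⟩

theorem Mero.const (c : ℝ) : Mero (fun _ : Vd d => c) := Mero.an analyticOnNhd_const

theorem Mero.add {F F' : Vd d → ℝ} (hF : Mero F) (hF' : Mero F') : Mero (fun ξ => F ξ + F' ξ) := by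
  obtain ⟨g, h, hg, hh, hne, e⟩ := hF
  obtain ⟨g', h', hg', hh', hne', e'⟩ := hF'
  refine ⟨_, _, (hg.mul hh').add (hg'.mul hh), hh.mul hh', an_mul_ne hh hh' hne hne', ?_⟩
  filter_upwards [e, e'] with ξ h1 h2
  simp only [Pi.add_apply]
  rw [← h1, ← h2]; ring

theorem Mero.mul {F F' : Vd d → ℝ} (hF : Mero F) (hF' : Mero F') : Mero (fun ξ => F ξ * F' ξ) := by
  obtain ⟨g, h, hg, hh, hne, e⟩ := hF
  obtain ⟨g', h', hg', hh', hne', e'⟩ := hF'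
  refine ⟨_, _, hg.mul hg', hh.mul hh', an_mul_ne hh hh' hne hne', ?_⟩
  filter_upwards [e, e'] with ξ h1 h2
  rw [← h1, ← h2]; ring

theorem Mero.sub {F F' : Vd d → ℝ} (hF : Mero F) (hF' : Mero F') : Mero (fun ξ => F ξ - F' ξ) := by
  simpa [sub_eq_add_neg] using hF.add ((Mero.const (-1)).mul hF')

theorem Mero.sum {ι : Type*} (s : Finset ι) {F : ι → Vd d → ℝ} (h : ∀ i, Mero (F i)) :
    Mero (fun ξ => ∑ i ∈ s, F i ξ) := by
  classical
  induction s using Finset.induction_on with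
  | empty => simpa using Mero.const 0
  | insert a s ha ih =>
    simp only [Finset.sum_insert ha]
    exact (h a).add ih

theorem Mero.eq_zero {F : Vd d → ℝ} (hF : Mero F) {U : Set (Vd d)} (hU : IsOpen U)
    (hne : U.Nonempty) (h : ∀ᶠ ξ in gen d, ξ ∈ U → F ξ = 0) : ∀ᶠ ξ in gen d, F ξ = 0 := by
  obtain ⟨g, k, hg, hk, hkne, e⟩ := hF
  obtain ⟨W, hWU, hW, hWne, hWp⟩ := gen_exists (h.and e) hU hne
  have hg0 : ∀ ξ, g ξ = 0 := by
    refine an_eq_of_open hg (analyticOnNhd_const (v := (0 : ℝ))) hW hWne fun ξ hξ => ?_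
    obtain ⟨h1, h2⟩ := hWp ξ hξ
    rw [← h2, h1 (hWU hξ), mul_zero]
  filter_upwards [e, gen_an hk hkne] with ξ h1 h2
  rw [hg0] at h1
  exact (mul_eq_zero.1 h1).resolve_left h2

theorem Mero.eq {F F' : Vd d → ℝ} (hF : Mero F) (hF' : Mero F') {U : Set (Vd d)} (hU : IsOpen U)
    (hne : U.Nonempty) (h : ∀ᶠ ξ in gen d, ξ ∈ U → F ξ = F' ξ) : ∀ᶠ ξ in gen d, F ξ = F' ξ := by
  have := (hF.sub hF').eq_zero hU hne (by
    filter_upwards [h] with ξ h1 h2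
    rw [h1 h2, sub_self])
  filter_upwards [this] with ξ h1 using sub_eq_zero.1 h1

/-- representation of the integral as a quotient of entire functions -/
def Rep (Λ : AddSubgroup (Vd d)) (m : Measure (Vd d)) (P : Set (Vd d)) (g h : Vd d → ℝ) : Prop :=
  RatAn (RD Λ) g ∧ RatAn (RD Λ) h ∧ (∃ ξ, h ξ ≠ 0) ∧
    ∀ ξ, GoodL P (pairE ξ) → h ξ * ∫ x in P, Real.exp (pairE ξ x) ∂m = g ξ

/-- the affine span as a set -/
abbrev spanA (P : Set (Vd d)) : Set (Vd d) :=
  ((affineSpan ℝ P : AffineSubspace ℝ (Vd d)) : Set (Vd d))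

/-- polyhedra for which the integral is not set to zero -/
def Adm (Λ : AddSubgroup (Vd d)) (P : Set (Vd d)) : Prop :=
  ¬ ContainsLine P ∧ ∃ (m : Measure (Vd d)) (g h : Vd d → ℝ),
    IsCanonicalMeasure Λ (spanA P) m ∧ Rep Λ m P g h

open Classical in
/-- the map `I` -/
noncomputable def II (Λ : AddSubgroup (Vd d)) (P : Set (Vd d)) (ξ : Vd d) : ℝ :=
  if H : Adm Λ P then
    if IntegrableOn (fun x => Real.exp (pairE ξ x)) P H.2.choose then
      ∫ x in P, Real.exp (pairE ξ x) ∂H.2.choose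
    else H.2.choose_spec.choose ξ / H.2.choose_spec.choose_spec.choose ξ
  else 0

theorem II_line {P : Set (Vd d)} (h : ContainsLine P) (ξ : Vd d) : II Λ P ξ = 0 := by
  rw [II, dif_neg]
  exact fun H => H.1 h

theorem II_none {P : Set (Vd d)} (h : ¬ ∃ m, IsCanonicalMeasure Λ (spanA P) m) (ξ : Vd d) :
    II Λ P ξ = 0 := by
  rw [II, dif_neg]
  rintro ⟨-, m, g, k, hm, -⟩
  exact h ⟨m, hm⟩

theorem nonempty_of_can {P : Set (Vd d)} {m : Measure (Vd d)}
    (hm : IsCanonicalMeasure Λ (spanA P) m) : P.Nonempty := by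
  obtain ⟨k, x₀, v, hx, -⟩ := hm
  exact (affineSpan_nonempty ℝ).1 ⟨x₀, hx⟩

theorem exists_rep (hΛ : IsFullLattice Λ) {P : Set (Vd d)} (hP : IsRP Λ P) {m : Measure (Vd d)}
    (hm : IsCanonicalMeasure Λ (spanA P) m) : ∃ g h, Rep Λ m P g h := by
  obtain ⟨s, hs, hsr⟩ := hP.ratPoint hΛ (nonempty_of_can hm)
  exact can_rep hm (subset_affineSpan ℝ P hs) hsr hP

theorem II_spec (hΛ : IsFullLattice Λ) {P : Set (Vd d)} (hP : IsRP Λ P) (hl : ¬ ContainsLine P)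
    {m : Measure (Vd d)} (hm : IsCanonicalMeasure Λ (spanA P) m) :
    (∀ ξ, IntegrableOn (fun x => Real.exp (pairE ξ x)) P m →
      II Λ P ξ = ∫ x in P, Real.exp (pairE ξ x) ∂m) ∧
    ∃ g h, Rep Λ m P g h ∧ ∀ ξ, h ξ ≠ 0 → h ξ * II Λ P ξ = g ξ := by
  have H : Adm Λ P := ⟨hl, m, by
    obtain ⟨g, h, hr⟩ := exists_rep hΛ hP hm
    exact ⟨g, h, hm, hr⟩⟩
  have hs := H.2.choose_spec.choose_spec.choose_spec
  have hmm : H.2.choose = m := can_unique hs.1 hm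
  have hrep := hs.2
  have key1 : ∀ ξ, IntegrableOn (fun x => Real.exp (pairE ξ x)) P H.2.choose →
      II Λ P ξ = ∫ x in P, Real.exp (pairE ξ x) ∂H.2.choose := fun ξ hξ => by
    rw [II, dif_pos H, if_pos hξ]
  have key2 : ∀ ξ, ¬ IntegrableOn (fun x => Real.exp (pairE ξ x)) P H.2.choose →
      II Λ P ξ = H.2.choose_spec.choose ξ / H.2.choose_spec.choose_spec.choose ξ := fun ξ hξ => by
    rw [II, dif_pos H, if_neg hξ]
  generalize H.2.choose_spec.choose_spec.choose = h at key2 hrep hs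
  generalize H.2.choose_spec.choose = g at key2 hrep hs
  rw [hmm] at hrep key1 key2
  refine ⟨key1, g, h, hrep, fun ξ hξ => ?_⟩
  by_cases hi : IntegrableOn (fun x => Real.exp (pairE ξ x)) P m
  · rw [key1 ξ hi]
    obtain ⟨ξ₀, hξ₀⟩ := good_nonempty hP hl
    exact rep_integrable hP.meas (fun ξ => can_integrable hm hP.meas) hrep.1.1 hrep.2.1.1
      hrep.2.2.2 hξ₀ hi
  · rw [key2 ξ hi]
    field_simp

theorem ratSeries_of {g : Vd d → ℝ} (hg : RatAn (RD Λ) g) : HasRatSeriesAt0 Λ g := by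
  obtain ⟨_, p, hp, h⟩ := hg
  exact ⟨p, hp, h⟩

theorem ratMero_zero {f : Vd d → ℝ} (hf : ∀ ξ, f ξ = 0) : RatMeromorphicAt0 Λ f := by
  refine ⟨fun _ => 0, fun _ => 1, ratSeries_of (RatAn.const _ IsQ.zero),
    ratSeries_of (RatAn.const _ IsQ.one), ?_, ?_⟩
  · intro h
    exact one_ne_zero h.self_of_nhds
  · exact Eventually.of_forall fun ξ _ => by rw [hf, zero_mul]

theorem II_ratMero (hΛ : IsFullLattice Λ) {P : Set (Vd d)} (hP : IsRP Λ P) :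
    RatMeromorphicAt0 Λ (II Λ P) := by
  by_cases hl : ContainsLine P
  · exact ratMero_zero (II_line hl)
  by_cases hm : ∃ m, IsCanonicalMeasure Λ (spanA P) m
  · obtain ⟨m, hm⟩ := hm
    obtain ⟨-, g, h, hr, h2⟩ := II_spec hΛ hP hl hm
    refine ⟨g, h, ratSeries_of hr.1, ratSeries_of hr.2.1, ?_, ?_⟩
    · intro hev
      obtain ⟨W, hW, hWo, hW0⟩ := eventually_nhds_iff.1 hev
      obtain ⟨ξ, hξ⟩ := hr.2.2.1
      exact hξ (an_eq_of_open hr.2.1.1 (analyticOnNhd_const (v := (0 : ℝ))) hWo ⟨0, hW0⟩ hW ξ)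
    · exact Eventually.of_forall fun ξ hξ => by rw [mul_comm]; exact h2 ξ hξ
  · exact ratMero_zero (II_none hm)

theorem II_integral (hΛ : IsFullLattice Λ) {P : Set (Vd d)} (hP : IsRP Λ P) {m : Measure (Vd d)}
    (hm : IsCanonicalMeasure Λ (spanA P) m) {ξ : Vd d}
    (hξ : IntegrableOn (fun x => Real.exp (pairE ξ x)) P m) :
    II Λ P ξ = ∫ x in P, Real.exp (pairE ξ x) ∂m := by
  by_cases hl : ContainsLine P
  · rw [II_line hl, line_integral_zero hP hl (subset_affineSpan ℝ P) hm hξ]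
  · exact (II_spec hΛ hP hl hm).1 ξ hξ

theorem II_mero (hΛ : IsFullLattice Λ) {P : Set (Vd d)} (hP : IsRP Λ P) : Mero (II Λ P) := by
  have h0 : (∀ ξ, II Λ P ξ = 0) → Mero (II Λ P) := fun h => by
    rw [show II Λ P = fun _ => 0 from funext h]; exact Mero.const 0
  by_cases hl : ContainsLine P
  · exact h0 (II_line hl)
  by_cases hm : ∃ m, IsCanonicalMeasure Λ (spanA P) m
  · obtain ⟨m, hm⟩ := hm
    obtain ⟨-, g, h, hr, h2⟩ := II_spec hΛ hP hl hm
    refine ⟨g, h, hr.1.1, hr.2.1.1, hr.2.2.1, ?_⟩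
    filter_upwards [gen_an hr.2.1.1 hr.2.2.1] with ξ hξ using h2 ξ hξ
  · exact h0 (II_none hm)

theorem good_translate {P : Set (Vd d)} {ξ : Vd d} (h : GoodL P (pairE ξ)) (s : Vd d) :
    GoodL ((fun x => s + x) '' P) (pairE ξ) := by
  obtain ⟨C, ε, hε, h⟩ := h
  refine ⟨C + pairE ξ s + ε * ‖s‖, ε, hε, ?_⟩
  rintro _ ⟨x, hx, rfl⟩
  have h1 := h x hx
  have h2 := mul_le_mul_of_nonneg_left (norm_add_le s x) hε.le
  dsimp only
  rw [pairE_add_right]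
  linarith

theorem integral_translate (P : Set (Vd d)) (m : Measure (Vd d)) (ξ s : Vd d) :
    ∫ x in (fun x => s + x) '' P, Real.exp (pairE ξ x) ∂(m.map fun x => s + x) =
      Real.exp (pairE ξ s) * ∫ x in P, Real.exp (pairE ξ x) ∂m := by
  have he : MeasurableEmbedding (fun x : Vd d => s + x) := measurableEmbedding_addLeft s
  rw [he.setIntegral_map, preimage_image_eq _ (add_right_injective s), ← integral_const_mul]
  simp only [pairE_add_right, Real.exp_add]

theorem line_translate {P : Set (Vd d)} (h : ContainsLine P) (s : Vd d) :
    ContainsLine ((fun x => s + x) '' P) := by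
  obtain ⟨x, u, hu, h⟩ := h
  exact ⟨s + x, u, hu, fun t => ⟨_, h t, by simp only [add_assoc]⟩⟩

theorem translate_neg (P : Set (Vd d)) (s : Vd d) :
    (fun x => -s + x) '' ((fun x => s + x) '' P) = P := by
  rw [image_image]; simp

theorem spanA_translate (P : Set (Vd d)) (s : Vd d) :
    spanA ((fun x => s + x) '' P) = (fun x => s + x) '' spanA P := by
  have h := AffineSubspace.map_span (AffineEquiv.constVAdd ℝ (Vd d) s).toAffineMap P
  have h2 := congrArg (fun A : AffineSubspace ℝ (Vd d) => (A : Set (Vd d))) h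
  simp only [AffineSubspace.coe_map] at h2
  exact h2.symm

theorem II_translate (hΛ : IsFullLattice Λ) {P : Set (Vd d)} (hP : IsRP Λ P) {s : Vd d}
    (hs : IsRatPoint Λ s) :
    ∀ᶠ ξ in gen d, II Λ ((fun x => s + x) '' P) ξ = Real.exp (pairE ξ s) * II Λ P ξ := by
  have hP' := hP.translate hs
  by_cases hl : ContainsLine P
  · refine Eventually.of_forall fun ξ => ?_
    rw [II_line hl, II_line (line_translate hl s), mul_zero]
  have hl' : ¬ ContainsLine ((fun x => s + x) '' P) := fun h => hl (by
    have := line_translate h (-s)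
    rwa [translate_neg] at this)
  by_cases hm : ∃ m, IsCanonicalMeasure Λ (spanA P) m
  · obtain ⟨m, hm⟩ := hm
    have hm' := can_translate hm s
    rw [← spanA_translate] at hm'
    have hexp : Mero (fun ξ : Vd d => Real.exp (pairE ξ s)) := by
      have := (RatAn.expL (R := ∅) (evL s) (by simp)).1
      simp only [evL_apply] at this
      exact Mero.an this
    refine Mero.eq (II_mero hΛ hP') (hexp.mul (II_mero hΛ hP)) (good_open P)
      (good_nonempty hP hl) (Eventually.of_forall fun ξ hξ => ?_)
    rw [II_integral hΛ hP hm (can_integrable hm hP.meas hξ),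
      II_integral hΛ hP' hm' (can_integrable hm' hP'.meas (good_translate hξ s)),
      integral_translate]
  · have hm2 : ¬ ∃ m, IsCanonicalMeasure Λ (spanA ((fun x => s + x) '' P)) m := by
      rintro ⟨m, hm'⟩
      have := can_translate hm' (-s)
      rw [← spanA_translate, translate_neg] at this
      exact hm ⟨_, this⟩
    refine Eventually.of_forall fun ξ => ?_
    rw [II_none hm, II_none hm2, mul_zero]

end BVI

open MeasureTheory Filter Topology Set
open scoped RealInnerProductSpace Pointwise BigOperators

namespace BVI
set_option linter.unusedSectionVars false
set_option linter.unusedVariables false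
set_option linter.deprecated false
variable {d : ℕ} {Λ : AddSubgroup (Vd d)} {μ : Measure (Vd d)}

/-- `F` represents the meromorphic continuation of the solid integral over `P` -/
def VR (μ : Measure (Vd d)) (P : Set (Vd d)) (F : Vd d → ℝ) : Prop :=
  Mero F ∧ (ContainsLine P → ∀ᶠ ξ in gen d, F ξ = 0) ∧
    ∀ᶠ ξ in gen d, GoodL P (pairE ξ) → F ξ = ∫ x in P, Real.exp (pairE ξ x) ∂μ

theorem exists_VR (hμ : IsCanonicalMeasure Λ univ μ) {P : Set (Vd d)} (hP : IsRP Λ P) :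
    ∃ F, VR μ P F := by
  by_cases hl : ContainsLine P
  · exact ⟨fun _ => 0, Mero.const 0, fun _ => Eventually.of_forall fun _ => rfl,
      Eventually.of_forall fun ξ hξ => absurd hl (not_line_of_good hξ)⟩
  obtain ⟨g, h, hg, hh, hne, hr⟩ := can_rep hμ (mem_univ 0) ⟨1, one_ne_zero, by simp⟩ hP
  refine ⟨fun ξ => g ξ / h ξ, ⟨g, h, hg.1, hh.1, hne, ?_⟩, fun h => absurd h hl, ?_⟩
  · filter_upwards [gen_an hh.1 hne] with ξ hξ
    field_simp
  · filter_upwards [gen_an hh.1 hne] with ξ hξ hgood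
    rw [← hr ξ hgood]
    field_simp

theorem VR.zero_of_dir {P : Set (Vd d)} {F : Vd d → ℝ} (h : VR μ P F) {u : Vd d} (hu : u ≠ 0)
    (hdir : ∀ x ∈ P, ∀ t : ℝ, x + t • u ∈ P) : ∀ᶠ ξ in gen d, F ξ = 0 := by
  rcases P.eq_empty_or_nonempty with rfl | ⟨x, hx⟩
  · filter_upwards [h.2.2] with ξ hξ
    rw [hξ (goodL_empty _)]; simp
  · exact h.2.1 ⟨x, u, hu, hdir x hx⟩

theorem line_dir' {P : Set (Vd d)} (hP : IsRP Λ P) {x u : Vd d} (h : ∀ t : ℝ, x + t • u ∈ P) :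
    ∀ y ∈ P, ∀ t : ℝ, y + t • u ∈ P := by
  obtain ⟨L, hL, rfl⟩ := hP
  have h0 : ∀ p ∈ L, pairE p.1 u = 0 := by
    intro p hp
    by_contra hne
    have h1 := h (((p.2 : ℝ) - pairE p.1 x + 1) / pairE p.1 u) p hp
    rw [pairE_add_right, pairE_smul_right, div_mul_cancel₀ _ hne] at h1
    linarith
  intro y hy t p hp
  rw [pairE_add_right, pairE_smul_right, h0 p hp, mul_zero, add_zero]
  exact hy p hp

/-- the affine hyperplane -/
def hyp (φ : Vd d) (c : ℝ) : AffineSubspace ℝ (Vd d) where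
  carrier := {x | pairE φ x = c}
  smul_vsub_vadd_mem' := by
    intro t p q r hp hq hr
    simp only [mem_setOf_eq] at *
    rw [vsub_eq_sub, vadd_eq_add, pairE_add_right, pairE_smul_right, pairE_sub_right, hp, hq, hr]
    ring

theorem hyp_null [μ.IsAddHaarMeasure] {φ : Vd d} (hφ : φ ≠ 0) (c : ℝ) :
    μ {x | pairE φ x = c} = 0 := by
  refine Measure.addHaar_affineSubspace μ (hyp φ c) fun h => ?_
  have h0 : (0 : Vd d) ∈ hyp φ c := by rw [h]; trivial
  have h1 : φ ∈ hyp φ c := by rw [h]; trivial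
  change pairE φ 0 = c at h0
  change pairE φ φ = c at h1
  rw [pairE_zero_right] at h0
  rw [← h0] at h1
  exact hφ (inner_self_eq_zero.1 h1)

theorem integral_split [μ.IsAddHaarMeasure] {φ : Vd d} (hφ : φ ≠ 0) {c : ℝ} {A B C : Set (Vd d)}
    (hA : A = B ∪ C) (hB : MeasurableSet B) (hC : MeasurableSet C)
    (h : ∀ x, x ∈ B → x ∈ C → pairE φ x = c) {f : Vd d → ℝ} (hf : IntegrableOn f A μ) :
    ∫ x in A, f x ∂μ = ∫ x in B, f x ∂μ + ∫ x in C, f x ∂μ := by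
  subst hA
  refine setIntegral_union₀ ?_ hC.nullMeasurableSet (hf.mono_set subset_union_left)
    (hf.mono_set subset_union_right)
  exact measure_mono_null (fun x hx => h x hx.1 hx.2) (hyp_null hφ c)

theorem IsRP.nonneg {φ : Vd d} (h : IsDualIntegral Λ φ) : IsRP Λ {x | 0 ≤ pairE φ x} := by
  simpa using IsRP.ge h 0
theorem IsRP.nonpos {φ : Vd d} (h : IsDualIntegral Λ φ) : IsRP Λ {x | pairE φ x ≤ 0} := by
  simpa using IsRP.le h 0
theorem IsRP.le_one {φ : Vd d} (h : IsDualIntegral Λ φ) : IsRP Λ {x | pairE φ x ≤ 1} := by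
  simpa using IsRP.le h 1

theorem mero_exp (s : Vd d) : AnalyticOnNhd ℝ (fun ξ : Vd d => Real.exp (pairE ξ s)) univ := by
  have := (RatAn.expL (R := ∅) (evL s) (by simp)).1
  simpa only [evL_apply] using this

theorem dir_zero {φ x u : Vd d} {c : ℝ} (h : ∀ t : ℝ, c ≤ pairE φ (x + t • u)) :
    pairE φ u = 0 := by
  by_contra hne
  have h1 := h ((c - pairE φ x - 1) / pairE φ u)
  rw [pairE_add_right, pairE_smul_right, div_mul_cancel₀ _ hne] at h1
  linarith

theorem VR.split (hμ : IsCanonicalMeasure Λ univ μ) [μ.IsAddHaarMeasure] {φ : Vd d} (hφ : φ ≠ 0)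
    (hφΛ : IsDualIntegral Λ φ) {P : Set (Vd d)} (hP : IsRP Λ P) {F Fp Fm : Vd d → ℝ}
    (h : VR μ P F) (hp : VR μ (P ∩ {x | 0 ≤ pairE φ x}) Fp)
    (hm : VR μ (P ∩ {x | pairE φ x ≤ 0}) Fm) : ∀ᶠ ξ in gen d, F ξ = Fp ξ + Fm ξ := by
  have hPp : IsRP Λ (P ∩ {x | 0 ≤ pairE φ x}) := hP.inter (IsRP.nonneg hφΛ)
  have hPm : IsRP Λ (P ∩ {x | pairE φ x ≤ 0}) := hP.inter (IsRP.nonpos hφΛ)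
  by_cases hdir : ∃ u : Vd d, u ≠ 0 ∧ pairE φ u = 0 ∧ ∀ x ∈ P, ∀ t : ℝ, x + t • u ∈ P
  · obtain ⟨u, hu, hu0, hd⟩ := hdir
    have e : ∀ (x : Vd d) (t : ℝ), pairE φ (x + t • u) = pairE φ x := fun x t => by
      rw [pairE_add_right, pairE_smul_right, hu0, mul_zero, add_zero]
    filter_upwards [h.zero_of_dir hu hd,
      hp.zero_of_dir hu (fun x hx t => ⟨hd x hx.1 t, by simpa only [mem_setOf_eq, e] using hx.2⟩),
      hm.zero_of_dir hu (fun x hx t => ⟨hd x hx.1 t, by simpa only [mem_setOf_eq, e] using hx.2⟩)]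
      with ξ h1 h2 h3
    rw [h1, h2, h3, add_zero]
  by_cases hl : ContainsLine P
  · -- the slab argument
    obtain ⟨u₀, hu₀, hd₀⟩ := line_dir hP hl
    have hne : pairE φ u₀ ≠ 0 := fun h0 => hdir ⟨u₀, hu₀, h0, hd₀⟩
    obtain ⟨u, hu1, hd⟩ : ∃ u : Vd d, pairE φ u = 1 ∧ ∀ x ∈ P, ∀ t : ℝ, x + t • u ∈ P := by
      refine ⟨(pairE φ u₀)⁻¹ • u₀, ?_, fun x hx t => ?_⟩
      · rw [pairE_smul_right, inv_mul_cancel₀ hne]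
      · rw [smul_smul]; exact hd₀ x hx _
    have hu : u ≠ 0 := by rintro rfl; rw [pairE_zero_right] at hu1; exact zero_ne_one hu1
    have hdu : ∀ x ∈ P, u + x ∈ P := fun x hx => by
      have := hd x hx 1; rwa [one_smul, add_comm] at this
    have hdu' : ∀ x ∈ P, -u + x ∈ P := fun x hx => by
      have := hd x hx (-1); rwa [neg_one_smul, add_comm] at this
    have hlp : ¬ ContainsLine (P ∩ {x | 0 ≤ pairE φ x}) := by
      rintro ⟨x, w, hw, hx⟩
      exact hdir ⟨w, hw, dir_zero fun t => (hx t).2, line_dir' hP fun t => (hx t).1⟩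
    have hlm : ¬ ContainsLine (P ∩ {x | pairE φ x ≤ 0}) := by
      rintro ⟨x, w, hw, hx⟩
      refine hdir ⟨w, hw, ?_, line_dir' hP fun t => (hx t).1⟩
      have : pairE (-φ) w = 0 := dir_zero (c := 0) (x := x) fun t => by
        rw [pairE_neg_left]; have := (hx t).2; simp only [mem_setOf_eq] at this; linarith
      rwa [pairE_neg_left, neg_eq_zero] at this
    set S : Set (Vd d) := (P ∩ {x | 0 ≤ pairE φ x}) ∩ {x | pairE φ x ≤ 1} with hSdef
    have hS : IsRP Λ S := hPp.inter (IsRP.le_one hφΛ)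
    obtain ⟨FS, hFS⟩ := exists_VR hμ hS
    have hinv : μ.map (fun x => u + x) = μ := map_add_left_eq_self μ u
    have htm : ∀ {A : Set (Vd d)}, IsRP Λ A → MeasurableSet ((fun x => u + x) '' A) := fun hA =>
      (measurableEmbedding_addLeft u).measurableSet_image' hA.meas
    have hti : ∀ (A : Set (Vd d)) (ξ : Vd d), ∫ x in (fun x => u + x) '' A, Real.exp (pairE ξ x) ∂μ =
        Real.exp (pairE ξ u) * ∫ x in A, Real.exp (pairE ξ x) ∂μ := fun A ξ => by
      have := integral_translate A μ ξ u
      rwa [hinv] at this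
    have hmem : ∀ (A : Set (Vd d)) (x : Vd d), x ∈ (fun x => u + x) '' A ↔ -u + x ∈ A := by
      intro A x
      simp only [image_add_left, mem_preimage]
    have hφm : ∀ x, pairE φ (-u + x) = pairE φ x - 1 := fun x => by
      rw [pairE_add_right, pairE_neg_right, hu1]; ring
    have hPm_iff : ∀ x, -u + x ∈ P ↔ x ∈ P := fun x => by
      refine ⟨fun hx => ?_, hdu' x⟩
      have := hdu _ hx
      rwa [add_neg_cancel_left] at this
    have e1 : P ∩ {x | 0 ≤ pairE φ x} = S ∪ (fun x => u + x) '' (P ∩ {x | 0 ≤ pairE φ x}) := by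
      ext x
      simp only [mem_union, hmem, hSdef, mem_inter_iff, mem_setOf_eq, hφm, hPm_iff]
      constructor
      · rintro ⟨h1, h2⟩
        rcases le_total (pairE φ x) 1 with h3 | h3
        · exact Or.inl ⟨⟨h1, h2⟩, h3⟩
        · exact Or.inr ⟨h1, by linarith⟩
      · rintro (⟨h1, h2⟩ | ⟨h1, h2⟩)
        · exact h1
        · exact ⟨h1, by linarith⟩
    have e2 : (fun x => u + x) '' (P ∩ {x | pairE φ x ≤ 0}) = S ∪ (P ∩ {x | pairE φ x ≤ 0}) := by
      ext x
      simp only [mem_union, hmem, hSdef, mem_inter_iff, mem_setOf_eq, hφm, hPm_iff]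
      constructor
      · rintro ⟨h1, h2⟩
        rcases le_total (pairE φ x) 0 with h3 | h3
        · exact Or.inr ⟨h1, h3⟩
        · exact Or.inl ⟨⟨h1, h3⟩, by linarith⟩
      · rintro (⟨h1, h2⟩ | ⟨h1, h2⟩)
        · exact ⟨h1.1, by linarith⟩
        · exact ⟨h1, by linarith⟩
    have hexp := mero_exp u
    have hE : Mero (fun ξ : Vd d => Real.exp (pairE ξ u)) := Mero.an hexp
    have k1 : ∀ᶠ ξ in gen d, Fp ξ = FS ξ + Real.exp (pairE ξ u) * Fp ξ := by
      refine Mero.eq hp.1 (hFS.1.add (hE.mul hp.1)) (good_open _) (good_nonempty hPp hlp) ?_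
      filter_upwards [hp.2.2, hFS.2.2] with ξ h1 h2 (hξ : GoodL _ _)
      rw [h1 hξ, h2 (hξ.mono inter_subset_left), ← hti]
      refine integral_split hφ (c := 1) e1 hS.meas (htm hPp) ?_ (can_integrable hμ hPp.meas hξ)
      intro x hx hx'
      rw [hmem] at hx'
      have h3 := hx'.2
      have h4 := hx.2
      simp only [mem_setOf_eq, hφm] at h3 h4
      linarith
    have k2 : ∀ᶠ ξ in gen d, Real.exp (pairE ξ u) * Fm ξ = FS ξ + Fm ξ := by
      refine Mero.eq (hE.mul hm.1) (hFS.1.add hm.1) (good_open _) (good_nonempty hPm hlm) ?_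
      filter_upwards [hm.2.2, hFS.2.2] with ξ h1 h2 (hξ : GoodL _ _)
      have hξ' := good_translate hξ u
      rw [h1 hξ, h2 (hξ'.mono (by rw [e2]; exact subset_union_left)), ← hti]
      refine integral_split hφ (c := 0) e2 hS.meas hPm.meas ?_
        (can_integrable hμ (htm hPm) hξ')
      intro x hx hx'
      have h3 := hx'.2
      have h4 := hx.1.2
      simp only [mem_setOf_eq] at h3 h4
      linarith
    have k3 : ∀ᶠ ξ in gen d, 1 - Real.exp (pairE ξ u) ≠ 0 := by
      refine gen_an (analyticOnNhd_const.sub hexp) ⟨u, ?_⟩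
      have : 0 < pairE u u := real_inner_self_pos.2 hu
      have h5 := Real.one_lt_exp_iff.2 this
      exact (sub_neg.2 h5).ne
    filter_upwards [h.2.1 hl, k1, k2, k3] with ξ h1 h2 h3 h4
    have : (1 - Real.exp (pairE ξ u)) * (Fp ξ + Fm ξ) = 0 := by linarith
    rw [h1, (mul_eq_zero.1 this).resolve_left h4]
  · refine Mero.eq h.1 (hp.1.add hm.1) (good_open P) (good_nonempty hP hl) ?_
    filter_upwards [h.2.2, hp.2.2, hm.2.2] with ξ h1 h2 h3 (hξ : GoodL _ _)
    rw [h1 hξ, h2 (hξ.mono inter_subset_left), h3 (hξ.mono inter_subset_left)]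
    refine integral_split hφ (c := 0) ?_ hPp.meas hPm.meas ?_ (can_integrable hμ hP.meas hξ)
    · ext x
      simp only [mem_union, mem_inter_iff, mem_setOf_eq, ← and_or_left]
      exact ⟨fun hx => ⟨hx, le_total _ _⟩, fun hx => hx.1⟩
    · intro x hx hx'
      exact le_antisymm hx'.2 hx.2

/-- the valuation property for polyhedra inside `Q` -/
def Val (Λ : AddSubgroup (Vd d)) (μ : Measure (Vd d)) (Q : Set (Vd d)) : Prop :=
  ∀ (n : ℕ) (P : Fin n → Set (Vd d)) (F : Fin n → Vd d → ℝ) (r : Fin n → ℝ),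
    (∀ i, IsRP Λ (P i)) → (∀ i, P i ⊆ Q) → (∀ i, VR μ (P i) (F i)) →
    (∀ x, ∑ i, indicator (P i) (fun _ => r i) x = 0) →
    ∀ᶠ ξ in gen d, ∑ i, r i * F i ξ = 0

theorem Val.mono {Q Q' : Set (Vd d)} (h : Val Λ μ Q) (hQ : Q' ⊆ Q) : Val Λ μ Q' :=
  fun n P F r h1 h2 h3 h4 => h n P F r h1 (fun i => (h2 i).trans hQ) h3 h4

theorem val_good (hμ : IsCanonicalMeasure Λ univ μ) {Q : Set (Vd d)} {ξ₀ : Vd d}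
    (hQ : GoodL Q (pairE ξ₀)) : Val Λ μ Q := by
  intro n P F r h1 h2 h3 h4
  refine Mero.eq_zero (Mero.sum Finset.univ fun i => (Mero.const (r i)).mul (h3 i).1)
    (good_open Q) ⟨ξ₀, hQ⟩ ?_
  have := Filter.eventually_all.2 fun i => (h3 i).2.2
  filter_upwards [this] with ξ h5 (hξ : GoodL _ _)
  have e : ∀ i, r i * F i ξ =
      ∫ x, indicator (P i) (fun _ => r i) x * Real.exp (pairE ξ x) ∂μ := by
    intro i
    rw [h5 i (hξ.mono (h2 i)), ← integral_const_mul, ← integral_indicator (h1 i).meas]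
    congr 1
    ext x
    by_cases hx : x ∈ P i <;> simp [hx]
  have hintg : ∀ i, Integrable
      (fun x => indicator (P i) (fun _ => r i) x * Real.exp (pairE ξ x)) μ := by
    intro i
    have := (can_integrable hμ (h1 i).meas (hξ.mono (h2 i))).const_mul (r i)
    have := (integrable_indicator_iff (h1 i).meas).2 this
    refine this.congr (Eventually.of_forall fun x => ?_)
    by_cases hx : x ∈ P i <;> simp [hx]
  simp only [e]
  rw [← integral_finset_sum _ fun i _ => hintg i]
  simp only [← Finset.sum_mul, h4, zero_mul, integral_zero]

theorem val_split (hμ : IsCanonicalMeasure Λ univ μ) [μ.IsAddHaarMeasure] {φ : Vd d} (hφ : φ ≠ 0)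
    (hφΛ : IsDualIntegral Λ φ) {Q : Set (Vd d)} (hp : Val Λ μ (Q ∩ {x | 0 ≤ pairE φ x}))
    (hm : Val Λ μ (Q ∩ {x | pairE φ x ≤ 0})) : Val Λ μ Q := by
  intro n P F r h1 h2 h3 h4
  have hPp : ∀ i, IsRP Λ (P i ∩ {x | 0 ≤ pairE φ x}) := fun i => (h1 i).inter (IsRP.nonneg hφΛ)
  have hPm : ∀ i, IsRP Λ (P i ∩ {x | pairE φ x ≤ 0}) := fun i => (h1 i).inter (IsRP.nonpos hφΛ)
  choose Fp hFp using fun i => exists_VR hμ (hPp i)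
  choose Fm hFm using fun i => exists_VR hμ (hPm i)
  have hind : ∀ (H : Set (Vd d)) (x : Vd d),
      ∑ i, indicator (P i ∩ H) (fun _ => r i) x = 0 := by
    intro H x
    by_cases hx : x ∈ H
    · rw [← h4 x]
      refine Finset.sum_congr rfl fun i _ => ?_
      by_cases hx2 : x ∈ P i <;> simp [hx, hx2]
    · refine Finset.sum_eq_zero fun i _ => ?_
      simp [hx]
  have k1 := hp n _ Fp r hPp (fun i => inter_subset_inter_left _ (h2 i)) hFp (hind _)
  have k2 := hm n _ Fm r hPm (fun i => inter_subset_inter_left _ (h2 i)) hFm (hind _)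
  have k3 := Filter.eventually_all.2 fun i => (h3 i).split hμ hφ hφΛ (h1 i) (hFp i) (hFm i)
  filter_upwards [k1, k2, k3] with ξ e1 e2 e3
  simp only [e3, mul_add, Finset.sum_add_distrib, e1, e2, add_zero]

theorem val_univ (hΛ : IsFullLattice Λ) (hμ : IsCanonicalMeasure Λ univ μ) [μ.IsAddHaarMeasure] :
    Val Λ μ univ := by
  classical
  obtain ⟨b, hb⟩ := lattice_basis hΛ
  have hdual : ∀ j, ∃ φ : Vd d, ∀ i, pairE φ (b i) = if i = j then 1 else 0 := by
    intro j
    obtain ⟨φ, hφ⟩ := evT_surj b.linearIndependent (fun i => if i = j then 1 else 0)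
    rw [evT_apply] at hφ
    exact ⟨φ, fun i => congrFun hφ i⟩
  choose l hl using hdual
  have hl0 : ∀ j, l j ≠ 0 := fun j h0 => by
    have := hl j j
    rw [h0, pairE_zero_left, if_pos rfl] at this
    exact zero_ne_one this
  have hexpand : ∀ (c : Fin d → ℝ) j, pairE (l j) (∑ i, c i • b i) = c j := by
    intro c j
    simp [pairE_sum_right, pairE_smul_right, hl]
  have hlΛ : ∀ j, IsDualIntegral Λ (l j) := by
    intro j x hx
    rw [hb] at hx
    obtain ⟨c, rfl⟩ := mem_closure_basis hx
    exact ⟨c j, hexpand _ j⟩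
  have hrep : ∀ x : Vd d, x = ∑ i, pairE (l i) x • b i := by
    intro x
    have h1 := b.sum_repr x
    have h2 : ∀ j, pairE (l j) x = b.repr x j := fun j => by
      conv_lhs => rw [← h1]
      exact hexpand (fun i => b.repr x i) j
    simp only [h2]
    exact h1.symm
  have main : ∀ (t : Finset (Fin d)) (φ : Fin d → Vd d), (∀ j, φ j = l j ∨ φ j = - l j) →
      Val Λ μ {x | ∀ j, j ∉ t → 0 ≤ pairE (φ j) x} := by
    intro t
    induction t using Finset.induction_on with
    | empty =>
      intro φ hφ
      have habs : ∀ j x, 0 ≤ pairE (φ j) x → pairE (φ j) x = |pairE (l j) x| := by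
        intro j x hx
        rcases hφ j with h | h
        · rw [h] at hx ⊢; rw [abs_of_nonneg hx]
        · rw [h, pairE_neg_left] at hx ⊢
          rw [abs_of_nonpos (by linarith)]
      refine val_good hμ (ξ₀ := -∑ j, φ j) ⟨0, (∑ j, ‖b j‖ + 1)⁻¹, by positivity, fun x hx => ?_⟩
      have h1 : pairE (-∑ j, φ j) x = - ∑ j, |pairE (l j) x| := by
        rw [pairE_neg_left, pairE_sum_left]
        congr 1
        exact Finset.sum_congr rfl fun j _ => habs j x (hx j (Finset.notMem_empty j))
      have h2 : ‖x‖ ≤ (∑ j, |pairE (l j) x|) * (∑ j, ‖b j‖ + 1) := by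
        conv_lhs => rw [hrep x]
        refine (norm_sum_le _ _).trans ?_
        rw [Finset.sum_mul]
        refine Finset.sum_le_sum fun j _ => ?_
        rw [norm_smul, Real.norm_eq_abs]
        refine mul_le_mul_of_nonneg_left ?_ (abs_nonneg _)
        have := Finset.single_le_sum (f := fun j => ‖b j‖) (fun i _ => norm_nonneg _)
          (Finset.mem_univ j)
        linarith
      have h3 : (∑ j, ‖b j‖ + 1)⁻¹ * ‖x‖ ≤ ∑ j, |pairE (l j) x| := by
        rw [inv_mul_le_iff₀ (by positivity), mul_comm]; exact h2
      rw [h1]; linarith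
    | insert a t ha ih =>
      intro φ hφ
      have hup : ∀ ψ, (ψ = l a ∨ ψ = - l a) →
          ∀ j, Function.update φ a ψ j = l j ∨ Function.update φ a ψ j = - l j := by
        intro ψ hψ j
        by_cases hj : j = a
        · subst hj; simpa using hψ
        · simpa [Function.update_of_ne hj] using hφ j
      refine val_split hμ (hl0 a) (hlΛ a) ((ih _ (hup (l a) (Or.inl rfl))).mono ?_)
        ((ih _ (hup (- l a) (Or.inr rfl))).mono ?_)
      · rintro x ⟨hx1, hx2⟩ j hj
        by_cases hja : j = a
        · subst hja; simpa using hx2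
        · rw [Function.update_of_ne hja]
          exact hx1 j (by simp [hja, hj])
      · rintro x ⟨hx1, hx2⟩ j hj
        by_cases hja : j = a
        · subst hja
          simpa [pairE_neg_left] using hx2
        · rw [Function.update_of_ne hja]
          exact hx1 j (by simp [hja, hj])
  have := main Finset.univ l fun j => Or.inl rfl
  exact this.mono fun x _ j hj => absurd (Finset.mem_univ j) hj

theorem II_valuation (hΛ : IsFullLattice Λ) (n : ℕ) (P : Fin n → Set (Vd d)) (r : Fin n → ℝ)
    (hP : ∀ i, IsRP Λ (P i)) (hsum : ∀ x, ∑ i, indicator (P i) (fun _ => r i) x = 0) :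
    ∀ᶠ ξ in gen d,
      ∑ᶠ i ∈ {i : Fin n | (affineSpan ℝ (P i) : AffineSubspace ℝ (Vd d)) = ⊤},
        r i * II Λ (P i) ξ = 0 := by
  classical
  obtain ⟨μ, hμ, hhaar⟩ := can_top hΛ
  have hV := val_univ hΛ hμ n P
    (fun i ξ => if (affineSpan ℝ (P i) : AffineSubspace ℝ (Vd d)) = ⊤ then II Λ (P i) ξ else 0) r
    hP (fun i => subset_univ _) (fun i => ?_) hsum
  · filter_upwards [hV] with ξ hξ
    rw [← hξ, finsum_eq_sum_of_fintype]
    refine Finset.sum_congr rfl fun i _ => ?_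
    rw [finsum_eq_if, mul_ite, mul_zero]
  · by_cases ht : (affineSpan ℝ (P i) : AffineSubspace ℝ (Vd d)) = ⊤
    · simp only [ht, if_true]
      refine ⟨II_mero hΛ (hP i), fun h => Eventually.of_forall (II_line h), ?_⟩
      refine Eventually.of_forall fun ξ hξ => ?_
      refine II_integral hΛ (hP i) ?_ (can_integrable hμ (hP i).meas hξ)
      rw [spanA, ht]; exact hμ
    · simp only [ht, if_false]
      refine ⟨Mero.const 0, fun h => Eventually.of_forall fun _ => rfl, ?_⟩
      refine Eventually.of_forall fun ξ hξ => ?_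
      have h0 : μ (P i) = 0 := measure_mono_null (subset_affineSpan ℝ (P i))
        (Measure.addHaar_affineSubspace μ _ ht)
      rw [setIntegral_measure_zero _ h0]

end BVI


/-- existence of the map `I` assigning to every rational polyhedron a
meromorphic function with rational coefficients, vanishing on polyhedra with lines, given by
`∫_P e^{⟨ξ,x⟩} dm_{<P>}` where integrable, covariant under rational translations, and a solid
valuation. -/
theorem statement0 (d : ℕ) (Λ : AddSubgroup (Vd d)) (hΛ : IsFullLattice Λ) :
    ∃ I : Set (Vd d) → Vd d → ℝ,
      (∀ P, IsRatPolyhedron Λ P → RatMeromorphicAt0 Λ (I P)) ∧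
      (∀ P, IsRatPolyhedron Λ P → ContainsLine P → ∀ ξ, I P ξ = 0) ∧
      (∀ P, IsRatPolyhedron Λ P → ∀ m : MeasureTheory.Measure (Vd d),
        IsCanonicalMeasure Λ ((affineSpan ℝ P : AffineSubspace ℝ (Vd d)) : Set (Vd d)) m →
        ∀ ξ : Vd d, MeasureTheory.IntegrableOn (fun x => Real.exp (pairE ξ x)) P m →
          I P ξ = ∫ x in P, Real.exp (pairE ξ x) ∂m) ∧
      (∀ P, IsRatPolyhedron Λ P → ∀ s : Vd d, IsRatPoint Λ s →
        MeroEqAt0 (I ((fun x => s + x) '' P)) (fun ξ => Real.exp (pairE ξ s) * I P ξ)) ∧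
      (∀ (n : ℕ) (P : Fin n → Set (Vd d)) (r : Fin n → ℝ),
        (∀ i, IsRatPolyhedron Λ (P i)) →
        (∀ x : Vd d, ∑ i, Set.indicator (P i) (fun _ => r i) x = 0) →
        MeroEqAt0
          (fun ξ => ∑ᶠ i ∈ {i : Fin n | (affineSpan ℝ (P i) : AffineSubspace ℝ (Vd d)) = ⊤},
            r i * I (P i) ξ)
          (fun _ => 0)) := by
  exact ⟨BVI.II Λ, fun P hP => BVI.II_ratMero hΛ (BVI.IsRP.of hΛ hP),
    fun P _ h ξ => BVI.II_line h ξ,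
    fun P hP m hm ξ hξ => BVI.II_integral hΛ (BVI.IsRP.of hΛ hP) hm hξ,
    fun P hP s hs => BVI.meroEq_of_gen (BVI.II_translate hΛ (BVI.IsRP.of hΛ hP) hs),
    fun n P r hP hsum => BVI.meroEq_of_gen
      (BVI.II_valuation hΛ n P r (fun i => BVI.IsRP.of hΛ (hP i)) hsum)⟩
end

section
/- Let c ⊂ V be a simplicial cone generated by k ≤ d linearly independent rational vectors v_1,…,v_k. Then the meromorphic function I(c) is the rational function I(c)(ξ) = (−1)^k · vol(□(v_1,…,v_k)) / ∏_{i=1}^k ⟨ξ, v_i⟩, where □(v_1,…,v_k) = Σ_{i=1}^k [0,1[ v_i is the semi-open parallelepiped and vol denotes its relative volume with respect to the canonical lattice measure on the subspace spanned by v_1,…,v_k. -/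
open MeasureTheory Filter Topology Set
open scoped RealInnerProductSpace Pointwise BigOperators

/-- integrality of the inverse change of basis up to a common denominator. -/
theorem aux_inv_int {n : ℕ} {E : Type*} [AddCommGroup E] [Module ℝ E]
    (b w : Module.Basis (Fin n) ℝ E) (h : ∀ j i, ∃ z : ℤ, b.repr (w j) i = z) :
    ∃ N : ℤ, N ≠ 0 ∧ ∀ i j, ∃ z : ℤ, (N : ℝ) * w.repr (b j) i = z := by
  choose M hM using h
  let M' : Matrix (Fin n) (Fin n) ℤ := fun i j => M j i
  have hA : b.toMatrix w = M'.map (Int.castRingHom ℝ) := by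
    ext i j
    rw [Module.Basis.toMatrix_apply, hM]; rfl
  have h1 : b.toMatrix w * w.toMatrix b = 1 := b.toMatrix_mul_toMatrix_flip w
  have hdet : (b.toMatrix w).det = ((M'.det : ℤ) : ℝ) := by
    rw [hA]
    have := (RingHom.map_det (Int.castRingHom ℝ) M').symm
    simpa using this
  have hadj : (M'.det : ℝ) • w.toMatrix b = M'.adjugate.map (Int.castRingHom ℝ) := by
    have h2 := Matrix.adjugate_mul (b.toMatrix w)
    have h3 := congrArg (· * w.toMatrix b) h2
    simp only [Matrix.mul_assoc, h1, Matrix.mul_one, Matrix.smul_mul, Matrix.one_mul] at h3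
    rw [← hdet, ← h3, hA]
    have := RingHom.map_adjugate (Int.castRingHom ℝ) M'
    simpa using this.symm
  refine ⟨M'.det, ?_, fun i j => ⟨M'.adjugate i j, ?_⟩⟩
  · intro h0
    have h4 := congrArg Matrix.det h1
    rw [Matrix.det_mul, hdet, h0] at h4
    simp at h4
  · have := congrFun (congrFun hadj i) j
    simpa [Module.Basis.toMatrix_apply] using this

/-- extension of independent rational vectors to a basis with almost integral coordinates. -/
theorem aux_basis {d : ℕ} (Λ : AddSubgroup (Vd d)) (hΛ : IsFullLattice Λ)
    (k : ℕ) (v : Fin k → Vd d)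
    (hvind : LinearIndependent ℝ v) (hvrat : ∀ i, IsRatPoint Λ (v i)) :
    ∃ (n : ℕ) (w : Module.Basis (Fin n) ℝ (Vd d)) (f : Fin k → Fin n) (N : ℝ), 0 < N ∧
      (∀ i, w (f i) = v i) ∧ ∀ x ∈ Λ, ∀ j, ∃ z : ℤ, N * w.repr x j = z := by
  obtain ⟨⟨n, b, hb, hcl⟩, hspan⟩ := hΛ
  have hbspan : ⊤ ≤ Submodule.span ℝ (Set.range b) := by
    rw [← hspan, Submodule.span_le, hcl]
    intro x hx
    have : AddSubgroup.closure (Set.range b) ≤ (Submodule.span ℝ (Set.range b)).toAddSubgroup := by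
      rw [AddSubgroup.closure_le]
      exact Submodule.subset_span
    exact this hx
  let B := Module.Basis.mk hb hbspan
  have hBint : ∀ x ∈ Λ, ∀ i, ∃ z : ℤ, B.repr x i = z := by
    intro x hx
    rw [hcl] at hx
    induction hx using AddSubgroup.closure_induction with
    | mem x hx =>
      obtain ⟨l, rfl⟩ := hx
      intro i
      have : b l = B l := by simp [B]
      rw [this, Module.Basis.repr_self]
      by_cases h : l = i
      · exact ⟨1, by simp [h]⟩
      · exact ⟨0, by simp [h]⟩
    | zero => exact fun i => ⟨0, by simp⟩
    | add x y _ _ hx hy =>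
      intro i
      obtain ⟨a, ha⟩ := hx i
      obtain ⟨c, hc⟩ := hy i
      exact ⟨a + c, by simp [ha, hc]⟩
    | neg x _ hx =>
      intro i
      obtain ⟨a, ha⟩ := hx i
      exact ⟨-a, by simp [ha]⟩
  have hs : LinearIndepOn ℝ id (Set.range v) := hvind.linearIndepOn_id
  have hst : Set.range v ⊆ Set.range v ∪ (Λ : Set (Vd d)) := Set.subset_union_left
  have ht : ⊤ ≤ Submodule.span ℝ (Set.range v ∪ (Λ : Set (Vd d))) := by
    rw [← hspan]
    exact Submodule.span_mono Set.subset_union_right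
  let w0 := Module.Basis.extendLe hs hst ht
  have hw0 : ∀ j, IsRatPoint Λ (w0 j) := by
    intro j
    have h1 : w0 j ∈ Set.range v ∪ (Λ : Set (Vd d)) :=
      Module.Basis.extendLe_subset hs hst ht ⟨j, rfl⟩
    rcases h1 with ⟨i, hi⟩ | h1
    · rw [← hi]; exact hvrat i
    · exact ⟨1, one_ne_zero, by simpa using h1⟩
  have hv0 : ∀ i, ∃ j, w0 j = v i := fun i =>
    Module.Basis.subset_extendLe hs hst ht ⟨i, rfl⟩
  let w := w0.reindex (w0.indexEquiv B)
  have hw : ∀ j, IsRatPoint Λ (w j) := fun j => by simpa [w] using hw0 _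
  have hv : ∀ i, ∃ j, w j = v i := by
    intro i
    obtain ⟨j, hj⟩ := hv0 i
    exact ⟨w0.indexEquiv B j, by simp [w, hj]⟩
  choose f hf using hv
  choose q hq0 hq using hw
  have hqu : ∀ j, IsUnit ((q j : ℝ)) := fun j => by
    rw [isUnit_iff_ne_zero]; exact_mod_cast hq0 j
  let w2 := w.isUnitSMul hqu
  have hw2 : ∀ j, w2 j = (q j : ℝ) • w j := fun j => w.isUnitSMul_apply hqu j
  obtain ⟨N, hN0, hN⟩ := aux_inv_int B w2 (fun j i => by
    rw [hw2]; exact hBint _ (hq j) i)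
  have hN' : ∀ x ∈ Λ, ∀ j, ∃ z : ℤ, (N : ℝ) * w2.repr x j = z := by
    intro x hx j
    choose c hc using hBint x hx
    choose z hz using hN j
    refine ⟨∑ l, c l * z l, ?_⟩
    conv_lhs => rw [← B.sum_repr x]
    simp only [map_sum, map_smul, Finsupp.coe_finsetSum, Finset.sum_apply, Finsupp.smul_apply,
      smul_eq_mul, Finset.mul_sum]
    push_cast
    refine Finset.sum_congr rfl fun l _ => ?_
    rw [hc, ← hz]; ring
  have hrel : ∀ x j, w.repr x j = q j * w2.repr x j := by
    intro x j
    conv_lhs => rw [← w2.sum_repr x]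
    simp only [map_sum, map_smul, Finsupp.coe_finsetSum, Finset.sum_apply, Finsupp.smul_apply,
      smul_eq_mul, hw2, Module.Basis.repr_self]
    rw [Finset.sum_eq_single j]
    · simp [mul_comm]
    · intro l _ hl; simp [hl]
    · simp
  refine ⟨n, w, f, (N : ℝ) ^ 2, ?_, hf, ?_⟩
  · have : (N : ℝ) ≠ 0 := by exact_mod_cast hN0
    positivity
  · intro x hx j
    obtain ⟨z, hz⟩ := hN' x hx j
    refine ⟨N * q j * z, ?_⟩
    rw [hrel]; push_cast; rw [← hz]; ring

/-- representation of a linear functional by the pairing. -/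
theorem aux_riesz {d : ℕ} (l : Vd d →ₗ[ℝ] ℝ) : ∃ φ : Vd d, ∀ x, pairE φ x = l x := by
  refine ⟨(InnerProductSpace.toDual ℝ (Vd d)).symm l.toContinuousLinearMap, fun x => ?_⟩
  simp [pairE]

theorem aux_poly {d : ℕ} (Λ : AddSubgroup (Vd d)) (hΛ : IsFullLattice Λ)
    (k : ℕ) (v : Fin k → Vd d)
    (hvind : LinearIndependent ℝ v) (hvrat : ∀ i, IsRatPoint Λ (v i)) :
    IsRatPolyhedron Λ {x | ∃ t : Fin k → ℝ, (∀ i, 0 ≤ t i) ∧ x = ∑ i, t i • v i} := by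
  obtain ⟨n, w, f, N, hN, hf, hint⟩ := aux_basis Λ hΛ k v hvind hvrat
  have hfinj : Function.Injective f := by
    intro i j hij
    apply hvind.injective
    rw [← hf, ← hf, hij]
  choose φ hφ using fun j => aux_riesz (N • w.coord j)
  have hφ' : ∀ j x, pairE (φ j) x = N * w.repr x j := fun j x => by simp [hφ]
  classical
  let ψ : Fin n → Vd d := fun j => if j ∈ Set.range f then 0 else φ j
  have hψint : ∀ j, IsDualIntegral Λ (φ j) := fun j x hx => by
    rw [hφ']; exact hint x hx j
  have h0 : ∀ x : Vd d, pairE 0 x = 0 := fun x => by simp [pairE]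
  have hneg : ∀ y x : Vd d, pairE (-y) x = - pairE y x := fun y x => by simp [pairE]
  refine ⟨n + n, Fin.append (fun j => - φ j) ψ, fun _ => 0, ?_, ?_⟩
  · intro i
    refine Fin.addCases (fun j => ?_) (fun j => ?_) i
    · intro x hx
      obtain ⟨z, hz⟩ := hψint j x hx
      exact ⟨-z, by simp [hneg, hz]⟩
    · intro x hx
      rw [Fin.append_right]
      by_cases hj : j ∈ Set.range f
      · exact ⟨0, by simp only [ψ, hj, if_true, h0]; simp⟩
      · simp only [ψ, hj, if_false]; exact hψint j x hx
  · ext x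
    simp only [Set.mem_setOf_eq, hΛ.2, Submodule.mem_top, true_and]
    constructor
    · rintro ⟨t, ht, rfl⟩ i
      have hrep : ∀ j, w.repr (∑ i, t i • v i) j = ∑ i, if f i = j then t i else 0 := by
        intro j
        simp only [map_sum, map_smul, Finsupp.coe_finsetSum, Finset.sum_apply,
          Finsupp.smul_apply, smul_eq_mul, ← hf, Module.Basis.repr_self, Finsupp.single_apply]
        simp
      refine Fin.addCases (fun j => ?_) (fun j => ?_) i
      · simp only [Fin.append_left, hneg, hφ', hrep]
        have : 0 ≤ ∑ i, if f i = j then t i else 0 :=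
          Finset.sum_nonneg fun i _ => by split_ifs <;> simp [ht]
        have := mul_nonneg hN.le this
        simpa using this
      · rw [Fin.append_right]
        by_cases hj : j ∈ Set.range f
        · simp only [ψ, hj, if_true, h0]; simp
        · simp only [ψ, hj, if_false, hφ', hrep]
          rw [Finset.sum_eq_zero]
          · simp
          · intro i _
            rw [if_neg]
            rintro rfl
            exact hj ⟨i, rfl⟩
    · intro h
      have h1 : ∀ j, 0 ≤ w.repr x j := by
        intro j
        have := h (Fin.castAdd n j)
        simp only [Fin.append_left, hneg, hφ'] at this
        by_contra hc
        push Not at hc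
        have := mul_neg_of_pos_of_neg hN hc
        simp at *
        linarith
      have h2 : ∀ j, j ∉ Set.range f → w.repr x j = 0 := by
        intro j hj
        have := h (Fin.natAdd n j)
        rw [Fin.append_right] at this
        simp only [ψ, hj, if_false, hφ'] at this
        have h3 := h1 j
        by_contra hc
        have h4 : 0 < w.repr x j := lt_of_le_of_ne h3 (Ne.symm hc)
        have := mul_pos hN h4
        simp at *
        linarith
      refine ⟨fun i => w.repr x (f i), fun i => h1 _, ?_⟩
      conv_lhs => rw [← w.sum_repr x]
      simp only [← hf]
      symm
      rw [← Finset.sum_image (f := fun j => w.repr x j • w j) (s := Finset.univ) (g := f)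
        (fun a _ b _ h => hfinj h)]
      apply Finset.sum_subset (Finset.subset_univ _)
      intro j _ hj
      rw [h2 j, zero_smul]
      rintro ⟨i, rfl⟩
      exact hj (by simp)

theorem aux_dir {d : ℕ} (k : ℕ) (v : Fin k → Vd d) (hvind : LinearIndependent ℝ v) :
    ∃ ξ : Vd d, ∀ i, pairE ξ (v i) < 0 := by
  let B := Module.Basis.span hvind
  obtain ⟨l, hl⟩ := LinearMap.exists_extend (B.constr ℝ (fun _ => (-1 : ℝ)))
  obtain ⟨φ, hφ⟩ := aux_riesz l
  refine ⟨φ, fun i => ?_⟩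
  have h := LinearMap.congr_fun hl (B i)
  rw [Module.Basis.constr_basis] at h
  have hB : ((B i : Submodule.span ℝ (Set.range v)) : Vd d) = v i := by
    simp [B, Module.Basis.span_apply]
  simp only [LinearMap.comp_apply, Submodule.subtype_apply, hB] at h
  rw [hφ, h]; norm_num

theorem aux_affineSpan {d : ℕ} (k : ℕ) (v : Fin k → Vd d) :
    ((affineSpan ℝ {x : Vd d | ∃ t : Fin k → ℝ, (∀ i, 0 ≤ t i) ∧ x = ∑ i, t i • v i} :
      AffineSubspace ℝ (Vd d)) : Set (Vd d)) = Submodule.span ℝ (Set.range v) := by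
  classical
  set P := {x : Vd d | ∃ t : Fin k → ℝ, (∀ i, 0 ≤ t i) ∧ x = ∑ i, t i • v i} with hP
  have h0 : (0 : Vd d) ∈ P := ⟨0, by simp, by simp⟩
  have hvP : ∀ i, v i ∈ P := fun i => ⟨Pi.single i 1, fun j => by
    by_cases h : j = i
    · subst h; simp
    · simp [h], by simp [Pi.single_apply]⟩
  have h1 : P ⊆ Submodule.span ℝ (Set.range v) := by
    rintro x ⟨t, _, rfl⟩
    exact Submodule.sum_mem _ fun i _ => Submodule.smul_mem _ _ (Submodule.subset_span ⟨i, rfl⟩)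
  apply Set.Subset.antisymm
  · have : affineSpan ℝ P ≤ (Submodule.span ℝ (Set.range v)).toAffineSubspace :=
      affineSpan_le.2 h1
    exact this
  · intro x hx
    have h2 : (0 : Vd d) ∈ affineSpan ℝ P := subset_affineSpan ℝ P h0
    have h3 : Submodule.span ℝ (Set.range v) ≤ (affineSpan ℝ P).direction := by
      rw [Submodule.span_le]
      rintro _ ⟨i, rfl⟩
      have := AffineSubspace.vsub_mem_direction (subset_affineSpan ℝ P (hvP i)) h2
      simpa using this
    have := AffineSubspace.vadd_mem_of_mem_direction (h3 hx) h2
    simpa using this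

/-- the canonical measure is a multiple of the image of Lebesgue measure. -/
theorem aux_measure {d : ℕ} (Λ : AddSubgroup (Vd d)) (k : ℕ) (v : Fin k → Vd d)
    (hvind : LinearIndependent ℝ v) (m : Measure (Vd d))
    (hm : IsCanonicalMeasure Λ
      ((Submodule.span ℝ (Set.range v) : Submodule ℝ (Vd d)) : Set (Vd d)) m) :
    ∃ c : ENNReal, c ≠ ⊤ ∧
      m = c • Measure.map (fun t : Fin k → ℝ => ∑ i, t i • v i) volume := by
  obtain ⟨k', x₀, u, hx₀, -, hu, hA, -, rfl⟩ := hm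
  have hspan : Submodule.span ℝ (Set.range u) = Submodule.span ℝ (Set.range v) := by
    ext x
    rw [Submodule.mem_span_range_iff_exists_fun]
    constructor
    · rintro ⟨t, rfl⟩
      have h1 : x₀ + ∑ i, t i • u i ∈ (Submodule.span ℝ (Set.range v) : Set (Vd d)) := by
        rw [hA]; exact ⟨t, rfl⟩
      simpa using Submodule.sub_mem _ h1 hx₀
    · intro hx
      have h1 : x₀ + x ∈ (Submodule.span ℝ (Set.range v) : Set (Vd d)) :=
        Submodule.add_mem _ hx₀ hx
      rw [hA] at h1
      obtain ⟨t, ht⟩ := h1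
      exact ⟨t, (add_left_cancel ht).symm⟩
  have hkk : k' = k := by
    have h1 := finrank_span_eq_card hu
    have h2 := finrank_span_eq_card hvind
    rw [hspan, h2] at h1
    simpa using h1.symm
  subst hkk
  have hex : ∀ x ∈ Submodule.span ℝ (Set.range v), ∃ t : Fin k' → ℝ, ∑ i, t i • v i = x :=
    fun x hx => (Submodule.mem_span_range_iff_exists_fun ℝ).1 hx
  obtain ⟨t₀, ht₀⟩ := hex x₀ hx₀
  have hex2 : ∀ i, ∃ t : Fin k' → ℝ, ∑ j, t j • v j = u i := fun i =>
    hex _ (hspan ▸ Submodule.subset_span ⟨i, rfl⟩)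
  choose A hAu using hex2
  let Lv : (Fin k' → ℝ) →ₗ[ℝ] Vd d := Fintype.linearCombination ℝ v
  let Lu : (Fin k' → ℝ) →ₗ[ℝ] Vd d := Fintype.linearCombination ℝ u
  let L : (Fin k' → ℝ) →ₗ[ℝ] (Fin k' → ℝ) := Fintype.linearCombination ℝ A
  have hLv : ∀ t, Lv t = ∑ i, t i • v i := fun t => rfl
  have hLu : ∀ t, Lu t = ∑ i, t i • u i := fun t => rfl
  have hcomp : ∀ t, Lv (L t) = Lu t := by
    intro t
    have h1 : L t = ∑ i, t i • A i := rfl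
    rw [h1, map_sum, hLu]
    exact Finset.sum_congr rfl fun i _ => by rw [map_smul, hLv, hAu]
  have hLuinj : Function.Injective Lu := hu.fintypeLinearCombination_injective
  have hLinj : Function.Injective L := by
    intro a b hab
    apply hLuinj
    rw [← hcomp, ← hcomp, hab]
  have hdet : LinearMap.det L ≠ 0 := by
    have := LinearEquiv.isUnit_det' (LinearEquiv.ofInjectiveEndo L hLinj)
    exact this.ne_zero
  have hLc : Measurable L := (LinearMap.continuous_of_finiteDimensional L).measurable
  have hLvc : Measurable Lv := (LinearMap.continuous_of_finiteDimensional Lv).measurable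
  have hmap := Real.map_linearMap_volume_pi_eq_smul_volume_pi hdet
  refine ⟨ENNReal.ofReal |(LinearMap.det L)⁻¹|, ENNReal.ofReal_ne_top, ?_⟩
  have hfun : (fun t : Fin k' → ℝ => x₀ + ∑ i, t i • u i) =
      Lv ∘ ((fun s => t₀ + s) ∘ L) := by
    funext t
    simp only [Function.comp_apply, map_add, hcomp]
    rw [hLv, ht₀, hLu]
  rw [hfun, ← Measure.map_map hLvc ((measurable_const_add t₀).comp hLc),
    ← Measure.map_map (measurable_const_add t₀) hLc, hmap, Measure.map_smul,
    MeasureTheory.map_add_left_eq_self, Measure.map_smul]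
  rfl

theorem aux_integral {k : ℕ} (a : Fin k → ℝ) (ha : ∀ i, a i < 0) :
    IntegrableOn (fun t : Fin k → ℝ => Real.exp (∑ i, t i * a i)) (Set.univ.pi fun _ => Set.Ici 0) ∧
    ∫ t in (Set.univ.pi fun _ => Set.Ici 0), Real.exp (∑ i, t i * a i) =
      ∏ i, (-1 / a i) := by
  have hint : ∀ i, Integrable (fun x : ℝ => Real.exp (a i * x)) (volume.restrict (Set.Ici 0)) :=
    fun i => (integrableOn_Ici_iff_integrableOn_Ioi).2 (integrableOn_exp_mul_Ioi (ha i) 0)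
  have hfun : (fun t : Fin k → ℝ => Real.exp (∑ i, t i * a i)) =
      fun t => ∏ i, Real.exp (a i * t i) := by
    funext t
    rw [Real.exp_sum]
    simp_rw [mul_comm]
  rw [hfun, IntegrableOn, volume_pi, Measure.restrict_pi_pi]
  refine ⟨Integrable.fintype_prod hint, ?_⟩
  rw [integral_fintype_prod_eq_prod (f := fun i x => Real.exp (a i * x))]
  refine Finset.prod_congr rfl fun i _ => ?_
  rw [integral_Ici_eq_integral_Ioi, integral_exp_mul_Ioi (ha i)]
  simp

theorem aux_value {d : ℕ} (Λ : AddSubgroup (Vd d)) (k : ℕ) (v : Fin k → Vd d)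
    (hvind : LinearIndependent ℝ v) (m : Measure (Vd d))
    (hm : IsCanonicalMeasure Λ
      ((Submodule.span ℝ (Set.range v) : Submodule ℝ (Vd d)) : Set (Vd d)) m)
    (ξ : Vd d) (hξ : ∀ i, pairE ξ (v i) < 0) :
    IntegrableOn (fun x => Real.exp (pairE ξ x))
      {x | ∃ t : Fin k → ℝ, (∀ i, 0 ≤ t i) ∧ x = ∑ i, t i • v i} m ∧
    ∫ x in {x | ∃ t : Fin k → ℝ, (∀ i, 0 ≤ t i) ∧ x = ∑ i, t i • v i},
      Real.exp (pairE ξ x) ∂m = (-1 : ℝ) ^ k *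
        (m {x | ∃ t : Fin k → ℝ, (∀ i, 0 ≤ t i ∧ t i < 1) ∧ x = ∑ i, t i • v i}).toReal /
        ∏ i, pairE ξ (v i) := by
  obtain ⟨c, hc, rfl⟩ := aux_measure Λ k v hvind m hm
  let Lv : (Fin k → ℝ) →ₗ[ℝ] Vd d := Fintype.linearCombination ℝ v
  have hLv : (fun t : Fin k → ℝ => ∑ i, t i • v i) = Lv := rfl
  have hinj : Function.Injective Lv := hvind.fintypeLinearCombination_injective
  have hemb : MeasurableEmbedding Lv :=
    (LinearMap.isClosedEmbedding_of_injective (LinearMap.ker_eq_bot.2 hinj)).measurableEmbedding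
  have hpre1 : Lv ⁻¹' {x | ∃ t : Fin k → ℝ, (∀ i, 0 ≤ t i) ∧ x = ∑ i, t i • v i} =
      Set.univ.pi fun _ => Set.Ici 0 := by
    ext t
    simp only [Set.mem_preimage, Set.mem_setOf_eq, Set.mem_univ_pi, Set.mem_Ici]
    constructor
    · rintro ⟨s, hs, h⟩
      have : t = s := hinj h
      rw [this]; exact hs
    · exact fun h => ⟨t, h, rfl⟩
  have hpre2 : Lv ⁻¹' {x | ∃ t : Fin k → ℝ, (∀ i, 0 ≤ t i ∧ t i < 1) ∧ x = ∑ i, t i • v i} =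
      Set.univ.pi fun _ => Set.Ico 0 1 := by
    ext t
    simp only [Set.mem_preimage, Set.mem_setOf_eq, Set.mem_univ_pi, Set.mem_Ico]
    constructor
    · rintro ⟨s, hs, h⟩
      have : t = s := hinj h
      rw [this]; exact hs
    · exact fun h => ⟨t, h, rfl⟩
  have hpair : ∀ t, pairE ξ (Lv t) = ∑ i, t i * pairE ξ (v i) := by
    intro t
    change inner ℝ ξ (∑ i, t i • v i) = _
    simp only [inner_sum, inner_smul_right, pairE]
  obtain ⟨h1, h2⟩ := aux_integral (fun i => pairE ξ (v i)) hξ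
  rw [hLv]
  constructor
  · rw [IntegrableOn, Measure.restrict_smul]
    refine Integrable.smul_measure ?_ hc
    rw [← IntegrableOn, hemb.integrableOn_map_iff, hpre1]
    refine h1.congr_fun (fun t _ => ?_) (MeasurableSet.univ_pi fun _ => measurableSet_Ici)
    simp [hpair]
  · rw [Measure.restrict_smul, integral_smul_measure, hemb.setIntegral_map, hpre1]
    simp only [hpair]
    rw [h2, Measure.smul_apply, hemb.map_apply, hpre2, volume_pi_pi]
    simp only [Finset.prod_div_distrib, Finset.prod_const]
    simp
    ring

/-- for a simplicial cone `c` generated by `k ≤ d` linearly independent rational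
vectors `v₁,…,v_k`, the meromorphic function `I(c)` is the rational function
`(−1)^k vol(□(v₁,…,v_k)) / ∏ᵢ ⟨ξ, vᵢ⟩`, where the relative volume of the semi-open
parallelepiped is computed with the canonical lattice measure on the span of the `vᵢ`. -/
theorem statement1 (d : ℕ) (Λ : AddSubgroup (Vd d)) (hΛ : IsFullLattice Λ)
    (I : Set (Vd d) → Vd d → ℝ) (hI : IsIMap Λ I)
    (k : ℕ) (hk : k ≤ d) (v : Fin k → Vd d)
    (hvind : LinearIndependent ℝ v) (hvrat : ∀ i, IsRatPoint Λ (v i))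
    (m : MeasureTheory.Measure (Vd d))
    (hm : IsCanonicalMeasure Λ
      ((Submodule.span ℝ (Set.range v) : Submodule ℝ (Vd d)) : Set (Vd d)) m) :
    MeroEqAt0
      (I {x | ∃ t : Fin k → ℝ, (∀ i, 0 ≤ t i) ∧ x = ∑ i, t i • v i})
      (fun ξ => (-1 : ℝ) ^ k *
        (m {x | ∃ t : Fin k → ℝ, (∀ i, 0 ≤ t i ∧ t i < 1) ∧ x = ∑ i, t i • v i}).toReal /
        ∏ i, pairE ξ (v i)) := by
  set c := (-1 : ℝ) ^ k *
        (m {x | ∃ t : Fin k → ℝ, (∀ i, 0 ≤ t i ∧ t i < 1) ∧ x = ∑ i, t i • v i}).toReal with hc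
  have hpoly := aux_poly Λ hΛ k v hvind hvrat
  set P := {x | ∃ t : Fin k → ℝ, (∀ i, 0 ≤ t i) ∧ x = ∑ i, t i • v i} with hP
  set D : Vd d → ℝ := fun ξ => ∏ i, pairE ξ (v i) with hD
  set C : Set (Vd d) := {ξ | ∀ i, pairE ξ (v i) < 0} with hC
  have hval : ∀ ξ ∈ C, I P ξ = c / D ξ := by
    intro ξ hξ
    obtain ⟨h1, h2⟩ := aux_value Λ k v hvind m hm ξ hξ
    rw [hI.2.2 P hpoly m (by rw [hP, aux_affineSpan]; exact hm) ξ h1, h2]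
  have hcont : ∀ i, Continuous fun ξ : Vd d => pairE ξ (v i) := fun i => by
    unfold pairE; fun_prop
  have hCopen : IsOpen C := by
    have : C = ⋂ i, {ξ | pairE ξ (v i) < 0} := by ext; simp [hC]
    rw [this]
    exact isOpen_iInter_of_finite fun i => isOpen_lt (hcont i) continuous_const
  have hDC : ∀ ξ ∈ C, D ξ ≠ 0 := fun ξ hξ => Finset.prod_ne_zero_iff.2 fun i _ => (hξ i).ne
  have hDan : ∀ ξ, AnalyticAt ℝ D ξ := by
    intro ξ
    apply Finset.analyticAt_fun_prod
    intro i _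
    have : (fun ξ : Vd d => pairE ξ (v i)) = innerSL ℝ (v i) := by
      funext x; simp [pairE, real_inner_comm]
    rw [this]
    exact ContinuousLinearMap.analyticAt _ _
  obtain ⟨g, h, ⟨pg, hg, -⟩, ⟨ph, hh, -⟩, hne, hfg⟩ := hI.1 P hpoly
  obtain ⟨r, hr, hball⟩ := Metric.eventually_nhds_iff_ball.1
    ((hg.analyticAt.eventually_analyticAt).and ((hh.analyticAt.eventually_analyticAt).and hfg))
  set U := Metric.ball (0 : Vd d) r with hU
  have hUconn : IsPreconnected U := (convex_ball _ _).isPreconnected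
  have hgU : AnalyticOnNhd ℝ g U := fun x hx => (hball x hx).1
  have hhU : AnalyticOnNhd ℝ h U := fun x hx => (hball x hx).2.1
  have hDU : AnalyticOnNhd ℝ D U := fun x _ => hDan x
  have hUn : U ∈ 𝓝 (0 : Vd d) := Metric.ball_mem_nhds _ hr
  have hUC : ∃ ξ ∈ U, ξ ∈ C := by
    obtain ⟨ξ, hξ⟩ := aux_dir k v hvind
    have ht : Tendsto (fun ε : ℝ => ε • ξ) (𝓝[>] 0) (𝓝 0) := by
      have : Tendsto (fun ε : ℝ => ε • ξ) (𝓝 0) (𝓝 ((0 : ℝ) • ξ)) :=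
        (continuous_id.smul continuous_const).tendsto 0
      rw [zero_smul] at this
      exact this.mono_left nhdsWithin_le_nhds
    obtain ⟨ε, h1, h2⟩ := ((ht.eventually hUn).and self_mem_nhdsWithin).exists
    refine ⟨ε • ξ, h1, fun i => ?_⟩
    have : pairE (ε • ξ) (v i) = ε * pairE ξ (v i) := by simp [pairE, inner_smul_left]
    rw [this]
    exact mul_neg_of_pos_of_neg h2 (hξ i)
  have hpt : ∃ ξ ∈ U, ξ ∈ C ∧ h ξ ≠ 0 := by
    by_contra hcon
    push Not at hcon
    obtain ⟨ξ, hξU, hξC⟩ := hUC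
    have hz : h =ᶠ[𝓝 ξ] 0 := by
      filter_upwards [Metric.isOpen_ball.mem_nhds hξU, hCopen.mem_nhds hξC] with y h1 h2
      exact hcon y h1 h2
    have := hhU.eqOn_zero_of_preconnected_of_eventuallyEq_zero hUconn hξU hz
    exact hne (by filter_upwards [hUn] with y hy using this hy)
  obtain ⟨ξ, hξU, hξC, hξh⟩ := hpt
  have hid : Set.EqOn (fun y => c * h y) (fun y => g y * D y) U := by
    refine AnalyticOnNhd.eqOn_of_preconnected_of_eventuallyEq
      (fun y hy => analyticAt_const.mul (hhU y hy)) (fun y hy => (hgU y hy).mul (hDU y hy))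
      hUconn hξU ?_
    filter_upwards [Metric.isOpen_ball.mem_nhds hξU, hCopen.mem_nhds hξC,
      (hhU ξ hξU).continuousAt.eventually_ne hξh] with y h1 h2 h3
    have h4 := (hball y h1).2.2 h3
    rw [hval y h2] at h4
    have := hDC y h2
    rw [← h4]
    field_simp
  refine ⟨Metric.closedBall 0 (r / 2) ∩ (fun y => h y * D y) ⁻¹' {0}, ?_, ?_, ?_⟩
  · refine ContinuousOn.preimage_isClosed_of_isClosed ?_ Metric.isClosed_closedBall
      isClosed_singleton
    intro y hy
    have hy' : y ∈ U := Metric.closedBall_subset_ball (by linarith) hy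
    exact ((hhU y hy').mul (hDU y hy')).continuousAt.continuousWithinAt
  · rw [Set.eq_empty_iff_forall_notMem]
    intro y hy
    have hyn := mem_interior_iff_mem_nhds.1 hy
    have hy' : y ∈ U := Metric.closedBall_subset_ball (by linarith) (interior_subset hy).1
    have hz : (fun y => h y * D y) =ᶠ[𝓝 y] 0 := by
      filter_upwards [hyn] with x hx using hx.2
    have := AnalyticOnNhd.eqOn_zero_of_preconnected_of_eventuallyEq_zero
      (fun y hy => (hhU y hy).mul (hDU y hy)) hUconn hy' hz hξU
    exact mul_ne_zero hξh (hDC ξ hξC) this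
  · filter_upwards [Metric.closedBall_mem_nhds (0 : Vd d) (half_pos hr)] with y hy hyZ
    have hy' : y ∈ U := Metric.closedBall_subset_ball (by linarith) hy
    have hne' : h y * D y ≠ 0 := fun h0 => hyZ ⟨hy, h0⟩
    have h1 : h y ≠ 0 := left_ne_zero_of_mul hne'
    have h2 : D y ≠ 0 := right_ne_zero_of_mul hne'
    have h3 := (hball y hy').2.2 h1
    have h4 : c * h y = g y * D y := hid hy'
    change I P y = c / D y
    rw [eq_div_iff h2]
    apply mul_right_cancel₀ h1
    rw [h4, ← h3]; ring
end
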